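/- Let 2 ≤ k ≤ n and α > 0. Suppose u ∈ C⁴(ℝⁿ) is an entire (k−1)-convex and semi-convex solution of σ_k(λ(D²u)) + α σ_{k−1}(λ(D²u)) = 1 on all of ℝⁿ, and u satisfies the quadratic growth condition. Then u is a quadratic polynomial: there exist a symmetric n×n real matrix A, a vector b ∈ ℝⁿ, and c ∈ ℝ such that u(x) = ½⟨Ax, x⟩ + ⟨b, x⟩ + c for all x ∈ ℝⁿ. -/

import Mathlib

open scoped BigOperators

noncomputable section

/-- The `j`-th elementary symmetric function of the entries of `lam` indexed by `T`
(`j : ℤ`, with value `0` for `j < 0`). -/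
def sigmaOn {n : ℕ} (T : Finset (Fin n)) (j : ℤ) (lam : Fin n → ℝ) : ℝ :=
  if 0 ≤ j then ∑ s ∈ T.powersetCard j.toNat, ∏ i ∈ s, lam i else 0

/-- The `j`-th elementary symmetric polynomial `σ_j(λ)`. -/
def esymmR {n : ℕ} (j : ℤ) (lam : Fin n → ℝ) : ℝ := sigmaOn Finset.univ j lam

/-- The Garding cone `Γ_k`. -/
def GammaCone (n k : ℕ) : Set (Fin n → ℝ) :=
  {lam | ∀ i : ℕ, 1 ≤ i → i ≤ k → 0 < esymmR (i : ℤ) lam}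

/-- The Hessian matrix `D²u(x)`. -/
def hess {n : ℕ} (u : (Fin n → ℝ) → ℝ) (x : Fin n → ℝ) : Matrix (Fin n) (Fin n) ℝ :=
  Matrix.of fun i j => iteratedFDeriv ℝ 2 u x ![Pi.single i 1, Pi.single j 1]

/-- Euclidean norm on `Fin n → ℝ`. -/
def eucNorm {n : ℕ} (x : Fin n → ℝ) : ℝ := Real.sqrt (∑ i, (x i) ^ 2)



/-- Elementary symmetric function over a finset. -/
def es {ι : Type*} (T : Finset ι) (j : ℕ) (l : ι → ℝ) : ℝ :=
  ∑ s ∈ T.powersetCard j, ∏ i ∈ s, l i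

section esbasic
variable {ι : Type*} [DecidableEq ι]

lemma es_zero (T : Finset ι) (l : ι → ℝ) : es T 0 l = 1 := by simp [es]

lemma es_insert (T : Finset ι) {i : ι} (hi : i ∉ T) (j : ℕ) (l : ι → ℝ) :
    es (insert i T) (j + 1) l = es T (j + 1) l + l i * es T j l := by
  unfold es
  rw [Finset.powersetCard_succ_insert hi, Finset.sum_union]
  · congr 1
    rw [Finset.sum_image, Finset.mul_sum]
    · refine Finset.sum_congr rfl fun s hs => ?_
      rw [Finset.prod_insert]
      intro h
      exact hi ((Finset.mem_powersetCard.1 hs).1 h)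
    · intro s hs t ht hst
      have h1 : i ∉ s := fun h => hi ((Finset.mem_powersetCard.1 hs).1 h)
      have h2 : i ∉ t := fun h => hi ((Finset.mem_powersetCard.1 ht).1 h)
      have := congrArg (fun u => Finset.erase u i) hst
      simpa [Finset.erase_insert h1, Finset.erase_insert h2] using this
  · rw [Finset.disjoint_left]
    intro s hs hs'
    obtain ⟨t, ht, rfl⟩ := Finset.mem_image.1 hs'
    exact hi ((Finset.mem_powersetCard.1 hs).1 (Finset.mem_insert_self i t))

lemma es_erase (T : Finset ι) {i : ι} (hi : i ∈ T) (j : ℕ) (l : ι → ℝ) :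
    es T (j + 1) l = es (T.erase i) (j + 1) l + l i * es (T.erase i) j l := by
  conv_lhs => rw [← Finset.insert_erase hi]
  exact es_insert _ (Finset.notMem_erase i T) j l

/-- generating polynomial -/
def gp (T : Finset ι) (l : ι → ℝ) : Polynomial ℝ :=
  ∏ i ∈ T, (1 + Polynomial.C (l i) * Polynomial.X)

lemma gp_coeff (T : Finset ι) (l : ι → ℝ) (j : ℕ) : (gp T l).coeff j = es T j l := by
  induction T using Finset.induction_on generalizing j with
  | empty =>
    cases j with
    | zero => simp [gp, es]
    | succ j =>
      have : Finset.powersetCard (j+1) (∅ : Finset ι) = ∅ :=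
        Finset.powersetCard_eq_empty.2 (by simp)
      simp [gp, es, Polynomial.coeff_one, this]
  | insert i T hi ih =>
    have : gp (insert i T) l = gp T l + Polynomial.C (l i) * (Polynomial.X * gp T l) := by
      unfold gp
      rw [Finset.prod_insert hi]; ring
    rw [this]
    cases j with
    | zero => simp [ih, es_zero]
    | succ j =>
      rw [es_insert T hi, Polynomial.coeff_add, Polynomial.coeff_C_mul, Polynomial.coeff_X_mul,
        ih, ih]

lemma es_euler (T : Finset ι) (l : ι → ℝ) (j : ℕ) :
    ∑ i ∈ T, l i * es (T.erase i) j l = (j + 1) * es T (j + 1) l := by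
  have h : (gp T l).derivative = ∑ i ∈ T, Polynomial.C (l i) * gp (T.erase i) l := by
    unfold gp
    rw [Polynomial.derivative_prod_finset]
    refine Finset.sum_congr rfl fun i hi => ?_
    rw [mul_comm]
    simp
  have h2 := congrArg (fun p => Polynomial.coeff p j) h
  simp only [Polynomial.coeff_derivative, Polynomial.finsetSum_coeff, Polynomial.coeff_C_mul,
    gp_coeff] at h2
  rw [← h2]; ring

lemma es_sum_erase (T : Finset ι) (l : ι → ℝ) (j : ℕ) :
    ∑ i ∈ T, es (T.erase i) j l = ((T.card : ℝ) - j) * es T j l := by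
  cases j with
  | zero => simp [es_zero]
  | succ j =>
    have h := es_euler T l j
    have h2 : ∑ i ∈ T, es T (j+1) l = ∑ i ∈ T, (es (T.erase i) (j+1) l + l i * es (T.erase i) j l) :=
      Finset.sum_congr rfl fun i hi => es_erase T hi j l
    rw [Finset.sum_add_distrib, h] at h2
    simp only [Finset.sum_const, nsmul_eq_mul] at h2
    push_cast
    linarith

lemma splits_derivative {p : Polynomial ℝ} (hp : p.Splits) : p.derivative.Splits := by
  by_cases h0 : p.natDegree = 0
  · rw [Polynomial.derivative_of_natDegree_zero h0]; exact Polynomial.Splits.zero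
  have h1 := Polynomial.card_roots_le_derivative p
  have h2 : p.roots.card = p.natDegree := hp.natDegree_eq_card_roots.symm
  have h3 : p.derivative.natDegree ≤ p.natDegree - 1 := Polynomial.natDegree_derivative_le p
  have h4 := Polynomial.card_roots' p.derivative
  rw [Polynomial.splits_iff_card_roots]
  omega

lemma laguerre_aux (p q : Polynomial ℝ) (x : ℝ)
    (hp : p.eval x * p.derivative.derivative.eval x ≤ (p.derivative.eval x)^2)
    (hq : q.eval x * q.derivative.derivative.eval x ≤ (q.derivative.eval x)^2) :
    (p*q).eval x * (p*q).derivative.derivative.eval x ≤ ((p*q).derivative.eval x)^2 := by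
  simp only [Polynomial.derivative_mul, Polynomial.derivative_add, Polynomial.eval_add,
    Polynomial.eval_mul]
  nlinarith [mul_le_mul_of_nonneg_left hp (sq_nonneg (q.eval x)),
    mul_le_mul_of_nonneg_left hq (sq_nonneg (p.eval x))]

lemma laguerre {p : Polynomial ℝ} (hp : p.Splits) (x : ℝ) :
    p.eval x * p.derivative.derivative.eval x ≤ (p.derivative.eval x)^2 := by
  rw [hp.eq_prod_roots]
  apply laguerre_aux
  · simp
  · generalize p.roots = s
    induction s using Multiset.induction_on with
    | empty => simp
    | cons a s ih =>
      rw [Multiset.map_cons, Multiset.prod_cons]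
      apply laguerre_aux _ _ _ _ ih
      simp

lemma gp_splits (T : Finset ι) (l : ι → ℝ) : (gp T l).Splits := by
  unfold gp
  apply Polynomial.Splits.prod
  intro i _
  apply Polynomial.Splits.of_natDegree_le_one
  rw [add_comm, ← Polynomial.C_1]
  exact Polynomial.natDegree_linear_le

lemma newton (T : Finset ι) (l : ι → ℝ) (j : ℕ) :
    es T j l * es T (j + 2) l ≤ es T (j + 1) l ^ 2 := by
  have hs : ∀ m : ℕ, (Polynomial.derivative^[m] (gp T l)).Splits := by
    intro m
    induction m with
    | zero => simpa using gp_splits T l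
    | succ m ih => rw [Function.iterate_succ_apply']; exact splits_derivative ih
  have h := laguerre (hs j) 0
  have e : ∀ m : ℕ, (Polynomial.derivative^[m] (gp T l)).eval 0 = (m.factorial : ℝ) * es T m l := by
    intro m
    rw [← Polynomial.coeff_zero_eq_eval_zero, Polynomial.coeff_iterate_derivative]
    simp [gp_coeff, Nat.descFactorial_self]
  rw [← Function.iterate_succ_apply' Polynomial.derivative, 
    ← Function.iterate_succ_apply' Polynomial.derivative, e, e, e] at h
  rw [Nat.factorial_succ (j+1), Nat.factorial_succ j] at h
  push_cast at h
  have hf : (0:ℝ) < (j.factorial : ℝ) := by exact_mod_cast j.factorial_pos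
  by_contra hc
  push Not at hc
  have hpos : 0 < es T j l * es T (j+2) l := lt_of_le_of_lt (sq_nonneg _) hc
  have h5 : ((j:ℝ)+1+1) * (es T j l * es T (j+2) l) ≤ ((j:ℝ)+1) * es T (j+1) l^2 := by
    have : (j.factorial : ℝ)^2 * ((j:ℝ)+1) * (((j:ℝ)+1+1) * (es T j l * es T (j+2) l)) ≤
      (j.factorial : ℝ)^2 * ((j:ℝ)+1) *(((j:ℝ)+1) * es T (j+1) l^2) := by
      nlinarith [h]
    exact le_of_mul_le_mul_left this (by positivity)
  nlinarith [h5, hpos, hc]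

/-- Garding cone over a finset -/
def Gam (T : Finset ι) (k : ℕ) (l : ι → ℝ) : Prop := ∀ j, j ≤ k → 0 < es T j l

lemma Gam.mono {T : Finset ι} {k m : ℕ} {l : ι → ℝ} (h : Gam T k l) (hm : m ≤ k) : Gam T m l :=
  fun j hj => h j (hj.trans hm)

lemma Gam.erase {T : Finset ι} {k : ℕ} {l : ι → ℝ} (h : Gam T (k+1) l) {i : ι} (hi : i ∈ T) :
    Gam (T.erase i) k l := by
  induction k with
  | zero =>
    intro j hj
    obtain rfl : j = 0 := by omega
    rw [es_zero]; norm_num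
  | succ k ih =>
    have ih' := ih (h.mono (by omega))
    intro j hj
    rcases Nat.lt_or_ge j (k+1) with hj1 | hj1
    · exact ih' j (by omega)
    obtain rfl : j = k + 1 := by omega
    have h0 := ih' k le_rfl
    have h1 := h (k+1) (by omega)
    have h2 := h (k+2) (by omega)
    rw [es_erase T hi] at h1 h2
    have hn := newton (T.erase i) l k
    by_contra hc
    push Not at hc
    set s0 := es (T.erase i) k l
    set s1 := es (T.erase i) (k+1) l
    set s2 := es (T.erase i) (k+2) l
    change 0 < s2 + l i * s1 at h2
    have hl : 0 < l i := by
      by_contra hl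
      nlinarith [mul_nonneg (neg_nonneg.2 (not_lt.1 hl)) h0.le]
    have a1 : 0 < s0 * s2 + l i * (s0 * s1) := by nlinarith [mul_pos h0 h2]
    nlinarith [mul_nonneg (neg_nonneg.2 hc) h1.le]

lemma es_quot_formula {T : Finset ι} {k : ℕ} {l : ι → ℝ} (h : Gam T (k+1) l) :
    ((k:ℝ)+2) * (es T (k+2) l / es T (k+1) l) =
      ∑ i ∈ T, (l i - (l i)^2 / (l i + es (T.erase i) (k+1) l / es (T.erase i) k l)) := by
  have hp := h (k+1) le_rfl
  have e := es_euler T l (k+1)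
  push_cast at e
  have : ((k:ℝ)+2) * (es T (k+2) l / es T (k+1) l) = ((k:ℝ)+1+1) * es T (k+1+1) l / es T (k+1) l := by
    ring_nf
  rw [this, ← e, Finset.sum_div]
  refine Finset.sum_congr rfl fun i hi => ?_
  have h0 := h.erase hi k le_rfl
  have e1 := es_erase T hi k l
  have hne : l i + es (T.erase i) (k+1) l / es (T.erase i) k l = es T (k+1) l / es (T.erase i) k l := by
    rw [e1]; field_simp; ring
  rw [hne]
  have e2 : es (T.erase i) (k+1) l = es T (k+1) l - l i * es (T.erase i) k l := by linarith
  rw [e2]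
  field_simp

lemma cs_aux {x y x' y' : ℝ} (h : 0 < y) (h' : 0 < y') :
    (x + x')^2 / (y + y') ≤ x^2/y + x'^2/y' := by
  rw [div_add_div _ _ h.ne' h'.ne', div_le_div_iff₀ (by positivity) (by positivity)]
  nlinarith [mul_pos h h', sq_nonneg (x*y' - x'*y), mul_nonneg (sq_nonneg (x*y' - x'*y)) h.le]

lemma quot_superadd (k : ℕ) : ∀ (T : Finset ι) (l m : ι → ℝ), Gam T k l → Gam T k m →
    Gam T k (l + m) ∧ es T (k+1) l / es T k l + es T (k+1) m / es T k m ≤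
      es T (k+1) (l+m) / es T k (l+m) := by
  induction k with
  | zero =>
    intro T l m _ _
    refine ⟨fun j hj => ?_, ?_⟩
    · obtain rfl : j = 0 := by omega
      rw [es_zero]; norm_num
    · have : ∀ l : ι → ℝ, es T 1 l = ∑ i ∈ T, l i := by
        intro l
        have := es_euler T l 0
        simp [es_zero] at this
        exact this.symm
      simp [es_zero, this, Finset.sum_add_distrib]
  | succ k ih =>
    intro T l m hl hm
    obtain ⟨g, hq⟩ := ih T l m (hl.mono (by omega)) (hm.mono (by omega))
    have g' : Gam T (k+1) (l+m) := by
      intro j hj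
      rcases Nat.lt_or_ge j (k+1) with hj1 | hj1
      · exact g j (by omega)
      obtain rfl : j = k + 1 := by omega
      have : 0 < es T (k+1) (l+m) / es T k (l+m) := lt_of_lt_of_le
        (add_pos (div_pos (hl _ le_rfl) (hl _ (by omega))) (div_pos (hm _ le_rfl) (hm _ (by omega)))) hq
      have h0 := g k le_rfl
      have := mul_pos this h0
      rwa [div_mul_cancel₀ _ h0.ne'] at this
    refine ⟨g', ?_⟩
    have key : ((k:ℝ)+2) * (es T (k+2) l / es T (k+1) l) + ((k:ℝ)+2) * (es T (k+2) m / es T (k+1) m)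
        ≤ ((k:ℝ)+2) * (es T (k+2) (l+m) / es T (k+1) (l+m)) := by
      rw [es_quot_formula hl, es_quot_formula hm, es_quot_formula g', ← Finset.sum_add_distrib]
      refine Finset.sum_le_sum fun i hi => ?_
      obtain ⟨_, hq'⟩ := ih (T.erase i) l m (hl.erase hi) (hm.erase hi)
      have pos : ∀ n : ι → ℝ, Gam T (k+1) n →
          0 < n i + es (T.erase i) (k+1) n / es (T.erase i) k n := by
        intro n hn
        have h0 := hn.erase hi k le_rfl
        have e1 := es_erase T hi k n
        have h1 := hn (k+1) le_rfl
        have hne : n i + es (T.erase i) (k+1) n / es (T.erase i) k n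
          = es T (k+1) n / es (T.erase i) k n := by
          rw [e1]; field_simp; ring
        rw [hne]; positivity
      have p1 := pos l hl
      have p2 := pos m hm
      have c1 := cs_aux (x := l i) (x' := m i) p1 p2
      have c2 : (l i + m i)^2 / (l i + m i + es (T.erase i) (k+1) (l+m) / es (T.erase i) k (l+m)) ≤
        (l i + m i)^2 / (l i + es (T.erase i) (k+1) l / es (T.erase i) k l +
          (m i + es (T.erase i) (k+1) m / es (T.erase i) k m)) := by
        apply div_le_div_of_nonneg_left (sq_nonneg _) (by positivity)
        linarith
      simp only [Pi.add_apply]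
      linarith
    have h2 : (0:ℝ) < (k:ℝ) + 2 := by positivity
    rw [← mul_add] at key
    exact le_of_mul_le_mul_left key h2

/-- log-midpoint concavity -/
lemma es_smul (T : Finset ι) (j : ℕ) (c : ℝ) (l : ι → ℝ) : es T j (c • l) = c^j * es T j l := by
  unfold es
  rw [Finset.mul_sum]
  refine Finset.sum_congr rfl fun s hs => ?_
  simp [Finset.prod_mul_distrib, (Finset.mem_powersetCard.1 hs).2]

lemma es_midpoint (T : Finset ι) (l m : ι → ℝ) (j : ℕ) (hp : Gam T j (l+m)) (hm : Gam T j (l-m)) :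
    es T j (l+m) * es T j (l-m) ≤ es T j l ^2 := by
  have hl : ∀ k, k ≤ j → Gam T k l := by
    intro k hk
    have h := (quot_superadd k T _ _ (hp.mono hk) (hm.mono hk)).1
    have e : (l + m + (l - m)) = (2:ℝ) • l := by
      ext i; simp; ring
    rw [e] at h
    intro i hi
    have := h i hi
    rw [es_smul] at this
    exact pos_of_mul_pos_right this (by positivity)
  induction j with
  | zero => simp [es_zero]
  | succ j ih =>
    have ih' := ih (hp.mono (by omega)) (hm.mono (by omega)) (fun k hk => hl k (by omega))
    have h := (quot_superadd j T _ _ (hp.mono (by omega : j ≤ j+1)) (hm.mono (by omega : j ≤ j+1))).2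
    have e : (l + m + (l - m)) = (2:ℝ) • l := by
      ext i; simp; ring
    rw [e, es_smul, es_smul] at h
    have a0 := hp j (by omega)
    have a1 := hp (j+1) le_rfl
    have b0 := hm j (by omega)
    have b1 := hm (j+1) le_rfl
    have c0 := hl j (by omega) j le_rfl
    have c1 := hl (j+1) le_rfl (j+1) le_rfl
    have e2 : (2:ℝ)^(j+1) * es T (j+1) l / (2^j * es T j l) = 2 * (es T (j+1) l / es T j l) := by
      rw [pow_succ]; field_simp
    rw [e2] at h
    set p := es T (j+1) (l+m) / es T j (l+m) with hpd
    set q := es T (j+1) (l-m) / es T j (l-m) with hqd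
    set r := es T (j+1) l / es T j l with hrd
    have f1 : es T (j+1) (l+m) = p * es T j (l+m) := by rw [hpd]; field_simp
    have f2 : es T (j+1) (l-m) = q * es T j (l-m) := by rw [hqd]; field_simp
    have f3 : es T (j+1) l = r * es T j l := by rw [hrd]; field_simp
    have pp : 0 < p := by positivity
    have pq : 0 < q := by positivity
    have pr : p * q ≤ r^2 := by nlinarith [sq_nonneg (p-q)]
    rw [f1, f2, f3]
    calc p * es T j (l+m) * (q * es T j (l-m)) = (p*q) * (es T j (l+m) * es T j (l-m)) := by ring
      _ ≤ r^2 * (es T j l ^2) := mul_le_mul pr ih' (by positivity) (by positivity)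
      _ = _ := by ring
end esbasic


lemma second_deriv_test {f f' : ℝ → ℝ} {c : ℝ} (hmax : IsLocalMax f 0)
    (h1 : ∀ᶠ s in nhds (0:ℝ), HasDerivAt f (f' s) s) (h2 : HasDerivAt f' c 0) : c ≤ 0 := by
  by_contra hc
  push Not at hc
  have e1 : deriv f =ᶠ[nhds 0] f' := h1.mono fun s hs => hs.deriv
  have e2 : deriv (deriv f) 0 = c := by rw [e1.deriv_eq]; exact h2.deriv
  have hf0 : deriv f 0 = 0 := hmax.deriv_eq_zero
  have hcont : ContinuousAt f 0 := h1.self_of_nhds.continuousAt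
  have hmin := isLocalMin_of_deriv_deriv_pos (by rw [e2]; exact hc) hf0 hcont
  have hconst : f =ᶠ[nhds 0] fun _ => f 0 := by
    filter_upwards [hmax, hmin] with x hx hy using le_antisymm hx hy
  have := hconst.deriv.deriv_eq
  rw [e2] at this
  simp at this
  exact hc.ne' this

section
variable {ι : Type*} [DecidableEq ι]

lemma es_hasDerivAt (T : Finset ι) (j : ℕ) (l ξ : ι → ℝ) (s : ℝ) :
    HasDerivAt (fun s : ℝ => es T (j+1) (l + s • ξ))
      (∑ i ∈ T, ξ i * es (T.erase i) j (l + s • ξ)) s := by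
  induction T using Finset.induction_on generalizing j with
  | empty =>
    have : Finset.powersetCard (j+1) (∅ : Finset ι) = ∅ :=
        Finset.powersetCard_eq_empty.2 (by simp)
    simp [es, this, hasDerivAt_const]
  | insert i T hi ih =>
    have hl : HasDerivAt (fun s : ℝ => (l + s • ξ) i) (ξ i) s := by
      have := ((hasDerivAt_id s).mul_const (ξ i)).const_add (l i)
      simpa using this
    have hsum : ∑ p ∈ insert i T, ξ p * es ((insert i T).erase p) j (l + s • ξ)
        = ξ i * es T j (l + s • ξ) + ∑ p ∈ T, ξ p * es (insert i (T.erase p)) j (l + s • ξ) := by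
      rw [Finset.sum_insert hi, Finset.erase_insert hi]
      congr 1
      refine Finset.sum_congr rfl fun p hp => ?_
      rw [Finset.erase_insert_of_ne]
      rintro rfl; exact hi hp
    rw [hsum]
    simp only [es_insert T hi]
    cases j with
    | zero =>
      simp only [es_zero]
      have := (ih 0).add (hl.mul_const 1)
      simp only [es_zero] at this
      refine this.congr_deriv ?_; ring
    | succ j =>
      have := (ih (j+1)).add (hl.mul (ih j))
      refine this.congr_deriv ?_
      have : ∀ p ∈ T, ξ p * es (insert i (T.erase p)) (j+1) (l + s • ξ) = ξ p * es (T.erase p) (j+1) (l + s • ξ) + (l + s • ξ) i * (ξ p * es (T.erase p) j (l + s • ξ)) := by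
        intro p hp
        rw [es_insert _ (fun h => hi (Finset.mem_of_mem_erase h))]; ring
      rw [Finset.sum_congr rfl this, Finset.sum_add_distrib, ← Finset.mul_sum]; ring

lemma es_continuous (T : Finset ι) (j : ℕ) : Continuous (fun l : ι → ℝ => es T j l) := by
  unfold es; fun_prop

/-- tangential concavity -/
lemma tang_concave {T : Finset ι} {j : ℕ} {l ξ : ι → ℝ} (h : Gam T (j+2) l)
    (hξ : ∑ i ∈ T, ξ i * es (T.erase i) (j+1) l = 0) :
    ∑ p ∈ T, ∑ q ∈ T.erase p, es ((T.erase p).erase q) j l * (ξ p * ξ q) ≤ 0 := by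
  set P := fun s : ℝ => es T (j+2) (l + s • ξ)
  set P1 := fun s : ℝ => ∑ i ∈ T, ξ i * es (T.erase i) (j+1) (l + s • ξ)
  set P2 := fun s : ℝ => ∑ i ∈ T, ξ i * ∑ q ∈ T.erase i, ξ q * es ((T.erase i).erase q) j (l + s • ξ)
  have d1 : ∀ s, HasDerivAt P (P1 s) s := fun s => es_hasDerivAt T (j+1) l ξ s
  have d2 : ∀ s, HasDerivAt P1 (P2 s) s := fun s =>
    HasDerivAt.fun_sum fun i _ => (es_hasDerivAt (T.erase i) j l ξ s).const_mul (ξ i)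
  have hgam : ∀ᶠ s in nhds (0:ℝ), Gam T (j+2) (l + s • ξ) := by
    have : ∀ i ∈ Finset.range (j+3), ∀ᶠ s in nhds (0:ℝ), 0 < es T i (l + s • ξ) := by
      intro i hi
      have hc : Continuous fun s : ℝ => es T i (l + s • ξ) :=
        (es_continuous T i).comp (by fun_prop)
      apply hc.continuousAt.eventually_const_lt
      simpa using h i (by simp at hi; omega)
    filter_upwards [(Filter.eventually_all_finset _).2 this] with s hs i hi
    exact hs i (by simp; omega)
  have hneg : Filter.Tendsto (fun s : ℝ => -s) (nhds 0) (nhds 0) := by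
    simpa using (continuous_neg (G := ℝ)).tendsto 0
  have hmax : IsLocalMax (fun s => P s * P (-s)) 0 := by
    filter_upwards [hgam, hneg.eventually hgam] with s h1 h2
    have := es_midpoint T l (s • ξ) (j+2) h1 (by simpa [sub_eq_add_neg] using h2)
    simp only [P, neg_zero, zero_smul, add_zero]
    rw [← pow_two]
    simpa [sub_eq_add_neg] using this
  have dn : ∀ s, HasDerivAt (fun s => P (-s)) (-P1 (-s)) s := fun s => by
    have := (d1 (-s)).comp s (hasDerivAt_neg s)
    simpa [Function.comp_def] using this
  have dn2 : ∀ s, HasDerivAt (fun s => P1 (-s)) (-P2 (-s)) s := fun s => by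
    have := (d2 (-s)).comp s (hasDerivAt_neg s)
    simpa [Function.comp_def] using this
  have key := second_deriv_test hmax (Filter.Eventually.of_forall fun s => (d1 s).mul (dn s))
    (((d2 0).mul (dn 0)).add ((d1 0).mul (dn2 0).neg))
  have p10 : P1 0 = 0 := by simpa [P1] using hξ
  have p0 : 0 < P 0 := by simpa [P] using h (j+2) le_rfl
  simp only [neg_zero, p10] at key
  have : P2 0 ≤ 0 := by
    by_contra hc
    push Not at hc
    nlinarith [mul_pos p0 hc]
  convert this using 1
  simp only [P2, zero_smul, add_zero]
  refine Finset.sum_congr rfl fun p _ => ?_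
  rw [Finset.mul_sum]
  refine Finset.sum_congr rfl fun q _ => ?_
  ring

/-- quotient monotone -/
lemma quot_anti {T : Finset ι} {k : ℕ} {l : ι → ℝ} (h : Gam T k l) {j : ℕ} (hj : j + 1 ≤ k) :
    es T k l * es T j l ≤ es T (j+1) l * es T (k-1) l := by
  obtain ⟨m, rfl⟩ := Nat.exists_eq_add_of_le hj
  clear hj
  induction m with
  | zero => simp
  | succ m ih =>
    have ih := ih (h.mono (by omega))
    have hn := newton T l (j+m)
    have e1 : j + 1 + (m+1) - 1 = j+m+1 := by omega
    have e2 : j + 1 + m - 1 = j + m := by omega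
    have e3 : j + 1 + (m+1) = j+m+2 := by omega
    have e4 : j + 1 + m = j + m + 1 := by omega
    rw [e1, e3]
    rw [e2, e4] at ih
    have a0 := h (j+m) (by omega)
    have a1 := h (j+m+1) (by omega)
    have a2 := h j (by omega)
    have a3 := h (j+1) (by omega)
    have : es T (j+m) l * (es T (j+m+2) l * es T j l) ≤ es T (j+m) l * (es T (j+1) l * es T (j+m+1) l) := by
      calc _ = (es T (j+m) l * es T (j+m+2) l) * es T j l := by ring
        _ ≤ es T (j+m+1) l ^2 * es T j l := by gcongr
        _ = es T (j+m+1) l * (es T (j+m+1) l * es T j l) := by ring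
        _ ≤ es T (j+m+1) l * (es T (j+1) l * es T (j+m) l) := by gcongr
        _ = _ := by ring
    exact le_of_mul_le_mul_left this a0

/-- trace bound: `σ₁ ≤ σ_{k-1}^{k-1}` when `σ_k = 1`. -/
lemma sigma1_le {T : Finset ι} {k : ℕ} (hk : 1 ≤ k) {l : ι → ℝ} (h : Gam T k l) (h1 : es T k l = 1) :
    es T 1 l ≤ es T (k-1) l ^ (k-1) := by
  -- es T (j+1) ≥ es T j / s, s = σ_{k-1}
  have hs := h (k-1) (by omega)
  have hq : ∀ j, j + 1 ≤ k → es T j l ≤ es T (j+1) l * es T (k-1) l := by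
    intro j hj
    have := quot_anti h hj
    rwa [h1, one_mul] at this
  have : ∀ m, m + 1 ≤ k → es T 1 l ≤ es T (m+1) l * es T (k-1) l ^ m := by
    intro m
    induction m with
    | zero => simp
    | succ m ih =>
      intro hm
      refine (ih (by omega)).trans ?_
      rw [pow_succ]
      have := hq (m+1) hm
      calc _ ≤ (es T (m+1+1) l * es T (k-1) l) * es T (k-1) l ^ m := by gcongr
        _ = _ := by ring
  have := this (k-1) (by omega)
  rwa [Nat.sub_add_cancel hk, h1, one_mul] at this

lemma es_one (T : Finset ι) (l : ι → ℝ) : es T 1 l = ∑ i ∈ T, l i := by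
  have := es_euler T l 0
  simp [es_zero] at this
  exact this.symm

/-- ellipticity lower bound -/
lemma ellip_lower {T : Finset ι} {k : ℕ} {l : ι → ℝ} (h : Gam T (k+1) l) (h1 : es T (k+1) l = 1)
    {C : ℝ} (hC : 0 < C) (hl : ∀ i ∈ T, |l i| ≤ C) {i : ι} (hi : i ∈ T) :
    1 / (2 * (T.card + 1) * C) ≤ es (T.erase i) k l := by
  have hg := h.erase hi
  have hd := hg k le_rfl
  set δ := es (T.erase i) k l with hδ
  have hN : (1:ℝ) ≤ T.card := by exact_mod_cast Finset.card_pos.2 ⟨i, hi⟩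
  by_contra hc
  push Not at hc
  rw [lt_div_iff₀ (by positivity)] at hc
  have he := es_erase T hi k l
  rw [h1] at he
  have hli := abs_le.1 (hl i hi)
  have hk1 : 1/2 ≤ es (T.erase i) (k+1) l := by
    have : l i * δ ≤ C * δ := by gcongr; exact hli.2
    have : 0 ≤ δ * C * T.card := by positivity
    nlinarith
  have hg' : Gam (T.erase i) (k+1) l := by
    intro j hj
    rcases Nat.lt_or_ge j (k+1) with h' | h'
    · exact hg j (by omega)
    · obtain rfl : j = k+1 := by omega
      linarith
  have hq := quot_anti hg' (j := 0) (by omega)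
  rw [es_zero] at hq
  simp only [Nat.add_sub_cancel, zero_add, mul_one] at hq
  rw [es_one] at hq
  have hsum : ∑ p ∈ T.erase i, l p ≤ T.card * C := by
    calc _ ≤ ∑ p ∈ T.erase i, C := Finset.sum_le_sum fun p hp =>
          (abs_le.1 (hl p (Finset.mem_of_mem_erase hp))).2
      _ = (T.erase i).card * C := by simp
      _ ≤ T.card * C := by
        gcongr; exact Finset.erase_subset _ _
  have : (∑ p ∈ T.erase i, l p) * δ ≤ T.card * C * δ := by gcongr
  nlinarith [mul_pos hd hC]

lemma es_erase_diff {T : Finset ι} (j : ℕ) (l : ι → ℝ) {o q : ι} (ho : o ∈ T) (hq : q ∈ T) (hne : q ≠ o) :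
    es (T.erase q) (j+1) l - es (T.erase o) (j+1) l = (l o - l q) * es ((T.erase o).erase q) j l := by
  rw [es_erase (T.erase q) (i := o) (Finset.mem_erase.2 ⟨hne.symm, ho⟩),
    es_erase (T.erase o) (i := q) (Finset.mem_erase.2 ⟨hne, hq⟩), Finset.erase_right_comm]
  ring
end


section ddsec
variable {E : Type*} [NormedAddCommGroup E] [NormedSpace ℝ E]

/-- directional derivative -/
def dd (e : E) (w : E → ℝ) : E → ℝ := fun x => fderiv ℝ w x e

lemma dd_contDiff {n m : WithTop ℕ∞} {w : E → ℝ} (hw : ContDiff ℝ n w) (h : m + 1 ≤ n) (e : E) :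
    ContDiff ℝ m (dd e w) :=
  (hw.fderiv_right h).clm_apply contDiff_const

lemma dd_comm {w : E → ℝ} (hw : ContDiff ℝ 2 w) (a b : E) : dd a (dd b w) = dd b (dd a w) := by
  funext x
  have hd : DifferentiableAt ℝ (fderiv ℝ w) x :=
    ((hw.fderiv_right (m := 1) (by norm_num)).differentiable one_ne_zero) x
  have e1 : ∀ a b : E, dd a (dd b w) x = fderiv ℝ (fderiv ℝ w) x a b := by
    intro a b
    unfold dd
    rw [fderiv_clm_apply hd (differentiableAt_const b)]
    simp
  rw [e1, e1]
  exact (hw.contDiffAt.isSymmSndFDerivAt (by simp)).eq a b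

lemma dd_add_vec (a b : E) (w : E → ℝ) (x : E) : dd (a + b) w x = dd a w x + dd b w x := by
  simp [dd]
lemma dd_smul_vec (c : ℝ) (a : E) (w : E → ℝ) (x : E) : dd (c • a) w x = c * dd a w x := by
  simp [dd]
lemma dd_neg_vec (a : E) (w : E → ℝ) (x : E) : dd (-a) w x = - dd a w x := by
  simp [dd]
lemma dd_sum_vec {ι : Type*} (s : Finset ι) (f : ι → E) (w : E → ℝ) (x : E) :
    dd (∑ i ∈ s, f i) w x = ∑ i ∈ s, dd (f i) w x := by
  simp [dd]

lemma line_hasDerivAt (x e : E) (s : ℝ) : HasDerivAt (fun s : ℝ => x + s • e) e s := by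
  simpa using ((hasDerivAt_id s).smul_const e).const_add x

lemma dd_line {w : E → ℝ} (hw : ContDiff ℝ 1 w) (x e : E) (s : ℝ) :
    HasDerivAt (fun s : ℝ => w (x + s • e)) (dd e w (x + s • e)) s :=
  ((hw.differentiable one_ne_zero _).hasFDerivAt).comp_hasDerivAt s (line_hasDerivAt x e s)

/-- second order bilinearity -/
lemma dd2_sum {ι : Type*} (s : Finset ι) {w : E → ℝ} (hw : ContDiff ℝ 2 w) (f : ι → ℝ) (b : ι → E)
    (g : ι → ℝ) (x : E) :
    dd (∑ i ∈ s, f i • b i) (dd (∑ j ∈ s, g j • b j) w) x =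
      ∑ i ∈ s, ∑ j ∈ s, f i * g j * dd (b i) (dd (b j) w) x := by
  rw [dd_sum_vec]
  refine Finset.sum_congr rfl fun i _ => ?_
  rw [dd_smul_vec, dd_comm hw, dd_sum_vec, Finset.mul_sum]
  refine Finset.sum_congr rfl fun j _ => ?_
  rw [dd_smul_vec, dd_comm hw]; ring

end ddsec

section detsec
variable {ι : Type*} [Fintype ι] [DecidableEq ι]

lemma det_hasDerivAt {M : ℝ → Matrix ι ι ℝ} {M1 : Matrix ι ι ℝ} {s : ℝ}
    (h : ∀ i j, HasDerivAt (fun s => M s i j) (M1 i j) s) :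
    HasDerivAt (fun s => (M s).det) (∑ i, ((M s).updateCol i (fun j => M1 j i)).det) s := by
  have h1 : ∀ σ : Equiv.Perm ι, HasDerivAt (fun s => ∏ i, M s (σ i) i)
      (∑ i, (∏ j ∈ Finset.univ.erase i, M s (σ j) j) * M1 (σ i) i) s := by
    intro σ
    have := HasDerivAt.fun_finsetProd (u := Finset.univ) (f := fun i s => M s (σ i) i)
      (f' := fun i => M1 (σ i) i) (x := s) (fun i _ => h (σ i) i)
    simpa [smul_eq_mul] using this
  have h2 := HasDerivAt.fun_sum (u := (Finset.univ : Finset (Equiv.Perm ι)))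
    (fun σ _ => (h1 σ).const_mul ((Equiv.Perm.sign σ : ℤ) : ℝ))
  simp only [Matrix.det_apply']
  refine h2.congr_deriv ?_
  rw [Finset.sum_comm]
  refine Finset.sum_congr rfl fun σ _ => ?_
  rw [Finset.mul_sum]
  refine Finset.sum_congr rfl fun i _ => ?_
  rw [← Finset.mul_prod_erase Finset.univ _ (Finset.mem_univ i)]
  simp only [Matrix.updateCol_self]
  rw [mul_comm (M1 (σ i) i)]
  congr 2
  refine Finset.prod_congr rfl fun j hj => ?_
  rw [Matrix.updateCol_ne (Finset.ne_of_mem_erase hj)]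

lemma det_upd1 (d : ι → ℝ) (i : ι) (c : ι → ℝ) :
    ((Matrix.diagonal d).updateCol i c).det = c i * ∏ j ∈ Finset.univ.erase i, d j := by
  rw [← Matrix.cramer_apply, Matrix.cramer_eq_adjugate_mulVec, Matrix.adjugate_diagonal,
    Matrix.mulVec_diagonal, mul_comm]

lemma det_upd2 (d : ι → ℝ) {p q : ι} (hpq : q ≠ p) (c c' : ι → ℝ) :
    (((Matrix.diagonal d).updateCol p c).updateCol q c').det =
      (c p * c' q - c q * c' p) * ∏ j ∈ (Finset.univ.erase p).erase q, d j := by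
  rw [Matrix.det_apply']
  have hfix : ∀ σ : Equiv.Perm ι, σ ∉ ({1, Equiv.swap p q} : Finset (Equiv.Perm ι)) →
      ∃ i, i ≠ p ∧ i ≠ q ∧ σ i ≠ i := by
    intro σ hσ
    by_contra hcon
    push Not at hcon
    apply hσ
    have hp : σ p = p ∨ σ p = q := by
      by_contra h'
      push Not at h'
      have := hcon (σ p) h'.1 h'.2
      exact h'.1 (σ.injective this)
    have hq : σ q = p ∨ σ q = q := by
      by_contra h'
      push Not at h'
      have := hcon (σ q) h'.1 h'.2
      exact h'.2 (σ.injective this)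
    simp only [Finset.mem_insert, Finset.mem_singleton]
    rcases hp with hp | hp
    · left
      have hq' : σ q = q := hq.resolve_left fun h => hpq (σ.injective (h.trans hp.symm))
      ext i
      by_cases h1 : i = p
      · subst h1; simpa using hp
      by_cases h2 : i = q
      · subst h2; simpa using hq'
      simpa using hcon i h1 h2
    · right
      have hq' : σ q = p := hq.resolve_right fun h => hpq (σ.injective (h.trans hp.symm))
      ext i
      by_cases h1 : i = p
      · subst h1; simpa using hp
      by_cases h2 : i = q
      · subst h2; simpa using hq'
      rw [Equiv.swap_apply_of_ne_of_ne h1 h2]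
      exact hcon i h1 h2
  rw [← Finset.sum_subset (Finset.subset_univ ({1, Equiv.swap p q} : Finset (Equiv.Perm ι)))]
  · rw [Finset.sum_pair]
    · have hqm : q ∈ Finset.univ.erase p := Finset.mem_erase.2 ⟨hpq, Finset.mem_univ _⟩
      rw [← Finset.mul_prod_erase Finset.univ _ (Finset.mem_univ p),
        ← Finset.mul_prod_erase _ _ hqm, 
        ← Finset.mul_prod_erase Finset.univ _ (Finset.mem_univ p),
        ← Finset.mul_prod_erase _ _ hqm]
      rw [Equiv.Perm.sign_swap hpq.symm]
      have e1 : ∏ x ∈ (Finset.univ.erase p).erase q,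
          (((Matrix.diagonal d).updateCol p c).updateCol q c') ((1 : Equiv.Perm ι) x) x =
          ∏ j ∈ (Finset.univ.erase p).erase q, d j := by
        refine Finset.prod_congr rfl fun j hj => ?_
        have h1 : j ≠ q := Finset.ne_of_mem_erase hj
        have h2 : j ≠ p := Finset.ne_of_mem_erase (Finset.mem_of_mem_erase hj)
        simp [Matrix.updateCol_ne h1, Matrix.updateCol_ne h2]
      have e2 : ∏ x ∈ (Finset.univ.erase p).erase q,
          (((Matrix.diagonal d).updateCol p c).updateCol q c') (Equiv.swap p q x) x =
          ∏ j ∈ (Finset.univ.erase p).erase q, d j := by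
        refine Finset.prod_congr rfl fun j hj => ?_
        have h1 : j ≠ q := Finset.ne_of_mem_erase hj
        have h2 : j ≠ p := Finset.ne_of_mem_erase (Finset.mem_of_mem_erase hj)
        rw [Equiv.swap_apply_of_ne_of_ne h2 h1]
        simp [Matrix.updateCol_ne h1, Matrix.updateCol_ne h2]
      rw [e1, e2]
      simp [Matrix.updateCol_ne hpq.symm]
      ring
    · intro h
      have := congrArg (fun σ : Equiv.Perm ι => σ p) h
      simp at this
      exact hpq this.symm
  · intro σ _ hσ
    obtain ⟨i, h1, h2, h3⟩ := hfix σ hσ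
    rw [Finset.prod_eq_zero (Finset.mem_univ i), mul_zero]
    rw [Matrix.updateCol_ne h2, Matrix.updateCol_ne h1, Matrix.diagonal_apply_ne _ h3]

end detsec

section lagr
/-- Lagrange weights -/
def lw (N k : ℕ) (κ : ℝ) (m : ℕ) : ℝ :=
  (Lagrange.basis (Finset.range (N+1)) (fun m : ℕ => κ * m) m).coeff k

lemma lw_coeff (N k : ℕ) {κ : ℝ} (hκ : 0 < κ) (p : Polynomial ℝ) (hp : p.natDegree ≤ N) :
    ∑ m ∈ Finset.range (N+1), lw N k κ m * p.eval (κ * m) = p.coeff k := by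
  have hinj : Set.InjOn (fun m : ℕ => κ * (m:ℝ)) (Finset.range (N+1) : Finset ℕ) := by
    intro a _ b _ h
    have := mul_left_cancel₀ hκ.ne' h
    exact_mod_cast this
  have h := Lagrange.eq_interpolate (s := Finset.range (N+1)) hinj (f := p) (by
    simp only [Finset.card_range]
    exact lt_of_le_of_lt Polynomial.degree_le_natDegree (by exact_mod_cast Nat.lt_succ_of_le hp))
  conv_rhs => rw [h]
  rw [Lagrange.interpolate_apply, Polynomial.finsetSum_coeff]
  refine Finset.sum_congr rfl fun m _ => ?_
  rw [Polynomial.coeff_C_mul, lw]; ring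
end lagr

section detsec2
variable {ι : Type*} [Fintype ι] [DecidableEq ι]

/-- first derivative of the determinant as function -/
def detD1 (M M1 : Matrix ι ι ℝ) : ℝ := ∑ i, (M.updateCol i (fun j => M1 j i)).det

lemma detD1_diag (d : ι → ℝ) (M1 : Matrix ι ι ℝ) :
    detD1 (Matrix.diagonal d) M1 = ∑ i, M1 i i * ∏ j ∈ Finset.univ.erase i, d j := by
  unfold detD1
  exact Finset.sum_congr rfl fun i _ => det_upd1 d i _

lemma det_second {M M1 : ℝ → Matrix ι ι ℝ} {M2 : Matrix ι ι ℝ} {d : ι → ℝ}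
    (h : ∀ i j, HasDerivAt (fun s => M s i j) (M1 0 i j) 0)
    (h' : ∀ i j, HasDerivAt (fun s => M1 s i j) (M2 i j) 0) (hd : M 0 = Matrix.diagonal d) :
    HasDerivAt (fun s => detD1 (M s) (M1 s))
      (∑ i, M2 i i * ∏ j ∈ Finset.univ.erase i, d j +
        ∑ p, ∑ q ∈ Finset.univ.erase p, (M1 0 p p * M1 0 q q - M1 0 q p * M1 0 p q) *
          ∏ j ∈ (Finset.univ.erase p).erase q, d j) 0 := by
  unfold detD1
  have hi : ∀ i, HasDerivAt (fun s => ((M s).updateCol i (fun j => M1 s j i)).det)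
      (∑ q, (((M 0).updateCol i (fun j => M1 0 j i)).updateCol q
        (fun j => ((M1 0).updateCol i (fun j => M2 j i)) j q)).det) 0 := by
    intro i
    apply det_hasDerivAt (M := fun s => (M s).updateCol i (fun j => M1 s j i))
    intro a b
    by_cases hb : b = i
    · subst hb
      simpa using h' a b
    · simpa [Matrix.updateCol_ne hb] using h a b
  refine (HasDerivAt.fun_sum fun i _ => hi i).congr_deriv ?_
  rw [← Finset.sum_add_distrib]
  refine Finset.sum_congr rfl fun i _ => ?_
  rw [← Finset.add_sum_erase Finset.univ _ (Finset.mem_univ i)]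
  congr 1
  · rw [hd]
    have : ((Matrix.diagonal d).updateCol i (fun j => M1 0 j i)).updateCol i
        (fun j => ((M1 0).updateCol i (fun j => M2 j i)) j i) =
        (Matrix.diagonal d).updateCol i (fun j => M2 j i) := by
      ext a b
      by_cases hb : b = i
      · subst hb; simp
      · simp [Matrix.updateCol_ne hb]
    rw [this, det_upd1]
  · refine Finset.sum_congr rfl fun q hq => ?_
    have hqi := Finset.ne_of_mem_erase hq
    rw [hd, det_upd2 d hqi]
    simp [Matrix.updateCol_ne hqi]

end detsec2


section solsec
variable {ι : Type*} [Fintype ι] [DecidableEq ι]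

lemma gp_natDegree (T : Finset ι) (l : ι → ℝ) : (gp T l).natDegree ≤ T.card := by
  unfold gp
  refine (Polynomial.natDegree_prod_le _ _).trans ?_
  calc _ ≤ ∑ i ∈ T, 1 := Finset.sum_le_sum fun i _ => by
        rw [add_comm, ← Polynomial.C_1]
        exact Polynomial.natDegree_linear_le
    _ = _ := by simp

lemma gp_eval (T : Finset ι) (l : ι → ℝ) (z : ℝ) : (gp T l).eval z = ∏ i ∈ T, (1 + z * l i) := by
  rw [gp, Polynomial.eval_prod]
  refine Finset.prod_congr rfl fun i _ => ?_
  simp only [Polynomial.eval_add, Polynomial.eval_one, Polynomial.eval_mul, Polynomial.eval_C,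
    Polynomial.eval_X]
  ring

lemma lw_gp0 (k : ℕ) {κ : ℝ} (hκ : 0 < κ) (l : ι → ℝ) :
    ∑ m ∈ Finset.range (Fintype.card ι+1), lw (Fintype.card ι) k κ m *
      ∏ i, (1 + (κ * m) * l i) = es Finset.univ k l := by
  rw [← gp_coeff, ← lw_coeff (Fintype.card ι) k hκ _ (gp_natDegree _ _)]
  simp only [gp_eval]

lemma lw_gp1 (k : ℕ) {κ : ℝ} (hκ : 0 < κ) (l : ι → ℝ) (p : ι) :
    ∑ m ∈ Finset.range (Fintype.card ι+1), lw (Fintype.card ι) (k+1) κ m *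
      ((κ * m) * ∏ i ∈ Finset.univ.erase p, (1 + (κ * m) * l i)) = es (Finset.univ.erase p) k l := by
  have hc : 0 < Fintype.card ι := Fintype.card_pos_iff.2 ⟨p⟩
  rw [← gp_coeff, ← Polynomial.coeff_X_mul, ← lw_coeff (Fintype.card ι) (k+1) hκ]
  · simp only [Polynomial.eval_mul, Polynomial.eval_X, gp_eval]
  · refine Polynomial.natDegree_mul_le.trans ?_
    have := gp_natDegree (Finset.univ.erase p) l
    rw [Finset.card_erase_of_mem (Finset.mem_univ _), Finset.card_univ] at this
    rw [Polynomial.natDegree_X]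
    omega

lemma lw_gp2 (k : ℕ) {κ : ℝ} (hκ : 0 < κ) (l : ι → ℝ) {p q : ι} (hpq : q ≠ p) :
    ∑ m ∈ Finset.range (Fintype.card ι+1), lw (Fintype.card ι) (k+2) κ m *
      ((κ * m)^2 * ∏ i ∈ (Finset.univ.erase p).erase q, (1 + (κ * m) * l i)) =
      es ((Finset.univ.erase p).erase q) k l := by
  have hc : 1 < Fintype.card ι := Fintype.one_lt_card_iff.2 ⟨p, q, hpq.symm⟩
  rw [← gp_coeff, ← Polynomial.coeff_X_pow_mul _ 2, ← lw_coeff (Fintype.card ι) (k+2) hκ]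
  · simp only [Polynomial.eval_mul, Polynomial.eval_X, gp_eval, Polynomial.eval_pow]
  · refine Polynomial.natDegree_mul_le.trans ?_
    have := gp_natDegree ((Finset.univ.erase p).erase q) l
    rw [Finset.card_erase_of_mem (Finset.mem_erase.2 ⟨hpq, Finset.mem_univ _⟩), 
      Finset.card_erase_of_mem (Finset.mem_univ _), Finset.card_univ] at this
    rw [Polynomial.natDegree_X_pow]
    omega

variable {E : Type*} [NormedAddCommGroup E] [InnerProductSpace ℝ E]

/-- Hessian in an orthonormal basis -/
def Hb (b : OrthonormalBasis ι ℝ E) (v : E → ℝ) (x : E) : Matrix ι ι ℝ :=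
  Matrix.of fun i j => dd (b i) (dd (b j) v) x

/-- change of basis matrix -/
def Ub (b b' : OrthonormalBasis ι ℝ E) : Matrix ι ι ℝ :=
  Matrix.of fun i j => inner ℝ (b i) (b' j)

lemma Ub_orth (b b' : OrthonormalBasis ι ℝ E) : (Ub b b').transpose * Ub b b' = 1 := by
  ext i j
  rw [Matrix.mul_apply]
  simp only [Ub, Matrix.transpose_apply, Matrix.of_apply]
  have h := b.sum_inner_mul_inner (b' i) (b' j)
  rw [Matrix.one_apply, ← orthonormal_iff_ite.1 b'.orthonormal i j, ← h]
  exact Finset.sum_congr rfl fun k _ => by rw [real_inner_comm]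

lemma Hb_conj (b b' : OrthonormalBasis ι ℝ E) {v : E → ℝ} (hv : ContDiff ℝ 2 v) (x : E) :
    Hb b' v x = (Ub b b').transpose * Hb b v x * Ub b b' := by
  ext i j
  simp only [Matrix.mul_apply, Hb, Ub, Matrix.transpose_apply, Matrix.of_apply]
  have e : ∀ k, b' k = ∑ i, inner ℝ (b i) (b' k) • b i := fun k => (b.sum_repr' (b' k)).symm
  conv_lhs => rw [e i, e j]
  rw [dd2_sum _ hv, Finset.sum_comm]
  refine Finset.sum_congr rfl fun p _ => ?_
  rw [Finset.sum_mul]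
  refine Finset.sum_congr rfl fun q _ => ?_
  ring

lemma Hb_det (b b' : OrthonormalBasis ι ℝ E) {v : E → ℝ} (hv : ContDiff ℝ 2 v) (x : E) (z : ℝ) :
    (1 + z • Hb b' v x).det = (1 + z • Hb b v x).det := by
  have h : 1 + z • Hb b' v x = (Ub b b').transpose * (1 + z • Hb b v x) * Ub b b' := by
    rw [mul_add, add_mul, mul_one, Ub_orth, Hb_conj b b' hv]
    simp
  rw [h, Matrix.det_mul_right_comm, Ub_orth, one_mul]

/-- Spectral data at a point; `k = j + 2`. -/
structure PtEig (j : ℕ) (K : ℝ) (v : E → ℝ) (x : E) (b : OrthonormalBasis ι ℝ E) (l : ι → ℝ) : Prop where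
  diag : Hb b v x = Matrix.diagonal l
  gam : Gam Finset.univ (j+2) l
  one : es Finset.univ (j+2) l = 1
  lb : ∀ i, -K ≤ l i

/-- entire solution -/
structure Sol (ι : Type*) [Fintype ι] [DecidableEq ι] (j : ℕ) (K : ℝ) (v : E → ℝ) : Prop where
  smooth : ContDiff ℝ 4 v
  pt : ∀ x, ∃ (b : OrthonormalBasis ι ℝ E) (l : ι → ℝ), PtEig j K v x b l

variable {j : ℕ} {K : ℝ} {v : E → ℝ}

lemma Sol.eq_one (h : Sol ι j K v) (b : OrthonormalBasis ι ℝ E) {κ : ℝ} (hκ : 0 < κ) (x : E) :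
    ∑ m ∈ Finset.range (Fintype.card ι+1), lw (Fintype.card ι) (j+2) κ m *
      (1 + (κ * m) • Hb b v x).det = 1 := by
  obtain ⟨b', l, hp⟩ := h.pt x
  rw [← hp.one, ← lw_gp0 (j+2) hκ l]
  refine Finset.sum_congr rfl fun m _ => ?_
  congr 1
  rw [Hb_det b' b (h.smooth.of_le (by norm_num)), hp.diag]
  rw [← Matrix.diagonal_one, ← Matrix.diagonal_smul, Matrix.diagonal_add, Matrix.det_diagonal]
  simp

lemma Sol.T12 (h : Sol ι j K v) {x : E} {b : OrthonormalBasis ι ℝ E} {l : ι → ℝ}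
    (hp : PtEig j K v x b l) (e : E) :
    (∑ i, es (Finset.univ.erase i) (j+1) l * dd e (dd (b i) (dd (b i) v)) x = 0) ∧
    (∑ i, es (Finset.univ.erase i) (j+1) l * dd e (dd e (dd (b i) (dd (b i) v))) x +
      ∑ p, ∑ q ∈ Finset.univ.erase p, es ((Finset.univ.erase p).erase q) j l *
        (dd e (dd (b p) (dd (b p) v)) x * dd e (dd (b q) (dd (b q) v)) x
          - dd e (dd (b p) (dd (b q) v)) x ^ 2) = 0) := by
  have c3 : ∀ i, ContDiff ℝ 3 (dd (b i) v) := fun i => dd_contDiff h.smooth (by norm_num) _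
  have c2 : ∀ i k, ContDiff ℝ 2 (dd (b i) (dd (b k) v)) := fun i k => dd_contDiff (c3 k) (by norm_num) _
  have c1 : ∀ i k, ContDiff ℝ 1 (dd e (dd (b i) (dd (b k) v))) := fun i k =>
    dd_contDiff (c2 i k) (by norm_num) _
  have sy : ∀ i k, dd (b i) (dd (b k) v) = dd (b k) (dd (b i) v) := fun i k =>
    dd_comm (h.smooth.of_le (by norm_num)) _ _
  -- matrices
  set M : ℕ → ℝ → Matrix ι ι ℝ := fun m s => 1 + ((1:ℝ) * m) • Hb b v (x + s • e) with hM
  set M1 : ℕ → ℝ → Matrix ι ι ℝ := fun m s => Matrix.of fun i k => ((1:ℝ) * m) * dd e (dd (b i) (dd (b k) v)) (x + s • e)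
  set M2 : ℕ → Matrix ι ι ℝ := fun m => Matrix.of fun i k => ((1:ℝ) * m) * dd e (dd e (dd (b i) (dd (b k) v))) x
  have hd1 : ∀ m s i k, HasDerivAt (fun s => M m s i k) (M1 m s i k) s := by
    intro m s i k
    have := ((dd_line ((c2 i k).of_le (by norm_num)) x e s).const_mul ((1:ℝ)*m)).const_add ((1 : Matrix ι ι ℝ) i k)
    simpa [M, M1, Hb] using this
  have hd2 : ∀ m i k, HasDerivAt (fun s => M1 m s i k) (M2 m i k) 0 := by
    intro m i k
    have := ((dd_line (c1 i k) x e 0).const_mul ((1:ℝ)*m))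
    simpa [M2, M1] using this
  have hM0 : ∀ m, M m 0 = Matrix.diagonal fun i => 1 + ((1:ℝ) * m) * l i := by
    intro m
    simp only [M, zero_smul, add_zero, hp.diag]
    rw [← Matrix.diagonal_one, ← Matrix.diagonal_smul, Matrix.diagonal_add]
    simp
  set W := fun m => lw (Fintype.card ι) (j+2) 1 m
  have hF : ∀ s, HasDerivAt (fun s => ∑ m ∈ Finset.range (Fintype.card ι+1), W m * (M m s).det)
      (∑ m ∈ Finset.range (Fintype.card ι+1), W m * detD1 (M m s) (M1 m s)) s := fun s =>
    HasDerivAt.fun_sum fun m _ => (det_hasDerivAt fun i k => hd1 m s i k).const_mul (W m)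
  have hconst : (fun s => ∑ m ∈ Finset.range (Fintype.card ι+1), W m * (M m s).det) = fun _ => 1 := by
    funext s
    exact h.eq_one b one_pos (x + s • e)
  have hz : ∀ s, ∑ m ∈ Finset.range (Fintype.card ι+1), W m * detD1 (M m s) (M1 m s) = 0 := by
    intro s
    have h1 := hF s
    rw [hconst] at h1
    exact h1.unique (hasDerivAt_const s (1:ℝ))
  constructor
  · have h0 := hz 0
    simp only [hM0, detD1_diag] at h0
    rw [← h0]
    simp only [Finset.mul_sum]
    rw [Finset.sum_comm]
    refine Finset.sum_congr rfl fun i _ => ?_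
    rw [← lw_gp1 (j+1) one_pos l i, Finset.sum_mul]
    refine Finset.sum_congr rfl fun m _ => ?_
    simp [M1, W]; ring
  · have h2 := HasDerivAt.fun_sum (u := Finset.range (Fintype.card ι+1)) (fun m _ =>
      (det_second (fun i k => hd1 m 0 i k) (hd2 m) (hM0 m)).const_mul (W m))
    have h3 : (fun s => ∑ m ∈ Finset.range (Fintype.card ι+1), W m * detD1 (M m s) (M1 m s)) = fun _ => 0 :=
      funext hz
    rw [h3] at h2
    have h4 := h2.unique (hasDerivAt_const 0 (0:ℝ))
    rw [← h4]
    simp only [mul_add, Finset.sum_add_distrib]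
    congr 1
    · simp only [Finset.mul_sum]
      rw [Finset.sum_comm]
      refine Finset.sum_congr rfl fun i _ => ?_
      rw [← lw_gp1 (j+1) one_pos l i, Finset.sum_mul]
      refine Finset.sum_congr rfl fun m _ => ?_
      simp [M2, W]; ring
    · simp only [Finset.mul_sum]
      rw [Finset.sum_comm]
      refine Finset.sum_congr rfl fun p _ => ?_
      rw [Finset.sum_comm]
      refine Finset.sum_congr rfl fun q hq => ?_
      rw [← lw_gp2 j one_pos l (Finset.ne_of_mem_erase hq), Finset.sum_mul]
      refine Finset.sum_congr rfl fun m _ => ?_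
      simp only [M1, W, Matrix.of_apply, zero_smul, add_zero]
      rw [sy q p]
      ring

/-- Second derivatives are subsolutions. -/
lemma Sol.subsol (h : Sol ι j K v) {x : E} {b : OrthonormalBasis ι ℝ E} {l : ι → ℝ}
    (hp : PtEig j K v x b l) (e : E) :
    ∑ p, ∑ q ∈ Finset.univ.erase p, es ((Finset.univ.erase p).erase q) j l *
        (dd e (dd (b p) (dd (b q) v)) x ^ 2) ≤
    ∑ i, es (Finset.univ.erase i) (j+1) l * dd (b i) (dd (b i) (dd e (dd e v))) x := by
  obtain ⟨t1, t2⟩ := h.T12 hp e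
  have tc := tang_concave (ξ := fun i => dd e (dd (b i) (dd (b i) v)) x) hp.gam
    (by rw [← t1]; exact Finset.sum_congr rfl fun i _ => mul_comm _ _)
  have sw : ∀ i, dd e (dd e (dd (b i) (dd (b i) v))) = dd (b i) (dd (b i) (dd e (dd e v))) := by
    intro i
    have c4 := h.smooth
    have c3 : ∀ i, ContDiff ℝ 3 (dd i v) := fun i => dd_contDiff c4 (by norm_num) _
    have c2 : ∀ i k, ContDiff ℝ 2 (dd i (dd k v)) := fun i k => dd_contDiff (c3 k) (by norm_num) _
    rw [dd_comm ((c3 _).of_le (by norm_num)) e (b i), dd_comm (c4.of_le (by norm_num)) e (b i),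
      dd_comm (c2 _ _) e (b i), dd_comm ((c3 _).of_le (by norm_num)) e (b i)]
  simp only [sw] at t2
  simp only [mul_sub, Finset.sum_sub_distrib] at t2
  linarith

end solsec


section gradsec
variable {ι : Type*} [Fintype ι] [DecidableEq ι]
variable {E : Type*} [NormedAddCommGroup E] [InnerProductSpace ℝ E]
variable {j : ℕ} {K : ℝ} {v : E → ℝ}

lemma sum_inner_sq (b : OrthonormalBasis ι ℝ E) (e : E) : ∑ i, inner ℝ (b i) e ^ 2 = ‖e‖^2 := by
  have := b.sum_sq_norm_inner_right e
  simpa using this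

lemma PtEig.form {x : E} {b : OrthonormalBasis ι ℝ E} {l : ι → ℝ} (hv : ContDiff ℝ 2 v)
    (hp : PtEig j K v x b l) (e f : E) :
    dd e (dd f v) x = ∑ i, l i * (inner ℝ (b i) e * inner ℝ (b i) f) := by
  have h := dd2_sum Finset.univ hv (fun i => inner ℝ (b i) e) b (fun i => inner ℝ (b i) f) x
  rw [b.sum_repr', b.sum_repr'] at h
  rw [h]
  refine Finset.sum_congr rfl fun i _ => ?_
  have hd : ∀ k, dd (b i) (dd (b k) v) x = Matrix.diagonal l i k := fun k => by
    rw [← hp.diag]; rfl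
  simp only [hd]
  rw [Finset.sum_eq_single i]
  · simp; ring
  · intro k _ hk
    rw [Matrix.diagonal_apply_ne _ hk.symm, mul_zero]
  · simp

lemma Sol.semiconv (h : Sol ι j K v) (x e : E) : -K * ‖e‖^2 ≤ dd e (dd e v) x := by
  obtain ⟨b, l, hp⟩ := h.pt x
  rw [hp.form (h.smooth.of_le (by norm_num)), ← sum_inner_sq b e, Finset.mul_sum]
  refine Finset.sum_le_sum fun i _ => ?_
  rw [← pow_two]
  exact mul_le_mul_of_nonneg_right (hp.lb i) (sq_nonneg _)

lemma taylor_lower {f f' f'' : ℝ → ℝ} {c : ℝ} (h1 : ∀ s, HasDerivAt f (f' s) s)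
    (h2 : ∀ s, HasDerivAt f' (f'' s) s) (h : ∀ s, c ≤ f'' s) : f 0 + f' 0 + c / 2 ≤ f 1 := by
  have hm : Monotone (fun s => f' s - c * s) := by
    apply monotone_of_hasDerivAt_nonneg (f' := fun s => f'' s - c)
    · intro s
      exact ((h2 s).sub ((hasDerivAt_id s).const_mul c)).congr_deriv (by simp)
    · intro s; simpa using h s
  have hd : ∀ s, HasDerivAt (fun s => f s - c/2 * s^2 - f' 0 * s) (f' s - c * s - f' 0) s := by
    intro s
    have := ((h1 s).sub ((hasDerivAt_pow 2 s).const_mul (c/2))).sub ((hasDerivAt_id s).const_mul (f' 0))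
    refine this.congr_deriv ?_
    simp; ring
  obtain ⟨ξ, hξ, e⟩ := exists_hasDerivAt_eq_slope _ _ (zero_lt_one' ℝ)
    (fun s _ => (hd s).continuousAt.continuousWithinAt) (fun s _ => hd s)
  have := hm hξ.1.le
  simp at this e
  linarith

lemma Sol.taylor (h : Sol ι j K v) (x y : E) :
    v x + dd (y - x) v x - K/2 * ‖y - x‖^2 ≤ v y := by
  have h2 : ContDiff ℝ 2 v := h.smooth.of_le (by norm_num)
  have := taylor_lower (dd_line (h2.of_le (by norm_num)) x (y-x))
    (dd_line (dd_contDiff h2 (by norm_num) (y-x)) x (y-x)) (fun s => h.semiconv (x + s • (y-x)) (y-x))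
  simp at this
  linarith

lemma localMin_compare (hv : ContDiff ℝ 2 v) {ψ : E → ℝ} {x e : E} {A B C : ℝ}
    (hψ : ∀ s : ℝ, ψ (x + s • e) = A + B * s + C * s^2)
    (hmin : IsLocalMin (fun y => v y - ψ y) x) : 2 * C ≤ dd e (dd e v) x := by
  have ht : Filter.Tendsto (fun s : ℝ => x + s • e) (nhds 0) (nhds x) := by
    have : Continuous fun s : ℝ => x + s • e := by fun_prop
    simpa using this.tendsto 0
  have hmax : IsLocalMax (fun s : ℝ => (A + B * s + C * s^2) - v (x + s • e)) 0 := by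
    filter_upwards [ht.eventually hmin] with s hs
    simp only [hψ] at hs
    have h0 := hψ 0
    simp only [zero_smul, add_zero] at h0 ⊢
    linarith
  have key := second_deriv_test (f' := fun s => (B + C * (2 * s)) - dd e v (x + s • e)) 
    (c := C * 2 - dd e (dd e v) x) hmax
    (Filter.Eventually.of_forall fun s => by
      have := ((((hasDerivAt_id s).const_mul B).const_add A).add ((hasDerivAt_pow 2 s).const_mul C)).sub
        (dd_line (hv.of_le (by norm_num)) x e s)
      refine this.congr_deriv ?_
      simp) (by
      have := ((((hasDerivAt_id (0:ℝ)).const_mul 2).const_mul C).const_add B).sub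
        (dd_line (dd_contDiff hv (by norm_num) e) x e 0)
      refine this.congr_deriv ?_
      simp)
  linarith

lemma es_big {l : ι → ℝ} {ε m : ℝ} (hε : 0 < ε) (hcard : j + 2 ≤ Fintype.card ι)
    (hl : ∀ i, ε ≤ l i) {i : ι} (hi : m ≤ l i) : m * ε^(j+1) ≤ es Finset.univ (j+2) l := by
  have hpos : ∀ (T : Finset ι) (r : ℕ), 0 ≤ es T r l := fun T r =>
    Finset.sum_nonneg fun s _ => Finset.prod_nonneg fun p _ => hε.le.trans (hl p)
  rw [es_erase Finset.univ (Finset.mem_univ i)]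
  have h1 : ε^(j+1) ≤ es (Finset.univ.erase i) (j+1) l := by
    have hne : ((Finset.univ.erase i).powersetCard (j+1)).Nonempty := by
      rw [Finset.powersetCard_nonempty, Finset.card_erase_of_mem (Finset.mem_univ _), Finset.card_univ]
      omega
    obtain ⟨s, hs⟩ := hne
    have h2 : ∏ p ∈ s, l p ≤ es (Finset.univ.erase i) (j+1) l :=
      Finset.single_le_sum (f := fun s => ∏ p ∈ s, l p)
        (fun s _ => Finset.prod_nonneg fun p _ => hε.le.trans (hl p)) hs
    refine le_trans ?_ h2
    rw [← (Finset.mem_powersetCard.1 hs).2, ← Finset.prod_const]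
    exact Finset.prod_le_prod (fun _ _ => hε.le) fun p _ => hl p
  have h3 := hpos (Finset.univ.erase i) (j+2)
  have h4 : m * ε^(j+1) ≤ l i * es (Finset.univ.erase i) (j+1) l :=
    (mul_le_mul_of_nonneg_right hi (by positivity)).trans
      (mul_le_mul_of_nonneg_left h1 (hε.le.trans (hl i)))
  have e : j + 1 + 1 = j + 2 := rfl
  rw [e]
  linarith

lemma card_ge {l : ι → ℝ} (h1 : es Finset.univ (j+2) l = 1) : j + 2 ≤ Fintype.card ι := by
  by_contra hc
  push Not at hc
  have : Finset.powersetCard (j+2) (Finset.univ : Finset ι) = ∅ :=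
    Finset.powersetCard_eq_empty.2 (by rwa [Finset.card_univ])
  simp [es, this] at h1

variable [FiniteDimensional ℝ E]

/-- gradient vector -/
def gv (v : E → ℝ) (x : E) : E := (InnerProductSpace.toDual ℝ E).symm (fderiv ℝ v x)

lemma gv_inner (v : E → ℝ) (x e : E) : inner ℝ (gv v x) e = dd e v x := by
  simp [gv, dd]

lemma exists_big_coord (b : OrthonormalBasis ι ℝ E) {ν : E} (hν : ‖ν‖ = 1) :
    ∃ i, 1 / (Fintype.card ι : ℝ) ≤ inner ℝ (b i) ν ^ 2 := by
  by_contra hc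
  push Not at hc
  have hne : (Finset.univ : Finset ι).Nonempty := by
    by_contra hne
    have := sum_inner_sq b ν
    rw [Finset.not_nonempty_iff_eq_empty.1 hne] at this
    simp [hν] at this
  have := Finset.sum_lt_sum_of_nonempty hne (fun i _ => hc i)
  rw [sum_inner_sq, hν] at this
  have hN : (Fintype.card ι : ℝ) ≠ 0 := by
    have := Finset.card_pos.2 hne
    rw [Finset.card_univ] at this
    exact_mod_cast this.ne'
  simp [hN] at this

set_option maxHeartbeats 1600000 in
lemma level_ball (j N : ℕ) {K ρ : ℝ} (hK : 0 < K) (hρ : 0 < ρ) :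
    ∃ d : ℝ, 0 < d ∧ K * d^2 ≤ 1/2 ∧ ∀ (ι : Type) [Fintype ι] [DecidableEq ι], Fintype.card ι = N →
      ∀ v : E → ℝ, Sol ι j K v → (∀ x, v x ≤ 1 → ‖x‖ ≤ ρ) →
      ∀ x0, v x0 ≤ 1/2 → ∀ y, ‖y - x0‖ ≤ d → v y ≤ 1 := by
  set ε : ℝ := 1 / (16 * ρ^2) with hε
  have hε0 : 0 < ε := by positivity
  set M : ℝ := 2 * (N+1) / ε^(j+1) with hM
  have hM0 : 0 < M := by positivity
  obtain ⟨d, hd0, hd1, hd2, hd3⟩ : ∃ d : ℝ, 0 < d ∧ K * d^2 ≤ 1/2 ∧ 24*M*K*ρ^3*d ≤ 1/8 ∧ 2*M*ρ*d < 1/4 := by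
    set S := 1 + 2*K + 192*M*K*ρ^3 + 9*M*ρ with hS
    have hS0 : 0 < S := by positivity
    have p1 : 0 < M*K*ρ^3 := by positivity
    have p2 : 0 < M*ρ := by positivity
    refine ⟨1/S, by positivity, ?_, ?_, ?_⟩
    · rw [div_pow, one_pow, mul_one_div, div_le_div_iff₀ (by positivity) (by norm_num)]
      nlinarith
    · rw [mul_one_div, div_le_div_iff₀ (by positivity) (by norm_num)]
      nlinarith
    · rw [mul_one_div, div_lt_div_iff₀ (by positivity) (by norm_num)]
      nlinarith
  refine ⟨d, hd0, hd1, ?_⟩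
  intro ι _ _ hcard v h hbd x0 hx0 y hy
  by_contra hvy
  push Not at hvy
  have hC2 : ContDiff ℝ 2 v := h.smooth.of_le (by norm_num)
  have hcont : Continuous v := hC2.continuous
  -- find z
  obtain ⟨t, ht, hz⟩ : ∃ t ∈ Set.Icc (0:ℝ) 1, v (x0 + t • (y - x0)) = 1 := by
    have := intermediate_value_Icc (f := fun t : ℝ => v (x0 + t • (y - x0))) zero_le_one
      (by fun_prop)
    have h2 := this (show (1:ℝ) ∈ _ from ⟨by simp; linarith, by simpa using hvy.le⟩)
    exact h2
  set z := x0 + t • (y - x0) with hzdef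
  have hzx : ‖x0 - z‖ ≤ d := by
    have : x0 - z = -(t • (y - x0)) := by rw [hzdef]; abel
    rw [this, norm_neg, norm_smul, Real.norm_of_nonneg ht.1]
    nlinarith [ht.2, ht.1, norm_nonneg (y - x0)]
  have hzρ := hbd z hz.le
  set g := gv v z with hg
  have hgd : 1/4 ≤ ‖g‖ * d := by
    have h1 := h.taylor z x0
    rw [← gv_inner, hz] at h1
    have h2 := abs_le.1 (abs_real_inner_le_norm g (x0 - z))
    have h3 : ‖g‖ * ‖x0 - z‖ ≤ ‖g‖ * d := by gcongr
    have h4 : ‖x0 - z‖^2 ≤ d^2 := by gcongr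
    have h5 : K/2 * ‖x0 - z‖^2 ≤ K/2 * d^2 := by gcongr
    linarith [h2.1]
  have hg0 : 0 < ‖g‖ := by
    by_contra hc
    have : ‖g‖ = 0 := le_antisymm (not_lt.1 hc) (norm_nonneg _)
    rw [this] at hgd; linarith
  set ν := (‖g‖⁻¹) • g with hν
  have hν1 : ‖ν‖ = 1 := by
    rw [hν, norm_smul, norm_inv, norm_norm, inv_mul_cancel₀ hg0.ne']
  have hs : ∀ x, v x ≤ 1 → inner ℝ ν (x - z) ≤ 8*K*ρ^2*d := by
    intro x hx
    have h1 := h.taylor z x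
    rw [← gv_inner, hz] at h1
    have h2 : ‖x - z‖ ≤ 2*ρ := (norm_sub_le _ _).trans (by linarith [hbd x hx])
    have h3 : ‖x - z‖^2 ≤ (2*ρ)^2 := by gcongr
    have h5 : K/2 * ‖x - z‖^2 ≤ K/2 * (2*ρ)^2 := by gcongr
    have h6 : inner ℝ g (x - z) ≤ 2*K*ρ^2 := by linarith
    rw [hν, inner_smul_left]
    simp only [conj_trivial]
    rw [inv_mul_le_iff₀ hg0]
    have : 2*K*ρ^2 ≤ 8*K*ρ^2 * (‖g‖ * d) := by nlinarith [mul_pos hK (pow_pos hρ 2)]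
    linarith
  set ψ : E → ℝ := fun x => 3/4 + ε/2 * ‖x - z‖^2 + M/2 * ((inner ℝ ν (x - z))^2 + 4*ρ*inner ℝ ν (x - z))
  have hψc : Continuous ψ := by fun_prop
  have hcomp : IsCompact {x | v x ≤ 1} := by
    apply Metric.isCompact_of_isClosed_isBounded (isClosed_le hcont continuous_const)
    exact (Metric.isBounded_closedBall (x := (0:E)) (r := ρ)).subset fun x hx => by
      simpa using hbd x hx
  obtain ⟨x1, hx1, hmin⟩ := hcomp.exists_isMinOn ⟨x0, by simp; linarith⟩ (f := fun x => v x - ψ x)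
    (hcont.sub hψc).continuousOn
  have hx1' : v x1 ≤ 1 := hx1
  rcases lt_or_eq_of_le hx1' with hlt | heq
  · -- interior
    have hloc : IsLocalMin (fun x => v x - ψ x) x1 := by
      have : {x | v x < 1} ∈ nhds x1 := (isOpen_lt hcont continuous_const).mem_nhds hlt
      filter_upwards [this] with x hx
      exact hmin (show v x ≤ 1 from le_of_lt hx)
    obtain ⟨b, l, hp⟩ := h.pt x1
    have hl : ∀ i, ε + M * inner ℝ (b i) ν ^ 2 ≤ l i := by
      intro i
      have h1 := localMin_compare hC2 (ψ := ψ) (x := x1) (e := b i)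
        (A := ψ x1) (B := ε * inner ℝ (x1 - z) (b i) + M/2 * (2 * inner ℝ ν (x1 - z) * inner ℝ ν (b i) + 4*ρ*inner ℝ ν (b i)))
        (C := ε/2 + M/2 * inner ℝ ν (b i)^2) (by
          intro s
          simp only [ψ]
          have e1 : x1 + s • b i - z = (x1 - z) + s • b i := by abel
          rw [e1, norm_add_sq_real, inner_add_right, norm_smul, inner_smul_right, inner_smul_right,
            b.orthonormal.1 i, Real.norm_eq_abs, mul_one, sq_abs]
          ring) hloc
      have h2 : dd (b i) (dd (b i) v) x1 = l i := by
        have := congrFun (congrFun hp.diag i) i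
        simpa [Hb] using this
      rw [h2] at h1
      rw [real_inner_comm]
      linarith
    obtain ⟨i, hi⟩ := exists_big_coord b hν1
    have hc := card_ge hp.one
    have hN : (0:ℝ) < Fintype.card ι := by exact_mod_cast (by omega : 0 < Fintype.card ι)
    have := es_big (j := j) (l := l) (m := M * (1 / (Fintype.card ι : ℝ))) hε0 hc
      (fun i => by
        have : 0 ≤ M * inner ℝ (b i) ν ^ 2 := by positivity
        linarith [hl i]) (i := i) (by
        have : M * (1 / (Fintype.card ι : ℝ)) ≤ M * inner ℝ (b i) ν ^ 2 := by gcongr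
        linarith [hl i])
    rw [hp.one, hcard] at this
    rw [hcard] at hN
    have e : M * (1 / (N:ℝ)) * ε^(j+1) = 2 * (N+1) / N := by
      rw [hM]; field_simp
    rw [e, div_le_one hN] at this
    linarith
  · -- boundary
    have h1 : v x1 - ψ x1 ≤ v x0 - ψ x0 := hmin (show x0 ∈ {x | v x ≤ 1} by simp; linarith)
    have hψ1 : ψ x1 ≤ 1 := by
      have h2 : ‖x1 - z‖ ≤ 2*ρ := (norm_sub_le _ _).trans (by linarith [hbd x1 hx1'])
      have h3 : ‖x1 - z‖^2 ≤ (2*ρ)^2 := by gcongr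
      have h4 := abs_le.1 (abs_real_inner_le_norm ν (x1 - z))
      rw [hν1, one_mul] at h4
      have h5 := hs x1 hx1'
      simp only [ψ]
      set s := inner ℝ ν (x1 - z)
      have h6 : s^2 + 4*ρ*s ≤ 48*K*ρ^3*d := by
        have hpos : 0 ≤ 8*K*ρ^2*d := by positivity
        rcases le_or_gt s 0 with h | h
        · have : s * (s+4*ρ) ≤ 0 := mul_nonpos_of_nonpos_of_nonneg h (by linarith)
          have : 0 ≤ 48*K*ρ^3*d := by positivity
          nlinarith
        · have : s * (s+4*ρ) ≤ (8*K*ρ^2*d) * (6*ρ) := mul_le_mul h5 (by linarith) (by positivity) hpos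
          nlinarith
      have h7 : ε/2 * ‖x1 - z‖^2 ≤ 1/8 := by
        calc _ ≤ ε/2 * (2*ρ)^2 := by gcongr
          _ = 1/8 := by rw [hε]; field_simp; norm_num
      have h8 : M/2 * (s^2 + 4*ρ*s) ≤ M/2 * (48*K*ρ^3*d) := by gcongr
      linarith
    have hψ0 : 1/2 < ψ x0 := by
      have h4 := abs_le.1 (abs_real_inner_le_norm ν (x0 - z))
      rw [hν1, one_mul] at h4
      simp only [ψ]
      set s := inner ℝ ν (x0 - z)
      have h5 : -d ≤ s := by linarith
      have h6 : 0 ≤ ε/2 * ‖x0 - z‖^2 := by positivity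
      have h7 : -(4*ρ*d) ≤ s^2 + 4*ρ*s := by nlinarith [sq_nonneg s]
      have h8 : M/2 * (-(4*ρ*d)) ≤ M/2 * (s^2 + 4*ρ*s) := by gcongr
      linarith
    linarith

lemma grad_bound (j N : ℕ) {K ρ b : ℝ} (hK : 0 < K) (hρ : 0 < ρ) :
    ∃ G : ℝ, 0 < G ∧ ∀ (ι : Type) [Fintype ι] [DecidableEq ι], Fintype.card ι = N →
      ∀ v : E → ℝ, Sol ι j K v → (∀ x, v x ≤ 1 → ‖x‖ ≤ ρ) → (∀ x, -b ≤ v x) →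
      ∀ x0, v x0 ≤ 1/2 → ‖gv v x0‖ ≤ G := by
  obtain ⟨d, hd0, hd1, hd⟩ := level_ball (E := E) j N hK hρ
  refine ⟨(2 + |b|) / d, by positivity, ?_⟩
  intro ι _ _ hcard v h hbd hb x0 hx0
  rw [le_div_iff₀ hd0]
  rcases eq_or_ne (gv v x0) 0 with h0 | h0
  · rw [h0, norm_zero, zero_mul]; positivity
  have hg0 : 0 < ‖gv v x0‖ := norm_pos_iff.2 h0
  set y := x0 + (d * ‖gv v x0‖⁻¹) • gv v x0 with hy
  have e1 : y - x0 = (d * ‖gv v x0‖⁻¹) • gv v x0 := by rw [hy]; abel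
  have e2 : ‖y - x0‖ = d := by
    rw [e1, norm_smul, Real.norm_of_nonneg (by positivity)]; field_simp
  have h1 := hd ι hcard v h hbd x0 hx0 y e2.le
  have h2 := h.taylor x0 y
  rw [e2, ← gv_inner, e1, inner_smul_right, real_inner_self_eq_norm_sq] at h2
  have e3 : d * ‖gv v x0‖⁻¹ * ‖gv v x0‖^2 = ‖gv v x0‖ * d := by field_simp
  rw [e3] at h2
  have := hb x0
  have := le_abs_self b
  linarith
end gradsec


lemma log_test {ι : Type*} [Fintype ι] {η η1 g g1 : ℝ → ℝ} {η2 g2 : ℝ} {V V1 : ι → ℝ → ℝ} {V2 : ι → ℝ}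
    {β τ A B : ℝ} (hη : ∀ s, HasDerivAt η (η1 s) s) (hη1 : HasDerivAt η1 η2 0)
    (hg : ∀ s, HasDerivAt g (g1 s) s) (hg1 : HasDerivAt g1 g2 0)
    (hV : ∀ i s, HasDerivAt (V i) (V1 i s) s) (hV1 : ∀ i, HasDerivAt (V1 i) (V2 i) 0)
    (pη : 0 < η 0) (pg : 0 < g 0)
    (hmax : IsLocalMax (fun s => β * Real.log (η s) + Real.log (g s) + τ/2 * ∑ i, V i s ^ 2
      + (A + B * s + s^2/2)) 0) :
    β * (η1 0 / η 0) + g1 0 / g 0 + τ * ∑ i, V i 0 * V1 i 0 + B = 0 ∧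
    β * (η2 / η 0 - (η1 0 / η 0)^2) + (g2 / g 0 - (g1 0 / g 0)^2)
      + τ * ∑ i, (V1 i 0 ^ 2 + V i 0 * V2 i) + 1 ≤ 0 := by
  have eη : ∀ᶠ s in nhds (0:ℝ), 0 < η s := (hη 0).continuousAt.eventually_const_lt pη
  have eg : ∀ᶠ s in nhds (0:ℝ), 0 < g s := (hg 0).continuousAt.eventually_const_lt pg
  have hd : ∀ᶠ s in nhds (0:ℝ), HasDerivAt (fun s => β * Real.log (η s) + Real.log (g s) + τ/2 * ∑ i, V i s ^ 2
      + (A + B * s + s^2/2)) (β * (η1 s / η s) + g1 s / g s + τ * ∑ i, V i s * V1 i s + (B + s)) s := by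
    filter_upwards [eη, eg] with s h1 h2
    have a1 := ((hη s).log h1.ne').const_mul β
    have a2 := (hg s).log h2.ne'
    have a3 := (HasDerivAt.fun_sum (u := Finset.univ) fun i _ => (hV i s).pow 2).const_mul (τ/2)
    have a4 : HasDerivAt (fun s : ℝ => A + B * s + s^2/2) (B + s) s := by
      have := (((hasDerivAt_id s).const_mul B).const_add A).add ((hasDerivAt_pow 2 s).div_const 2)
      exact this.congr_deriv (by simp)
    refine (((a1.add a2).add a3).add a4).congr_deriv ?_
    simp only [Finset.mul_sum]
    congr 2
    refine Finset.sum_congr rfl fun i _ => ?_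
    simp; ring
  have hfirst := hmax.hasDerivAt_eq_zero hd.self_of_nhds
  have h2 : HasDerivAt (fun s => β * (η1 s / η s) + g1 s / g s + τ * ∑ i, V i s * V1 i s + (B + s))
      (β * (η2 / η 0 - (η1 0 / η 0)^2) + (g2 / g 0 - (g1 0 / g 0)^2)
      + τ * ∑ i, (V1 i 0 ^ 2 + V i 0 * V2 i) + 1) 0 := by
    have a1 := (hη1.div (hη 0) pη.ne').const_mul β
    have a2 := hg1.div (hg 0) pg.ne'
    have a3 := (HasDerivAt.fun_sum (u := Finset.univ) fun i _ => (hV i 0).mul (hV1 i)).const_mul τ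
    have a4 := (hasDerivAt_id (0:ℝ)).const_add B
    refine (((a1.add a2).add a3).add a4).congr_deriv ?_
    congr 2
    · congr 1
      · field_simp
      · field_simp
    · congr 1
      refine Finset.sum_congr rfl fun i _ => ?_
      ring
  refine ⟨by simpa using hfirst, second_deriv_test hmax hd h2⟩

lemma pogo_alg {ι : Type*} [Fintype ι] {F l y w x : ι → ℝ} {o : ι} {β τ η G ρ k : ℝ}
    (hF : ∀ q, 0 < F q) (hη : 0 < η) (hβ6 : 6 ≤ β) (hβρ : 6 * ρ^2 ≤ β) (hτ0 : 0 < τ)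
    (hτ : τ * G^2 ≤ 1/10)
    (hC : ∀ q, β * (w q / η) = y q + τ * (w q * l q) + x q)
    (hw : ∑ q, w q ^ 2 ≤ G^2) (hx : ∑ q, x q ^ 2 ≤ ρ^2) (hl : ∀ q, (l q)^2 ≤ (l o)^2)
    (hmain : 1/2 * ∑ q, F q * y q ^ 2 + τ * ∑ q, F q * l q ^ 2 + ∑ q, F q ≤
      β * k / η + ∑ q, F q * (β * (w q / η)^2) + 3/2 * (F o * ∑ q, y q ^ 2)) :
    τ/2 * (F o * l o ^ 2) + 1/2 * ∑ q, F q ≤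
      β * k / η + 9/2 * (F o * (β^2 * G^2 / η^2 + ρ^2)) := by
  have hβ0 : 0 < β := by linarith
  have hwq : ∀ q, w q ^ 2 ≤ G^2 := fun q =>
    (Finset.single_le_sum (f := fun q => w q ^ 2) (fun i _ => sq_nonneg _) (Finset.mem_univ q)).trans hw
  have hxq : ∀ q, x q ^ 2 ≤ ρ^2 := fun q =>
    (Finset.single_le_sum (f := fun q => x q ^ 2) (fun i _ => sq_nonneg _) (Finset.mem_univ q)).trans hx
  have h1 : ∑ q, F q * (β * (w q / η)^2) ≤
      1/2 * ∑ q, F q * y q ^ 2 + τ/20 * ∑ q, F q * l q ^ 2 + 1/2 * ∑ q, F q := by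
    rw [Finset.mul_sum, Finset.mul_sum, Finset.mul_sum, ← Finset.sum_add_distrib, ← Finset.sum_add_distrib]
    refine Finset.sum_le_sum fun q _ => ?_
    have : β * (w q / η)^2 ≤ 1/2 * y q ^2 + τ/20 * l q ^2 + 1/2 := by
      have e : β * (w q / η)^2 = (β * (w q / η))^2 / β := by field_simp
      rw [e, hC q, div_le_iff₀ hβ0]
      have s1 : (y q + τ * (w q * l q) + x q)^2 ≤ 3 * (y q ^2 + (τ * (w q * l q))^2 + x q ^2) := by
        nlinarith [sq_nonneg (y q - τ * (w q * l q)), sq_nonneg (y q - x q), sq_nonneg (τ * (w q * l q) - x q)]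
      have s2 : (τ * (w q * l q))^2 ≤ τ/10 * l q ^2 := by
        calc (τ * (w q * l q))^2 = τ * (τ * w q ^2) * l q ^2 := by ring
          _ ≤ τ * (1/10) * l q ^2 := by
            gcongr
            exact (mul_le_mul_of_nonneg_left (hwq q) hτ0.le).trans hτ
          _ = _ := by ring
      have s3 := hxq q
      have s4 : 6 * y q ^2 ≤ β * y q ^2 := by gcongr
      have s5 : 6 * (τ/10 * l q ^2) ≤ β * (τ/10 * l q ^2) := by gcongr
      linarith
    calc _ ≤ F q * (1/2 * y q ^2 + τ/20 * l q ^2 + 1/2) := mul_le_mul_of_nonneg_left this (hF q).le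
      _ = _ := by ring
  have h2 : ∑ q, y q ^ 2 ≤ 3 * (β^2 * G^2/η^2 + ρ^2) + 3*τ/10 * l o ^2 := by
    have : ∀ q, y q ^2 ≤ 3 * (β^2/η^2 * w q ^2) + 3*(τ^2 * l o ^2 * w q ^2) + 3 * x q ^2 := by
      intro q
      have e : y q = β * (w q / η) - τ * (w q * l q) - x q := by rw [hC q]; ring
      have s1 : y q ^2 ≤ 3 * ((β * (w q / η))^2 + (τ * (w q * l q))^2 + x q ^2) := by
        rw [e]
        nlinarith [sq_nonneg (β * (w q / η) + τ * (w q * l q)), sq_nonneg (β * (w q / η) + x q), sq_nonneg (τ * (w q * l q) - x q)]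
      have s2 : (τ * (w q * l q))^2 ≤ τ^2 * l o ^2 * w q ^2 := by
        calc _ = τ^2 * l q ^2 * w q ^2 := by ring
          _ ≤ _ := by gcongr ?_ * ?_ * ?_; exact hl q
      have s3 : (β * (w q / η))^2 = β^2/η^2 * w q ^2 := by ring
      linarith
    calc _ ≤ ∑ q, (3 * (β^2/η^2 * w q ^2) + 3*(τ^2 * l o ^2 * w q ^2) + 3 * x q ^2) :=
          Finset.sum_le_sum fun q _ => this q
      _ = 3 * (β^2/η^2 * ∑ q, w q ^2) + 3*(τ^2 * l o ^2 * ∑ q, w q ^2) + 3 * ∑ q, x q ^2 := by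
          simp only [Finset.sum_add_distrib, Finset.mul_sum]
      _ ≤ 3 * (β^2/η^2 * G^2) + 3*(τ^2 * l o ^2 * G^2) + 3 * ρ^2 := by gcongr
      _ = 3 * (β^2 * G^2/η^2 + ρ^2) + 3*τ*l o ^2 * (τ * G^2) := by ring
      _ ≤ 3 * (β^2 * G^2/η^2 + ρ^2) + 3*τ*l o ^2 * (1/10) := by gcongr
      _ = _ := by ring
  have h3 : F o * l o ^2 ≤ ∑ q, F q * l q ^2 :=
    Finset.single_le_sum (f := fun q => F q * l q ^ 2)
      (fun i _ => mul_nonneg (hF i).le (sq_nonneg _)) (Finset.mem_univ o)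
  have h4 : F o * ∑ q, y q ^ 2 ≤ F o * (3 * (β^2 * G^2/η^2 + ρ^2) + 3*τ/10 * l o ^2) :=
    mul_le_mul_of_nonneg_left h2 (hF o).le
  have h5 : τ * (F o * l o^2) ≤ τ * ∑ q, F q * l q ^2 := by gcongr
  nlinarith


section
variable {ι : Type*} [Fintype ι] [DecidableEq ι]
variable {E : Type*} [NormedAddCommGroup E] [InnerProductSpace ℝ E] [FiniteDimensional ℝ E]
variable {j : ℕ} {K : ℝ} {v : E → ℝ}

lemma PtEig.apply {x : E} {b : OrthonormalBasis ι ℝ E} {l : ι → ℝ} 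
    (hp : PtEig j K v x b l) (i k : ι) : dd (b i) (dd (b k) v) x = if i = k then l i else 0 := by
  have := congrFun (congrFun hp.diag i) k
  rw [Matrix.diagonal_apply] at this
  exact this

set_option maxHeartbeats 1000000 in
lemma pogo_pt (h : Sol ι j K v) {x : E} {b : OrthonormalBasis ι ℝ E} {l : ι → ℝ}
    (hp : PtEig j K v x b l) {o : ι} (ho : ∀ q, l q ≤ l o) (hK : 0 < K) (hlo : 3 * K ≤ l o)
    {β τ G ρ : ℝ} (hη : 0 < 1/2 - v x) (hβ6 : 6 ≤ β) (hβρ : 6 * ρ^2 ≤ β) (hτ0 : 0 < τ)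
    (hτ : τ * G^2 ≤ 1/10) (hG : ‖gv v x‖ ≤ G) (hρ : ‖x‖ ≤ ρ)
    (hmax : IsLocalMax (fun y => β * Real.log (1/2 - v y) + Real.log (dd (b o) (dd (b o) v) y)
      + τ/2 * ∑ i, dd (b i) v y ^ 2 + ‖y‖^2/2) x) :
    τ/2 * (es (Finset.univ.erase o) (j+1) l * l o ^ 2) + 1/2 * ∑ q, es (Finset.univ.erase q) (j+1) l ≤
      β * (j+2) / (1/2 - v x) + 9/2 * (es (Finset.univ.erase o) (j+1) l *
        (β^2 * G^2 / (1/2 - v x)^2 + ρ^2)) := by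
  have c4 := h.smooth
  have c3 : ∀ i, ContDiff ℝ 3 (dd i v) := fun i => dd_contDiff c4 (by norm_num) _
  have c2 : ∀ i k, ContDiff ℝ 2 (dd i (dd k v)) := fun i k => dd_contDiff (c3 k) (by norm_num) _
  have c1 : ∀ i k m, ContDiff ℝ 1 (dd i (dd k (dd m v))) := fun i k m => dd_contDiff (c2 k m) (by norm_num) _
  have comm2 : ∀ a b, dd a (dd b v) = dd b (dd a v) := fun a b => dd_comm (c4.of_le (by norm_num)) a b
  have comm3 : ∀ a b c, dd a (dd b (dd c v)) = dd b (dd a (dd c v)) := fun a b c =>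
    dd_comm ((c3 c).of_le (by norm_num)) a b
  have hlo0 : 0 < l o := by linarith
  set η := 1/2 - v x with hηdef
  set F : ι → ℝ := fun q => es (Finset.univ.erase q) (j+1) l with hFdef
  have hF : ∀ q, 0 < F q := fun q => hp.gam.erase (Finset.mem_univ q) (j+1) le_rfl
  set cc : ι → ι → ℝ := fun p q => es ((Finset.univ.erase p).erase q) j l with hcc
  have hcc0 : ∀ p q, q ≠ p → 0 < cc p q := fun p q hqp =>
    (hp.gam.erase (Finset.mem_univ p)).erase (Finset.mem_erase.2 ⟨hqp, Finset.mem_univ q⟩) j le_rfl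
  set w : ι → ℝ := fun q => dd (b q) v x with hw
  set y : ι → ℝ := fun q => dd (b q) (dd (b o) (dd (b o) v)) x / l o with hy
  set X : ι → ℝ := fun q => inner ℝ (b q) x with hX
  have hgo : dd (b o) (dd (b o) v) x = l o := by rw [hp.apply]; simp
  -- line test
  have ht : ∀ q, (β * (-w q / η) + y q + τ * ∑ i, w i * dd (b q) (dd (b i) v) x + X q = 0) ∧
     (β * (-(l q) / η - (-w q / η)^2) + (dd (b q) (dd (b q) (dd (b o) (dd (b o) v))) x / l o - y q ^2)
      + τ * ∑ i, ((dd (b q) (dd (b i) v) x)^2 + w i * dd (b q) (dd (b q) (dd (b i) v)) x) + 1 ≤ 0) := by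
    intro q
    have hline : Filter.Tendsto (fun s : ℝ => x + s • b q) (nhds 0) (nhds x) := by
      have : Continuous fun s : ℝ => x + s • b q := by fun_prop
      simpa using this.tendsto 0
    have hloc : IsLocalMax (fun s : ℝ => β * Real.log (1/2 - v (x + s • b q)) + Real.log (dd (b o) (dd (b o) v) (x + s • b q))
      + τ/2 * ∑ i, dd (b i) v (x + s • b q) ^ 2 + (‖x‖^2/2 + X q * s + s^2/2)) 0 := by
      have hn : ∀ s : ℝ, ‖x‖^2/2 + X q * s + s^2/2 = ‖x + s • b q‖^2/2 := by
        intro s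
        rw [norm_add_sq_real, norm_smul, inner_smul_right, b.orthonormal.1 q, Real.norm_eq_abs, mul_one, sq_abs,
          real_inner_comm]
        simp only [hX]; ring
      simp only [hn]
      filter_upwards [hline.eventually hmax] with s hs
      simpa using hs
    have key := log_test (η := fun s => 1/2 - v (x + s • b q)) (η1 := fun s => - dd (b q) v (x + s • b q))
      (g := fun s => dd (b o) (dd (b o) v) (x + s • b q)) (g1 := fun s => dd (b q) (dd (b o) (dd (b o) v)) (x + s • b q))
      (V := fun i s => dd (b i) v (x + s • b q)) (V1 := fun i s => dd (b q) (dd (b i) v) (x + s • b q))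
      (fun s => (dd_line (c4.of_le (by norm_num)) x (b q) s).const_sub _)
      ((dd_line ((c3 _).of_le (by norm_num)) x (b q) 0).neg)
      (fun s => dd_line ((c2 _ _).of_le (by norm_num)) x (b q) s)
      (dd_line (c1 _ _ _) x (b q) 0)
      (fun i s => dd_line ((c3 _).of_le (by norm_num)) x (b q) s)
      (fun i => dd_line ((c2 _ _).of_le (by norm_num)) x (b q) 0)
      (by simp only [zero_smul, add_zero]; exact hη) (by simp [hgo, hlo0]) hloc
    simp only [zero_smul, add_zero, hgo] at key
    have hqq : dd (b q) (dd (b q) v) x = l q := by rw [hp.apply]; simp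
    rw [hqq] at key
    exact key
  have hsum1 : ∀ q, ∑ i, w i * dd (b q) (dd (b i) v) x = w q * l q := by
    intro q
    rw [Finset.sum_eq_single q]
    · rw [hp.apply]; simp
    · intro i _ hi
      rw [hp.apply, if_neg hi.symm, mul_zero]
    · simp
  have hsum2 : ∀ q, ∑ i, (dd (b q) (dd (b i) v) x)^2 = l q ^2 := by
    intro q
    rw [Finset.sum_eq_single q]
    · rw [hp.apply]; simp
    · intro i _ hi
      rw [hp.apply, if_neg hi.symm]; simp
    · simp
  have hC : ∀ q, β * (w q / η) = y q + τ * (w q * l q) + X q := by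
    intro q
    have := (ht q).1
    rw [hsum1, neg_div] at this
    linarith
  refine pogo_alg (w := w) (x := X) (y := y) hF hη hβ6 hβρ hτ0 hτ hC ?_ ?_ ?_ ?_
  · have : ∑ q, w q ^2 = ‖gv v x‖^2 := by
      rw [← sum_inner_sq b]
      refine Finset.sum_congr rfl fun q _ => ?_
      rw [real_inner_comm, gv_inner]
    rw [this]
    gcongr
  · rw [sum_inner_sq b x]; gcongr
  · intro q
    have := hp.lb q
    have := ho q
    rw [sq_le_sq, abs_of_pos hlo0, abs_le]
    constructor <;> linarith
  · -- main inequality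
    have hsub := h.subsol hp (b o)
    have hS : ∀ q, F q * (dd (b q) (dd (b q) (dd (b o) (dd (b o) v))) x / l o) ≤
        β * (F q * l q) / η + F q * (β * (w q / η)^2) + F q * y q ^2 - τ * (F q * l q ^2)
          - τ * ∑ i, w i * (F q * dd (b i) (dd (b q) (dd (b q) v)) x) - F q := by
      intro q
      have h2 := (ht q).2
      rw [Finset.sum_add_distrib, hsum2] at h2
      have e3 : ∀ i, dd (b q) (dd (b q) (dd (b i) v)) = dd (b i) (dd (b q) (dd (b q) v)) := by
        intro i
        rw [comm2 (b q) (b i), comm3]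
      simp only [e3] at h2
      have h3 := mul_le_mul_of_nonneg_left h2 (hF q).le
      have e4 : ∑ i, w i * (F q * dd (b i) (dd (b q) (dd (b q) v)) x) =
        F q * ∑ i, w i * dd (b i) (dd (b q) (dd (b q) v)) x := by
        rw [Finset.mul_sum]; exact Finset.sum_congr rfl fun i _ => by ring
      rw [e4]
      have e5 : F q * (β * (-(l q) / η - (-w q / η)^2)) = -(β * (F q * l q) / η) - F q * (β * (w q / η)^2) := by
        ring
      nlinarith
    have hS' := Finset.sum_le_sum fun q (_ : q ∈ Finset.univ) => hS q
    simp only [Finset.sum_sub_distrib, Finset.sum_add_distrib] at hS'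
    have t1 : ∑ q, τ * ∑ i, w i * (F q * dd (b i) (dd (b q) (dd (b q) v)) x) = 0 := by
      rw [← Finset.mul_sum, Finset.sum_comm]
      have : ∀ i, ∑ q, w i * (F q * dd (b i) (dd (b q) (dd (b q) v)) x) = 0 := by
        intro i
        rw [← Finset.mul_sum, (h.T12 hp (b i)).1, mul_zero]
      simp [this]
    have eu : ∑ q, β * (F q * l q) / η = β * (j+2) / η := by
      have := es_euler Finset.univ l (j+1)
      rw [hp.one] at this
      rw [← Finset.sum_div, ← Finset.mul_sum]
      congr 2
      have e2 : ∑ q, F q * l q = ∑ q, l q * es (Finset.univ.erase q) (j+1) l :=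
        Finset.sum_congr rfl fun q _ => mul_comm _ _
      rw [e2, this]; push_cast; ring
    rw [t1, eu] at hS'
    have e6 : ∑ q, F q * (dd (b q) (dd (b q) (dd (b o) (dd (b o) v))) x / l o) =
      (∑ q, F q * (dd (b q) (dd (b q) (dd (b o) (dd (b o) v))) x)) / l o := by
      rw [Finset.sum_div]; exact Finset.sum_congr rfl fun q _ => by ring
    rw [e6] at hS'
    -- lower bound of the good term
    have good : 3/2 * ∑ q, (F q - F o) * y q ^2 ≤
        (∑ q, F q * (dd (b q) (dd (b q) (dd (b o) (dd (b o) v))) x)) / l o := by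
      rw [le_div_iff₀ hlo0]
      refine le_trans ?_ hsub
      set D : ι → ι → ℝ := fun p q => cc p q * dd (b o) (dd (b p) (dd (b q) v)) x ^2 with hD
      have hD0 : ∀ p, ∀ q ∈ Finset.univ.erase p, 0 ≤ D p q := fun p q hq =>
        mul_nonneg (hcc0 p q (Finset.ne_of_mem_erase hq)).le (sq_nonneg _)
      have hrow : ∀ q ∈ Finset.univ.erase o, D q o = D o q := by
        intro q hq
        simp only [hD, hcc]
        rw [Finset.erase_right_comm, comm2 (b q) (b o)]
      have hy2 : ∀ q, D o q = cc o q * (l o * y q)^2 := by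
        intro q
        simp only [hD, hy]
        rw [mul_div_cancel₀ _ hlo0.ne', comm2 (b o) (b q), comm3 (b o) (b q)]
      have low : 2 * ∑ q ∈ Finset.univ.erase o, D o q ≤ ∑ p, ∑ q ∈ Finset.univ.erase p, D p q := by
        rw [← Finset.add_sum_erase Finset.univ _ (Finset.mem_univ o)]
        have : ∑ q ∈ Finset.univ.erase o, D o q ≤ ∑ p ∈ Finset.univ.erase o, ∑ q ∈ Finset.univ.erase p, D p q := by
          refine Finset.sum_le_sum fun p hp' => ?_
          rw [← hrow p hp']
          exact Finset.single_le_sum (hD0 p) (Finset.mem_erase.2 ⟨(Finset.ne_of_mem_erase hp').symm, Finset.mem_univ _⟩)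
        linarith
      refine le_trans ?_ low
      rw [← Finset.add_sum_erase Finset.univ _ (Finset.mem_univ o)]
      simp only [sub_self, zero_mul, zero_add]
      rw [Finset.mul_sum, Finset.mul_sum, Finset.sum_mul]
      refine Finset.sum_le_sum fun q hq => ?_
      have hqo := Finset.ne_of_mem_erase hq
      have ed := es_erase_diff j l (Finset.mem_univ o) (Finset.mem_univ q) hqo
      rw [hy2]
      simp only [hFdef]
      rw [ed]
      have hc := hcc0 o q hqo
      simp only [hcc] at hc ⊢
      have hlq := hp.lb q
      have : 3/2 * (l o - l q) ≤ 2 * l o := by linarith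
      have h7 : 0 ≤ es ((Finset.univ.erase o).erase q) j l * y q ^2 * l o := by positivity
      calc _ = (3/2 * (l o - l q)) * (es ((Finset.univ.erase o).erase q) j l * y q ^2 * l o) := by ring
        _ ≤ (2 * l o) * (es ((Finset.univ.erase o).erase q) j l * y q ^2 * l o) := by gcongr
        _ = _ := by ring
    have e7 : ∑ q, (F q - F o) * y q ^2 = ∑ q, F q * y q ^2 - F o * ∑ q, y q ^2 := by
      rw [Finset.mul_sum, ← Finset.sum_sub_distrib]
      exact Finset.sum_congr rfl fun q _ => by ring
    have e8 : ∑ q, τ * (F q * l q ^2) = τ * ∑ q, F q * l q ^2 := by rw [Finset.mul_sum]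
    rw [e7] at good
    rw [e8] at hS'
    linarith
end


section
variable {E : Type*} [NormedAddCommGroup E] [InnerProductSpace ℝ E] [FiniteDimensional ℝ E]

lemma dd2_eq {E : Type*} [NormedAddCommGroup E] [NormedSpace ℝ E] {w : E → ℝ} (hw : ContDiff ℝ 2 w) (a b x : E) :
    dd a (dd b w) x = fderiv ℝ (fderiv ℝ w) x a b := by
  have hd : DifferentiableAt ℝ (fderiv ℝ w) x :=
    ((hw.fderiv_right (m := 1) (by norm_num)).differentiable one_ne_zero) x
  unfold dd
  rw [fderiv_clm_apply hd (differentiableAt_const b)]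
  simp

lemma dd2_cont {E : Type*} [NormedAddCommGroup E] [NormedSpace ℝ E] {w : E → ℝ} (hw : ContDiff ℝ 2 w) :
    Continuous fun p : E × E => dd p.2 (dd p.2 w) p.1 := by
  simp only [dd2_eq hw]
  have h1 : Continuous (fderiv ℝ (fderiv ℝ w)) :=
    (hw.fderiv_right (m := 1) (by norm_num)).continuous_fderiv one_ne_zero
  exact ((h1.comp continuous_fst).clm_apply continuous_snd).clm_apply continuous_snd

lemma gv_cont {w : E → ℝ} (hw : ContDiff ℝ 1 w) : Continuous (gv w) := by
  unfold gv
  exact (LinearIsometryEquiv.continuous _).comp (hw.continuous_fderiv one_ne_zero)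

lemma gv_norm_sq {ι : Type*} [Fintype ι] [DecidableEq ι] (b : OrthonormalBasis ι ℝ E) (v : E → ℝ) (x : E) :
    ‖gv v x‖^2 = ∑ q, dd (b q) v x ^2 := by
  rw [← sum_inner_sq b]
  refine Finset.sum_congr rfl fun q _ => ?_
  rw [real_inner_comm, gv_inner]

/-- final scalar estimate -/
lemma pogo_scalar {ι : Type*} [Fintype ι] [DecidableEq ι] {j : ℕ} {l : ι → ℝ} {o : ι} {K η H τ G ρ : ℝ} {β : ℕ}
    (hg : Gam Finset.univ (j+2) l) (h1 : es Finset.univ (j+2) l = 1) (hK : 0 < K) (hl : ∀ i, -K ≤ l i)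
    (hlo : 0 ≤ l o)
    (hη : 0 < η) (hηH : η ≤ H) (hH : 1 ≤ H) (hτ : 0 < τ) (hβ1 : 1 ≤ β) (hβj : j + 1 ≤ β)
    (hm : 3 * K ≤ l o → τ/2 * (es (Finset.univ.erase o) (j+1) l * l o ^ 2) + 1/2 * ∑ q, es (Finset.univ.erase q) (j+1) l ≤
      β * (j+2) / η + 9/2 * (es (Finset.univ.erase o) (j+1) l * (β^2 * G^2 / η^2 + ρ^2))) :
    η^β * l o ≤ H^β * (3*K + (1 + 9/τ * (β^2*G^2 + ρ^2*H^2)) + (Fintype.card ι * K + (2*β*(j+2))^(j+1))) := by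
  have hF : 0 < es (Finset.univ.erase o) (j+1) l := hg.erase (Finset.mem_univ o) (j+1) le_rfl
  have p1 : 0 ≤ 3*K := by positivity
  have p2 : 0 ≤ 1 + 9/τ * (β^2*G^2 + ρ^2*H^2) := by positivity
  have p3 : 0 ≤ Fintype.card ι * K := by positivity
  have p4 : (0:ℝ) ≤ (2*β*(j+2))^(j+1) := by positivity
  have hHβ : 0 < H^β := by positivity
  have hpow : η^β ≤ H^β := by gcongr
  rcases le_or_gt (l o) (3*K) with hc | hc
  · calc η^β * l o ≤ H^β * (3*K) := by gcongr
      _ ≤ _ := by gcongr; linarith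
  have hm := hm hc.le
  rcases le_or_gt (τ/2 * l o ^2) (9/2 * (β^2 * G^2 / η^2 + ρ^2)) with hc2 | hc2
  · have h3 : η * l o ≤ 1 + 9/τ * (β^2*G^2 + ρ^2*H^2) := by
      have : (η * l o)^2 ≤ 9/τ * (β^2*G^2 + ρ^2*H^2) := by
        have e : l o ^2 ≤ 9/τ * (β^2 * G^2 / η^2 + ρ^2) := by
          rw [div_mul_eq_mul_div, le_div_iff₀ hτ]; linarith
        calc (η * l o)^2 = η^2 * l o^2 := by ring
          _ ≤ η^2 * (9/τ * (β^2 * G^2 / η^2 + ρ^2)) := by gcongr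
          _ = 9/τ * (β^2 * G^2 + ρ^2 * η^2) := by field_simp
          _ ≤ _ := by gcongr
      nlinarith [sq_nonneg (η * l o - 1)]
    calc η^β * l o = η^(β-1) * (η * l o) := by
          obtain ⟨m, rfl⟩ := Nat.exists_eq_add_of_le hβ1
          simp [pow_add]; ring
      _ ≤ H^β * (1 + 9/τ * (β^2*G^2 + ρ^2*H^2)) := by
          gcongr ?_ * ?_
          calc η^(β-1) ≤ H^(β-1) := by gcongr
            _ ≤ H^β := pow_le_pow_right₀ hH (by omega)
      _ ≤ _ := mul_le_mul_of_nonneg_left (by linarith) (by positivity)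
  · have h2 : 1/2 * ∑ q, es (Finset.univ.erase q) (j+1) l ≤ β * (j+2) / η := by
      have : es (Finset.univ.erase o) (j+1) l * (9/2 * (β^2 * G^2 / η^2 + ρ^2)) ≤ 
        es (Finset.univ.erase o) (j+1) l * (τ/2 * l o ^2) := by gcongr
      linarith
    rw [es_sum_erase, Finset.card_univ] at h2
    have hc := card_ge h1
    have hN : (j:ℝ) + 2 ≤ Fintype.card ι := by exact_mod_cast hc
    have hs := hg (j+1) (by omega)
    have h3 : es Finset.univ (j+1) l ≤ 2*β*(j+2)/η := by
      push_cast at h2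
      have : es Finset.univ (j+1) l ≤ (Fintype.card ι - ((j:ℝ)+1)) * es Finset.univ (j+1) l := by
        nlinarith
      have e : 2*β*(j+2)/η = 2 * (β * (j+2)/η) := by ring
      rw [e]; linarith
    have h4 := sigma1_le (by omega) hg h1
    simp only [Nat.add_succ_sub_one] at h4
    have h5 : es Finset.univ 1 l ≤ (2*β*(j+2)/η)^(j+1) := h4.trans (by gcongr)
    have h6 : l o ≤ es Finset.univ 1 l + Fintype.card ι * K := by
      rw [es_one]
      have : l o + K ≤ ∑ i, (l i + K) := 
        Finset.single_le_sum (f := fun i => l i + K) (fun i _ => by linarith [hl i]) (Finset.mem_univ o)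
      rw [Finset.sum_add_distrib] at this
      simp at this
      linarith
    calc η^β * l o ≤ η^β * ((2*β*(j+2)/η)^(j+1) + Fintype.card ι * K) := by gcongr; linarith
      _ = η^(β-(j+1)) * (2*β*(j+2))^(j+1) + η^β * (Fintype.card ι * K) := by
          obtain ⟨m, rfl⟩ := Nat.exists_eq_add_of_le hβj
          rw [div_pow, mul_add]
          congr 1
          simp only [add_tsub_cancel_left, pow_add η]
          field_simp
      _ ≤ H^β * (2*β*(j+2))^(j+1) + H^β * (Fintype.card ι * K) := by
          gcongr ?_ * _ + ?_ * _
          calc η^(β-(j+1)) ≤ H^(β-(j+1)) := by gcongr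
            _ ≤ H^β := pow_le_pow_right₀ hH (by omega)
      _ = H^β * (Fintype.card ι * K + (2*β*(j+2))^(j+1)) := by ring
      _ ≤ _ := mul_le_mul_of_nonneg_left (by linarith) (by positivity)

set_option maxHeartbeats 1000000 in
lemma pogo_bound (j N : ℕ) {K ρ b G : ℝ} (hK : 0 < K) (hρ0 : 0 < ρ) (hG0 : 0 < G) :
    ∃ (β : ℕ) (C : ℝ), 0 < C ∧ ∀ (ι : Type) [Fintype ι] [DecidableEq ι], Fintype.card ι = N →
      ∀ v : E → ℝ, Sol ι j K v → (∀ x, v x ≤ 1 → ‖x‖ ≤ ρ) → (∀ x, -b ≤ v x) →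
      (∀ x, v x ≤ 1/2 → ‖gv v x‖ ≤ G) →
      ∀ x, v x ≤ 1/2 → ∀ e : E, ‖e‖ = 1 → (1/2 - v x)^β * dd e (dd e v) x ≤ C := by
  obtain ⟨β, hβ⟩ := exists_nat_ge (6 + 6*ρ^2 + j)
  have hβ6 : (6:ℝ) ≤ β := by
    have : 0 ≤ ρ^2 := sq_nonneg _
    have : (0:ℝ) ≤ j := by positivity
    linarith
  have hβρ : 6*ρ^2 ≤ β := by
    have : (0:ℝ) ≤ j := by positivity
    linarith
  have hβj : j + 1 ≤ β := by
    have : (j:ℝ) + 1 ≤ β := by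
      have : 0 ≤ ρ^2 := sq_nonneg _
      linarith
    exact_mod_cast this
  set τ : ℝ := 1 / (10 * (G^2+1)) with hτd
  have hτ0 : 0 < τ := by positivity
  have hτ : τ * G^2 ≤ 1/10 := by
    rw [hτd, div_mul_eq_mul_div, div_le_div_iff₀ (by positivity) (by norm_num)]
    nlinarith
  set H : ℝ := 1 + |b| with hH
  have hH1 : 1 ≤ H := by rw [hH]; linarith [abs_nonneg b]
  set C' : ℝ := H^β * (3*K + (1 + 9/τ * (β^2*G^2 + ρ^2*H^2)) + (N * K + (2*β*(j+2))^(j+1))) with hC'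
  have hC'0 : 0 < C' := by positivity
  refine ⟨β, C' * Real.exp (τ/2 * G^2 + ρ^2/2), by positivity, ?_⟩
  intro ι _ _ hcard v h hbd hb hG x hx e he
  have hC2 : ContDiff ℝ 2 v := h.smooth.of_le (by norm_num)
  have hcont : Continuous v := hC2.continuous
  set Q : E → ℝ := fun x => τ/2 * ‖gv v x‖^2 + ‖x‖^2/2 with hQ
  have hQc : Continuous Q := by
    have := gv_cont (hC2.of_le (by norm_num) : ContDiff ℝ 1 v)
    fun_prop
  set Φ : E × E → ℝ := fun p => (1/2 - v p.1)^β * Real.exp (Q p.1) * dd p.2 (dd p.2 v) p.1 with hΦ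
  have hΦc : Continuous Φ := by
    refine Continuous.mul ?_ (dd2_cont hC2)
    fun_prop
  have hcomp : IsCompact {x | v x ≤ 1/2} := by
    apply Metric.isCompact_of_isClosed_isBounded (isClosed_le hcont continuous_const)
    exact (Metric.isBounded_closedBall (x := (0:E)) (r := ρ)).subset fun x hx => by
      have hx' : v x ≤ 1/2 := hx
      simpa using hbd x (by linarith)
  obtain ⟨⟨x0, e0⟩, ⟨hx0, he0⟩, hmax⟩ := (hcomp.prod (isCompact_sphere (0:E) 1)).exists_isMaxOn
    ⟨(x, e), hx, by simpa using he⟩ hΦc.continuousOn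
  have hx0' : v x0 ≤ 1/2 := hx0
  have he0' : ‖e0‖ = 1 := by simpa using he0
  have hmax' : ∀ y f, v y ≤ 1/2 → ‖f‖ = 1 → Φ (y, f) ≤ Φ (x0, e0) := fun y f hy hf =>
    hmax (show (y, f) ∈ _ from ⟨hy, by simpa using hf⟩)
  have hQle : ∀ y, v y ≤ 1/2 → Q y ≤ τ/2 * G^2 + ρ^2/2 := by
    intro y hy
    have h1 := hG y hy
    have h2 := hbd y (by linarith)
    simp only [hQ]
    gcongr
  have hQ0 : ∀ y, 0 ≤ Q y := fun y => by simp only [hQ]; positivity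
  -- it suffices to bound Φ(x0,e0)
  suffices hb0 : Φ (x0, e0) ≤ C' * Real.exp (τ/2 * G^2 + ρ^2/2) by
    rcases le_or_gt (dd e (dd e v) x) 0 with hn | hn
    · have : (1/2 - v x)^β * dd e (dd e v) x ≤ 0 :=
        mul_nonpos_of_nonneg_of_nonpos (pow_nonneg (by linarith) _) hn
      exact this.trans (by positivity)
    · refine le_trans ?_ ((hmax' x e hx he).trans hb0)
      simp only [hΦ]
      have h1 : 0 ≤ (1/2 - v x)^β := pow_nonneg (by linarith) _
      have h2 : 1 ≤ Real.exp (Q x) := Real.one_le_exp (hQ0 x)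
      have : (1/2 - v x)^β * 1 ≤ (1/2 - v x)^β * Real.exp (Q x) := by gcongr
      nlinarith
  rcases le_or_gt (Φ (x0, e0)) 0 with hn | hpos
  · exact hn.trans (by positivity)
  have hη : 0 < 1/2 - v x0 := by
    rcases lt_or_eq_of_le hx0' with h' | h'
    · linarith
    · exfalso
      simp only [hΦ, h'] at hpos
      rw [sub_self, zero_pow (by have : (0:ℝ) < β := by linarith
                                 have : 0 < β := by exact_mod_cast this
                                 omega)] at hpos
      simp at hpos
  obtain ⟨B, l, hp⟩ := h.pt x0
  have hne : Nonempty ι := Fintype.card_pos_iff.1 (by have := card_ge hp.one; omega)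
  obtain ⟨o, ho⟩ := Finite.exists_max l
  have hdo : dd (B o) (dd (B o) v) x0 = l o := by rw [hp.apply]; simp
  have hle : dd e0 (dd e0 v) x0 ≤ l o := by
    rw [hp.form hC2]
    calc _ ≤ ∑ i, l o * (inner ℝ (B i) e0)^2 := Finset.sum_le_sum fun i _ => by
          rw [← pow_two]; exact mul_le_mul_of_nonneg_right (ho i) (sq_nonneg _)
      _ = l o := by rw [← Finset.mul_sum, sum_inner_sq, he0']; ring
  have hpre : 0 < (1/2 - v x0)^β * Real.exp (Q x0) := by positivity
  have hΦo : Φ (x0, e0) ≤ Φ (x0, B o) := by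
    simp only [hΦ, hdo]
    exact mul_le_mul_of_nonneg_left hle hpre.le
  have hlo : 0 < l o := by
    have := lt_of_lt_of_le hpos hΦo
    simp only [hΦ, hdo] at this
    exact (pos_iff_pos_of_mul_pos this).1 hpre
  have hloc : IsLocalMax (fun y => (β:ℝ) * Real.log (1/2 - v y) + Real.log (dd (B o) (dd (B o) v) y)
      + τ/2 * ∑ i, dd (B i) v y ^ 2 + ‖y‖^2/2) x0 := by
    have c2 : Continuous (dd (B o) (dd (B o) v)) := by
      have := (dd2_cont hC2).comp (Continuous.prodMk continuous_id (continuous_const (y := B o)))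
      exact this
    have ev1 : ∀ᶠ y in nhds x0, 0 < 1/2 - v y := 
      (continuous_const.sub hcont).continuousAt.eventually_const_lt hη
    have ev2 : ∀ᶠ y in nhds x0, 0 < dd (B o) (dd (B o) v) y :=
      c2.continuousAt.eventually_const_lt (by rw [hdo]; exact hlo)
    have hlog : ∀ y, 0 < 1/2 - v y → 0 < dd (B o) (dd (B o) v) y → 
        Real.log (Φ (y, B o)) = (β:ℝ) * Real.log (1/2 - v y) + Real.log (dd (B o) (dd (B o) v) y)
      + τ/2 * ∑ i, dd (B i) v y ^ 2 + ‖y‖^2/2 := by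
      intro y h1 h2
      simp only [hΦ]
      rw [Real.log_mul (by positivity) h2.ne', Real.log_mul (by positivity) (Real.exp_pos _).ne',
        Real.log_exp, Real.log_pow, ← gv_norm_sq]
      simp only [hQ]; ring
    filter_upwards [ev1, ev2] with y h1 h2
    rw [← hlog y h1 h2, ← hlog x0 hη (by rw [hdo]; exact hlo)]
    apply Real.log_le_log
    · simp only [hΦ]; positivity
    · exact (hmax' y (B o) (by linarith) (B.orthonormal.1 o)).trans hΦo
  have hfin := pogo_scalar (o := o) (τ := τ) (G := G) (ρ := ρ) (H := H) (β := β) (η := 1/2 - v x0) hp.gam hp.one hK hp.lb hlo.le hη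
    (by rw [hH]; have := hb x0; have := neg_abs_le b; have := le_abs_self b; linarith)
    hH1 hτ0 (by omega) hβj (fun h3 => pogo_pt h hp ho hK h3 hη hβ6 hβρ hτ0 hτ (hG x0 hx0') (hbd x0 (by linarith)) hloc)
  rw [hcard] at hfin
  calc Φ (x0, e0) ≤ Φ (x0, B o) := hΦo
    _ = ((1/2 - v x0)^β * l o) * Real.exp (Q x0) := by simp only [hΦ, hdo]; ring
    _ ≤ C' * Real.exp (τ/2 * G^2 + ρ^2/2) := by
      gcongr
      exact hQle x0 hx0'
end


section
variable {E : Type*} [NormedAddCommGroup E] [InnerProductSpace ℝ E] [FiniteDimensional ℝ E]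

lemma dd_affine {w : E → ℝ} (hw : ContDiff ℝ 1 w) (c R : ℝ) (x0 e : E) :
    dd e (fun y => c * w (x0 + R • y)) = fun y => (c * R) * dd e w (x0 + R • y) := by
  funext y
  have h1 : HasFDerivAt (fun y : E => x0 + R • y) (R • ContinuousLinearMap.id ℝ E) y :=
    ((hasFDerivAt_id y).const_smul R).const_add x0
  have h2 := (((hw.differentiable one_ne_zero (x0 + R • y)).hasFDerivAt).comp y h1).const_mul c
  have h3 : fderiv ℝ (fun y => c * w (x0 + R • y)) y = _ := h2.fderiv
  unfold dd
  rw [h3]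
  simp
  ring

lemma affine_contDiff {n : WithTop ℕ∞} {w : E → ℝ} (hw : ContDiff ℝ n w) (c R : ℝ) (x0 : E) :
    ContDiff ℝ n (fun y => c * w (x0 + R • y)) := by
  refine contDiff_const.mul (hw.comp ?_)
  exact contDiff_const.add (contDiff_const.smul contDiff_id)

variable {ι : Type*} [Fintype ι] [DecidableEq ι] {j : ℕ} {K : ℝ} {v : E → ℝ}

lemma dd2_affine {w : E → ℝ} (hw : ContDiff ℝ 2 w) (c R : ℝ) (x0 e f : E) :
    dd e (dd f (fun y => c * w (x0 + R • y))) = fun y => (c * R * R) * dd e (dd f w) (x0 + R • y) := by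
  rw [dd_affine (hw.of_le (by norm_num)), dd_affine (dd_contDiff hw (by norm_num) f)]

lemma Sol.scale (h : Sol ι j K v) {R : ℝ} (hR : 0 < R) :
    Sol ι j K (fun y => (1/R^2) * v (0 + R • y)) := by
  refine ⟨affine_contDiff h.smooth _ _ _, fun x => ?_⟩
  obtain ⟨b, l, hp⟩ := h.pt (0 + R • x)
  refine ⟨b, l, ?_, hp.gam, hp.one, hp.lb⟩
  rw [← hp.diag]
  ext p q
  simp only [Hb, Matrix.of_apply]
  rw [dd2_affine (h.smooth.of_le (by norm_num))]
  field_simp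

lemma hess_bound {ι : Type} [Fintype ι] [DecidableEq ι] {a b : ℝ} (h : Sol ι j K v) (hK : 0 < K) (ha : 0 < a) (hb : 0 < b)
    (hgr : ∀ x, a * ‖x‖^2 - b ≤ v x) :
    ∃ C : ℝ, 0 < C ∧ ∀ x e : E, ‖e‖ = 1 → dd e (dd e v) x ≤ C := by
  set ρ : ℝ := Real.sqrt ((1+b)/a) with hρ
  have hρ0 : 0 < ρ := Real.sqrt_pos.2 (by positivity)
  obtain ⟨G, hG0, hG⟩ := grad_bound (E := E) j (Fintype.card ι) (b := b) hK hρ0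
  obtain ⟨β, C, hC, hb2⟩ := pogo_bound (E := E) j (Fintype.card ι) (b := b) hK hρ0 hG0
  refine ⟨C * 4^β, by positivity, fun x e he => ?_⟩
  obtain ⟨R, hR⟩ := exists_nat_ge (1 + 4 * |v x|)
  have hR1 : (1:ℝ) ≤ R := by linarith [abs_nonneg (v x)]
  have hR0 : (0:ℝ) < R := by linarith
  set w : E → ℝ := fun y => (1/(R:ℝ)^2) * v (0 + (R:ℝ) • y) with hw
  have hs : Sol ι j K w := h.scale hR0
  have hgw : ∀ y, a * ‖y‖^2 - b ≤ w y := by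
    intro y
    have h1 := hgr (0 + (R:ℝ) • y)
    rw [zero_add, norm_smul, Real.norm_eq_abs, abs_of_pos hR0] at h1
    simp only [hw, zero_add]
    rw [one_div_mul_eq_div, le_div_iff₀ (by positivity)]
    nlinarith [one_le_pow₀ hR1 (n := 2)]
  have h1 : ∀ y, w y ≤ 1 → ‖y‖ ≤ ρ := by
    intro y hy
    apply Real.le_sqrt_of_sq_le
    rw [le_div_iff₀ ha]
    linarith [hgw y]
  have h2 : ∀ y, -b ≤ w y := fun y => by nlinarith [hgw y, sq_nonneg ‖y‖]
  have hwx : w ((1/(R:ℝ)) • x) ≤ 1/4 := by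
    simp only [hw, zero_add, smul_smul]
    rw [mul_one_div_cancel hR0.ne', one_smul, one_div_mul_eq_div, div_le_iff₀ (by positivity)]
    nlinarith [le_abs_self (v x), abs_nonneg (v x)]
  have h3 := hb2 ι rfl w hs h1 h2 (hG ι rfl w hs h1 h2) ((1/(R:ℝ)) • x) (by linarith) e he
  have e1 : dd e (dd e w) ((1/(R:ℝ)) • x) = dd e (dd e v) x := by
    rw [hw, dd2_affine (h.smooth.of_le (by norm_num))]
    simp only [zero_add, smul_smul]
    rw [mul_one_div_cancel hR0.ne', one_smul]
    field_simp
  rw [e1] at h3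
  rcases le_or_gt (dd e (dd e v) x) 0 with hn | hn
  · exact hn.trans (by positivity)
  have h4 : (1/4:ℝ)^β * dd e (dd e v) x ≤ C := by
    refine le_trans ?_ h3
    gcongr
    linarith
  rw [one_div, inv_pow, inv_mul_le_iff₀ (by positivity)] at h4
  linarith
end


section
variable {E : Type*} [NormedAddCommGroup E] [InnerProductSpace ℝ E]
variable {ι : Type*} [Fintype ι] [DecidableEq ι]

/-- divergence free uniformly elliptic coefficient matrices -/
structure Ell (b : OrthonormalBasis ι ℝ E) (lo hi : ℝ) (A : E → Matrix ι ι ℝ) : Prop where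
  smooth : ∀ p q, ContDiff ℝ 1 (fun x => A x p q)
  symm : ∀ x p q, A x p q = A x q p
  lower : ∀ x (ξ : ι → ℝ), lo * ∑ p, ξ p ^ 2 ≤ ∑ p, ∑ q, A x p q * (ξ p * ξ q)
  upper : ∀ x (ξ : ι → ℝ), ∑ p, ∑ q, A x p q * (ξ p * ξ q) ≤ hi * ∑ p, ξ p ^ 2
  div : ∀ x q, ∑ p, dd (b p) (fun y => A y p q) x = 0

/-- the operator -/
def LL (b : OrthonormalBasis ι ℝ E) (A : E → Matrix ι ι ℝ) (w : E → ℝ) (x : E) : ℝ :=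
  ∑ p, ∑ q, A x p q * dd (b p) (dd (b q) w) x

/-- the bilinear form -/
def QQ (b : OrthonormalBasis ι ℝ E) (A : E → Matrix ι ι ℝ) (f g : E → ℝ) (x : E) : ℝ :=
  ∑ p, ∑ q, A x p q * (dd (b p) f x * dd (b q) g x)

lemma detD1_adj (M M1 : Matrix ι ι ℝ) : detD1 M M1 = ∑ i, ∑ k, M.adjugate i k * M1 k i := by
  unfold detD1
  refine Finset.sum_congr rfl fun i _ => ?_
  rw [← Matrix.cramer_apply, Matrix.cramer_eq_adjugate_mulVec]
  rfl

lemma det_contDiff {n : WithTop ℕ∞} {P : E → Matrix ι ι ℝ} (hP : ∀ p q, ContDiff ℝ n (fun x => P x p q)) :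
    ContDiff ℝ n (fun x => (P x).det) := by
  simp only [Matrix.det_apply']
  refine ContDiff.sum fun σ _ => contDiff_const.mul ?_
  exact contDiff_prod fun i _ => hP _ _

lemma adj_contDiff {n : WithTop ℕ∞} {P : E → Matrix ι ι ℝ} (hP : ∀ p q, ContDiff ℝ n (fun x => P x p q)) (i j : ι) :
    ContDiff ℝ n (fun x => (P x).adjugate i j) := by
  simp only [Matrix.adjugate_apply]
  apply det_contDiff
  intro p q
  by_cases hp : p = j
  · subst hp; simp only [Matrix.updateRow_self]; exact contDiff_const
  · simp only [Matrix.updateRow_ne hp]; exact hP p q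

lemma dd_hasDerivAt {w : E → ℝ} (hw : ContDiff ℝ 1 w) (x e : E) :
    HasDerivAt (fun s : ℝ => w (x + s • e)) (dd e w x) 0 := by
  simpa using dd_line hw x e 0

lemma dd_unique {w : E → ℝ} (hw : ContDiff ℝ 1 w) {x e : E} {c : ℝ}
    (h : HasDerivAt (fun s : ℝ => w (x + s • e)) c 0) : dd e w x = c :=
  (dd_hasDerivAt hw x e).unique h

lemma dd_det {P : E → Matrix ι ι ℝ} (hP : ∀ p q, ContDiff ℝ 1 (fun x => P x p q)) (x e : E) :
    dd e (fun y => (P y).det) x = ∑ i, ∑ k, (P x).adjugate i k * dd e (fun y => P y k i) x := by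
  apply dd_unique (det_contDiff hP)
  have := det_hasDerivAt (M := fun s : ℝ => P (x + s • e)) (M1 := Matrix.of fun k i => dd e (fun y => P y k i) x)
    (s := 0) (fun i k => dd_hasDerivAt (hP i k) x e)
  refine this.congr_deriv ?_
  have h2 := detD1_adj (P x) (Matrix.of fun k i => dd e (fun y => P y k i) x)
  simpa [detD1] using h2

lemma cofactor_div {b : ι → E} {P : E → Matrix ι ι ℝ} (hP : ∀ p q, ContDiff ℝ 1 (fun x => P x p q)) {x : E}
    (hsym : ∀ i k l, dd (b i) (fun y => P y k l) x = dd (b l) (fun y => P y k i) x)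
    (hd : (P x).det ≠ 0) (q : ι) :
    ∑ i, dd (b i) (fun y => (P y).adjugate i q) x = 0 := by
  set B := (P x).adjugate with hB
  set d := (P x).det with hd'
  -- derivative of P * adj P = det
  have h1 : ∀ e : E, ∀ k, ∑ l, (dd e (fun y => P y k l) x * B l q + P x k l * dd e (fun y => (P y).adjugate l q) x)
      = if k = q then dd e (fun y => (P y).det) x else 0 := by
    intro e k
    have h := HasDerivAt.fun_sum (u := Finset.univ) (fun l _ =>
      (dd_hasDerivAt (hP k l) x e).mul (dd_hasDerivAt (adj_contDiff hP l q) x e))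
    have h2 : HasDerivAt (fun s : ℝ => if k = q then (P (x + s • e)).det else 0)
        (if k = q then dd e (fun y => (P y).det) x else 0) 0 := by
      split_ifs
      · exact dd_hasDerivAt (det_contDiff hP) x e
      · exact hasDerivAt_const _ _
    have e1 : (fun s : ℝ => if k = q then (P (x + s • e)).det else 0) =
        fun s : ℝ => ∑ l, P (x + s • e) k l * (P (x + s • e)).adjugate l q := by
      funext s
      rw [← Matrix.mul_apply, Matrix.mul_adjugate]
      simp [Matrix.one_apply]
    rw [e1] at h2
    have := h.unique h2
    simpa using this
  -- multiply by B
  have h2 : ∀ (e : E) (i : ι), d * dd e (fun y => (P y).adjugate i q) x =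
      B i q * dd e (fun y => (P y).det) x - ∑ k, ∑ l, B i k * dd e (fun y => P y k l) x * B l q := by
    intro e i
    have h3 : ∑ k, B i k * (∑ l, (dd e (fun y => P y k l) x * B l q + P x k l * dd e (fun y => (P y).adjugate l q) x))
      = B i q * dd e (fun y => (P y).det) x := by
      simp only [h1 e]
      simp
    rw [← h3]
    have h4 : ∑ k, ∑ l, B i k * (P x k l * dd e (fun y => (P y).adjugate l q) x) = d * dd e (fun y => (P y).adjugate i q) x := by
      rw [Finset.sum_comm]
      have : ∀ l, ∑ k, B i k * (P x k l * dd e (fun y => (P y).adjugate l q) x) =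
          (if i = l then d else 0) * dd e (fun y => (P y).adjugate l q) x := by
        intro l
        have e2 : ∑ k, B i k * P x k l = if i = l then d else 0 := by
          rw [← Matrix.mul_apply, hB, Matrix.adjugate_mul]
          simp [Matrix.one_apply, hd']
        rw [← e2, Finset.sum_mul]
        exact Finset.sum_congr rfl fun k _ => by ring
      simp only [this]
      simp
    rw [← h4, ← Finset.sum_sub_distrib]
    refine Finset.sum_congr rfl fun k _ => ?_
    rw [Finset.mul_sum, ← Finset.sum_sub_distrib]
    exact Finset.sum_congr rfl fun l _ => by ring
  have h5 : d * ∑ i, dd (b i) (fun y => (P y).adjugate i q) x = 0 := by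
    rw [Finset.mul_sum]
    simp only [h2]
    rw [Finset.sum_sub_distrib]
    have e3 : ∑ i, ∑ k, ∑ l, B i k * dd (b i) (fun y => P y k l) x * B l q =
        ∑ l, B l q * dd (b l) (fun y => (P y).det) x := by
      have : ∀ i k l, B i k * dd (b i) (fun y => P y k l) x * B l q = B l q * (B i k * dd (b l) (fun y => P y k i) x) := by
        intro i k l
        rw [hsym]; ring
      simp only [this, dd_det hP, Finset.mul_sum]
      rw [Finset.sum_comm]
      conv_lhs => enter [2, k]; rw [Finset.sum_comm]
      rw [Finset.sum_comm]
      refine Finset.sum_congr rfl fun l _ => ?_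
      rw [Finset.sum_comm]
    rw [e3, sub_self]
  exact (mul_eq_zero.1 h5).resolve_left hd
end


section
variable {ι : Type*} [Fintype ι] [DecidableEq ι]

lemma adj_conj {U : Matrix ι ι ℝ} (hU : U.transpose * U = 1) (d : ι → ℝ) :
    (U * Matrix.diagonal d * U.transpose).adjugate =
      U * Matrix.diagonal (fun i => ∏ k ∈ Finset.univ.erase i, d k) * U.transpose := by
  have hU' : U * U.transpose = 1 := mul_eq_one_comm.1 hU
  have hdet : U.det * U.det = 1 := by
    have := congrArg Matrix.det hU
    rwa [Matrix.det_mul, Matrix.det_transpose, Matrix.det_one] at this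
  have hadj : U.adjugate = U.det • U.transpose := by
    calc U.adjugate = U.adjugate * (U * U.transpose) := by rw [hU', mul_one]
      _ = _ := by rw [← mul_assoc, Matrix.adjugate_mul, Matrix.smul_mul, one_mul]
  rw [Matrix.adjugate_mul_distrib, Matrix.adjugate_mul_distrib, ← Matrix.adjugate_transpose, hadj,
    Matrix.adjugate_diagonal]
  simp only [Matrix.transpose_smul, Matrix.transpose_transpose, Matrix.smul_mul, Matrix.mul_smul, smul_smul, hdet,
    one_smul, mul_assoc]

lemma conj_form (U : Matrix ι ι ℝ) (F : ι → ℝ) (W : Matrix ι ι ℝ) :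
    ∑ p, ∑ q, (U * Matrix.diagonal F * U.transpose) p q * W p q =
      ∑ i, F i * (U.transpose * W * U) i i := by
  simp only [Matrix.mul_apply (M := U * Matrix.diagonal F), Matrix.mul_diagonal]
  simp only [Matrix.mul_apply, Matrix.transpose_apply, Finset.sum_mul, Finset.mul_sum]
  rw [Finset.sum_comm]
  conv_lhs => enter [2, q]; rw [Finset.sum_comm]
  rw [Finset.sum_comm]
  refine Finset.sum_congr rfl fun i _ => Finset.sum_congr rfl fun p _ => Finset.sum_congr rfl fun q _ => ?_
  ring

lemma conj_form2 (U : Matrix ι ι ℝ) (F : ι → ℝ) (ξ : ι → ℝ) :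
    ∑ p, ∑ q, (U * Matrix.diagonal F * U.transpose) p q * (ξ p * ξ q) =
      ∑ i, F i * (∑ p, U p i * ξ p)^2 := by
  have := conj_form U F (Matrix.of fun p q => ξ p * ξ q)
  simp only [Matrix.of_apply] at this
  rw [this]
  refine Finset.sum_congr rfl fun i _ => ?_
  congr 1
  simp only [Matrix.mul_apply, Matrix.transpose_apply, Matrix.of_apply, pow_two]
  rw [Finset.sum_mul_sum]
  simp only [Finset.sum_mul]
  rw [Finset.sum_comm]
  refine Finset.sum_congr rfl fun p _ => Finset.sum_congr rfl fun q _ => ?_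
  ring

lemma orth_sum {U : Matrix ι ι ℝ} (hU : U.transpose * U = 1) (ξ : ι → ℝ) :
    ∑ i, (∑ p, U p i * ξ p)^2 = ∑ p, ξ p ^ 2 := by
  have h := conj_form2 U (fun _ => 1) ξ
  simp only [one_mul] at h
  rw [← h]
  have : (Matrix.diagonal fun _ : ι => (1:ℝ)) = 1 := Matrix.diagonal_one
  rw [this, mul_one, mul_eq_one_comm.1 hU]
  simp [Matrix.one_apply, pow_two]

variable {E : Type*} [NormedAddCommGroup E] [InnerProductSpace ℝ E]
 {j : ℕ} {K : ℝ} {v : E → ℝ}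

/-- linearised coefficients -/
def coefA (b : OrthonormalBasis ι ℝ E) (v : E → ℝ) (j : ℕ) (κ : ℝ) (x : E) : Matrix ι ι ℝ :=
  ∑ m ∈ Finset.range (Fintype.card ι+1), (lw (Fintype.card ι) (j+2) κ m * (κ * m)) •
    (1 + (κ * m) • Hb b v x).adjugate

lemma one_add_conj (b0 b : OrthonormalBasis ι ℝ E) (hv : ContDiff ℝ 2 v) {x : E} {l : ι → ℝ}
    (hp : Hb b v x = Matrix.diagonal l) (z : ℝ) :
    1 + z • Hb b0 v x = Ub b0 b * Matrix.diagonal (fun i => 1 + z * l i) * (Ub b0 b).transpose := by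
  have hU := Ub_orth b0 b
  have hU' : Ub b0 b * (Ub b0 b).transpose = 1 := mul_eq_one_comm.1 hU
  have h1 := Hb_conj b0 b hv x
  have h2 : Hb b0 v x = Ub b0 b * Hb b v x * (Ub b0 b).transpose := by
    rw [h1]
    calc Hb b0 v x = (Ub b0 b * (Ub b0 b).transpose) * Hb b0 v x * (Ub b0 b * (Ub b0 b).transpose) := by
          rw [hU', one_mul, mul_one]
      _ = _ := by simp only [mul_assoc]
  have h3 : Matrix.diagonal (fun i => 1 + z * l i) = 1 + z • Matrix.diagonal l := by
    ext p q
    by_cases hpq : p = q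
    · subst hpq; simp
    · simp [hpq]
  rw [h3, h2, hp, mul_add, add_mul, mul_one, hU', Matrix.mul_smul, Matrix.smul_mul]

lemma coefA_eq (b0 b : OrthonormalBasis ι ℝ E) (hv : ContDiff ℝ 2 v) {x : E} {l : ι → ℝ}
    (hp : Hb b v x = Matrix.diagonal l) {κ : ℝ} (hκ : 0 < κ) :
    coefA b0 v j κ x = Ub b0 b * Matrix.diagonal (fun i => es (Finset.univ.erase i) (j+1) l) * (Ub b0 b).transpose := by
  unfold coefA
  have h1 : ∀ m : ℕ, (1 + (κ * m) • Hb b0 v x).adjugate = _ := fun m => by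
    rw [one_add_conj b0 b hv hp, adj_conj (Ub_orth b0 b)]
  simp only [h1]
  simp only [← Matrix.smul_mul]
  simp only [Matrix.smul_mul (_ : ℝ) (Ub b0 b), ← Matrix.mul_smul]
  rw [← Finset.sum_mul, ← Finset.mul_sum]
  congr 2
  ext p q
  rw [Matrix.sum_apply]
  by_cases hpq : p = q
  · subst hpq
    simp only [Matrix.smul_apply, Matrix.diagonal_apply_eq, smul_eq_mul]
    rw [← lw_gp1 (j+1) hκ l p]
    refine Finset.sum_congr rfl fun m _ => by ring
  · simp [hpq]

lemma Hb_smooth (b0 : OrthonormalBasis ι ℝ E) (hv : ContDiff ℝ 4 v) (z : ℝ) (p q : ι) :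
    ContDiff ℝ 2 fun x => (1 + z • Hb b0 v x) p q := by
  simp only [Matrix.add_apply, Matrix.smul_apply, Hb, Matrix.of_apply, smul_eq_mul]
  exact contDiff_const.add (contDiff_const.mul (dd_contDiff (n := 3) (dd_contDiff hv (by norm_num) _) (by norm_num) _))

lemma Hb_dd (b0 : OrthonormalBasis ι ℝ E) (hv : ContDiff ℝ 4 v) (z : ℝ) (p q : ι) (e : E) :
    dd e (fun x => (1 + z • Hb b0 v x) p q) = fun x => z * dd e (dd (b0 p) (dd (b0 q) v)) x := by
  funext x
  have h1 : ContDiff ℝ 1 (dd (b0 p) (dd (b0 q) v)) :=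
    dd_contDiff (n := 2) (dd_contDiff (n := 4) hv (m := 2) (by norm_num) _) (by norm_num) _
  apply dd_unique ((Hb_smooth b0 hv z p q).of_le (by norm_num))
  simp only [Matrix.add_apply, Matrix.smul_apply, Hb, Matrix.of_apply, smul_eq_mul]
  exact ((dd_hasDerivAt h1 x e).const_mul z).const_add _

lemma es_abs_le (T : Finset ι) (k : ℕ) {l : ι → ℝ} {M : ℝ} (hM : 1 ≤ M) (hl : ∀ i, |l i| ≤ M) :
    es T k l ≤ 2^Fintype.card ι * M^k := by
  unfold es
  calc _ ≤ ∑ s ∈ T.powersetCard k, M^k := by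
        refine Finset.sum_le_sum fun s hs => ?_
        refine (le_abs_self _).trans ?_
        rw [Finset.abs_prod]
        refine (Finset.prod_le_prod (fun _ _ => abs_nonneg _) fun i _ => hl i).trans ?_
        rw [Finset.prod_const, (Finset.mem_powersetCard.1 hs).2]
    _ ≤ _ := by
        rw [Finset.sum_const, nsmul_eq_mul]
        gcongr
        have h1 : (T.powersetCard k).card ≤ 2^Fintype.card ι := by
          rw [← Finset.card_univ, ← Finset.card_powerset]
          exact Finset.card_le_card fun s _ => Finset.mem_powerset.2 (Finset.subset_univ s)
        exact_mod_cast h1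

variable [FiniteDimensional ℝ E]

lemma exists_Ell {C : ℝ} (h : Sol ι j K v) (hK : 0 < K) (hC : 0 < C)
    (hbd : ∀ x e : E, ‖e‖ = 1 → dd e (dd e v) x ≤ C) (b0 : OrthonormalBasis ι ℝ E) :
    ∃ (lo hi : ℝ) (A : E → Matrix ι ι ℝ), 0 < lo ∧ 0 < hi ∧ Ell b0 lo hi A ∧
      ∀ e x, 0 ≤ LL b0 A (dd e (dd e v)) x := by
  have hv2 : ContDiff ℝ 2 v := h.smooth.of_le (by norm_num)
  set M : ℝ := K + C + 1 with hM
  have hM1 : 1 ≤ M := by linarith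
  have hl : ∀ x (b : OrthonormalBasis ι ℝ E) l, PtEig j K v x b l → ∀ i, |l i| ≤ M := by
    intro x b l hp i
    have h1 := hbd x (b i) (b.norm_eq_one i)
    rw [hp.apply] at h1
    simp only [if_true] at h1
    rw [abs_le]
    constructor <;> linarith [hp.lb i]
  set N : ℝ := (Fintype.card ι : ℝ) with hN
  have hN0 : 0 ≤ N := by positivity
  set κ : ℝ := 1 / ((N+1) * M) with hκ
  have hκ0 : 0 < κ := by positivity
  have hF : ∀ x (b : OrthonormalBasis ι ℝ E) l, PtEig j K v x b l → coefA b0 v j κ x = _ := fun x b l hp =>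
    coefA_eq b0 b hv2 hp.diag hκ0
  have hdet : ∀ m ∈ Finset.range (Fintype.card ι+1), ∀ x, (1 + (κ * m) • Hb b0 v x).det ≠ 0 := by
    intro m hm x
    obtain ⟨b, l, hp⟩ := h.pt x
    rw [Hb_det b b0 hv2 x, hp.diag]
    have : (1 : Matrix ι ι ℝ) + (κ * m) • Matrix.diagonal l = Matrix.diagonal (fun i => 1 + (κ * m) * l i) := by
      ext p q
      by_cases hpq : p = q
      · subst hpq; simp
      · simp [hpq]
    rw [this, Matrix.det_diagonal]
    refine (Finset.prod_pos fun i _ => ?_).ne'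
    have hm' : (m:ℝ) ≤ N := by
      have := Finset.mem_range.1 hm
      rw [hN]
      exact_mod_cast Nat.lt_succ_iff.1 this
    have h1 : |(κ * m) * l i| < 1 := by
      rw [abs_mul, abs_of_nonneg (by positivity : 0 ≤ κ * (m:ℝ))]
      calc κ * m * |l i| ≤ κ * N * M := by gcongr; exact hl x b l hp i
        _ < 1 := by
          rw [hκ, div_mul_eq_mul_div, div_mul_eq_mul_div, div_lt_one (by positivity)]
          nlinarith
    linarith [(abs_lt.1 h1).1]
  refine ⟨1/(2*(N+1)*M), 2^Fintype.card ι * M^(j+1), coefA b0 v j κ, by positivity, by positivity, ⟨?_, ?_, ?_, ?_, ?_⟩, ?_⟩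
  · intro p q
    simp only [coefA, Matrix.sum_apply, Matrix.smul_apply, smul_eq_mul]
    refine ContDiff.sum fun m _ => contDiff_const.mul ?_
    exact (adj_contDiff (Hb_smooth b0 h.smooth (κ * m)) p q).of_le (by norm_num)
  · intro x p q
    obtain ⟨b, l, hp⟩ := h.pt x
    have hs : (coefA b0 v j κ x).transpose = coefA b0 v j κ x := by
      rw [hF x b l hp]
      simp [Matrix.transpose_mul, mul_assoc]
    conv_lhs => rw [← hs]
    rfl
  · intro x ξ
    obtain ⟨b, l, hp⟩ := h.pt x
    rw [hF x b l hp, conj_form2, ← orth_sum (Ub_orth b0 b) ξ, Finset.mul_sum]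
    refine Finset.sum_le_sum fun i _ => ?_
    refine mul_le_mul_of_nonneg_right ?_ (sq_nonneg _)
    have := ellip_lower hp.gam hp.one (C := M) (by linarith) (fun i _ => hl x b l hp i) (Finset.mem_univ i)
    simpa [hN] using this
  · intro x ξ
    obtain ⟨b, l, hp⟩ := h.pt x
    rw [hF x b l hp, conj_form2, ← orth_sum (Ub_orth b0 b) ξ, Finset.mul_sum]
    refine Finset.sum_le_sum fun i _ => ?_
    refine mul_le_mul_of_nonneg_right ?_ (sq_nonneg _)
    exact es_abs_le _ _ hM1 (hl x b l hp)
  · intro x q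
    have h1 : ∀ p, dd (b0 p) (fun y => coefA b0 v j κ y p q) x =
        ∑ m ∈ Finset.range (Fintype.card ι+1), (lw (Fintype.card ι) (j+2) κ m * (κ * m)) *
          dd (b0 p) (fun y => (1 + (κ * m) • Hb b0 v y).adjugate p q) x := by
      intro p
      have hs : ∀ m : ℕ, ContDiff ℝ 1 fun y => (1 + (κ * m) • Hb b0 v y).adjugate p q := fun m =>
        (adj_contDiff (Hb_smooth b0 h.smooth (κ * m)) p q).of_le (by norm_num)
      have e : (fun y => coefA b0 v j κ y p q) = fun y => ∑ m ∈ Finset.range (Fintype.card ι+1), (lw (Fintype.card ι) (j+2) κ m * (κ * m)) *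
          (1 + (κ * m) • Hb b0 v y).adjugate p q := by
        funext y
        simp only [coefA, Matrix.sum_apply, Matrix.smul_apply, smul_eq_mul]
      rw [e]
      apply dd_unique (ContDiff.sum fun m _ => contDiff_const.mul (hs m))
      exact HasDerivAt.fun_sum fun m _ => (dd_hasDerivAt (hs m) x (b0 p)).const_mul _
    simp only [h1]
    rw [Finset.sum_comm]
    refine Finset.sum_eq_zero fun m hm => ?_
    rw [← Finset.mul_sum, cofactor_div (fun p q => (Hb_smooth b0 h.smooth (κ * m) p q).of_le (by norm_num)) _ (hdet m hm x),
      mul_zero]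
    intro i k l
    rw [Hb_dd b0 h.smooth, Hb_dd b0 h.smooth]
    simp only
    have hv3 : ∀ e, ContDiff ℝ 2 (dd e v) := fun e => dd_contDiff (h.smooth.of_le (m := 3) (by norm_num)) (by norm_num) e
    rw [dd_comm (hv3 (b0 l)) (b0 i) (b0 k), dd_comm hv2 (b0 i) (b0 l), dd_comm (hv3 (b0 i)) (b0 k) (b0 l)]
  · intro e x
    obtain ⟨b, l, hp⟩ := h.pt x
    have hw : ContDiff ℝ 2 (dd e (dd e v)) := dd_contDiff (n := 3) (dd_contDiff h.smooth (by norm_num) e) (by norm_num) e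
    have h1 : LL b0 (coefA b0 v j κ) (dd e (dd e v)) x = ∑ i, es (Finset.univ.erase i) (j+1) l * dd (b i) (dd (b i) (dd e (dd e v))) x := by
      unfold LL
      rw [hF x b l hp]
      have := conj_form (Ub b0 b) (fun i => es (Finset.univ.erase i) (j+1) l) (Hb b0 (dd e (dd e v)) x)
      rw [← Hb_conj b0 b hw] at this
      exact this
    rw [h1]
    refine le_trans ?_ (h.subsol hp e)
    refine Finset.sum_nonneg fun p _ => Finset.sum_nonneg fun q hq => mul_nonneg ?_ (sq_nonneg _)
    rcases Nat.eq_zero_or_pos j with rfl | hj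
    · rw [es_zero]; norm_num
    · exact (((hp.gam.erase (Finset.mem_univ p)).erase hq) j le_rfl).le
end


section
open MeasureTheory
variable {E : Type*} [NormedAddCommGroup E] [InnerProductSpace ℝ E] [FiniteDimensional ℝ E]
  [MeasurableSpace E] [BorelSpace E]
variable {ι : Type*} [Fintype ι] [DecidableEq ι] {b : OrthonormalBasis ι ℝ E} {A : E → Matrix ι ι ℝ} {lo hi : ℝ}

lemma dd_cont {w : E → ℝ} (hw : ContDiff ℝ 1 w) (e : E) : Continuous (dd e w) :=
  (dd_contDiff (m := 0) hw (by norm_num) e).continuous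

lemma dd_supp {w : E → ℝ} (hc : HasCompactSupport w) (e : E) : HasCompactSupport (dd e w) :=
  hc.fderiv_apply ℝ e

lemma LL_cont (hA : Ell b lo hi A) {h : E → ℝ} (hh : ContDiff ℝ 2 h) : Continuous (LL b A h) := by
  unfold LL
  refine continuous_finsetSum _ fun p _ => continuous_finsetSum _ fun q _ => ?_
  exact (hA.smooth p q).continuous.mul (dd_cont (dd_contDiff hh (by norm_num) _) _)

lemma QQ_cont (hA : Ell b lo hi A) {f h : E → ℝ} (hf : ContDiff ℝ 1 f) (hh : ContDiff ℝ 1 h) :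
    Continuous (QQ b A f h) := by
  unfold QQ
  refine continuous_finsetSum _ fun p _ => continuous_finsetSum _ fun q _ => ?_
  exact (hA.smooth p q).continuous.mul ((dd_cont hf _).mul (dd_cont hh _))

lemma cint {f : E → ℝ} (hf : Continuous f) (hc : HasCompactSupport f) : Integrable f :=
  hf.integrable_of_hasCompactSupport hc

lemma weak (hA : Ell b lo hi A) {ψ h : E → ℝ} (hψ : ContDiff ℝ 1 ψ) (hc : HasCompactSupport ψ)
    (hh : ContDiff ℝ 2 h) : ∫ x, ψ x * LL b A h x = -∫ x, QQ b A ψ h x := by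
  set V : ι → E → ℝ := fun p x => ∑ q, A x p q * dd (b q) h x with hV
  have hVs : ∀ p, ContDiff ℝ 1 (V p) := fun p => ContDiff.sum fun q _ =>
    (hA.smooth p q).mul (dd_contDiff hh (by norm_num) _)
  have h1 : ∀ x, LL b A h x = ∑ p, dd (b p) (V p) x := by
    intro x
    have e : ∀ p, dd (b p) (V p) x = ∑ q, (dd (b p) (fun y => A y p q) x * dd (b q) h x + A x p q * dd (b p) (dd (b q) h) x) := by
      intro p
      apply dd_unique (hVs p)
      have := HasDerivAt.fun_sum (u := Finset.univ) (fun q _ =>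
        (dd_hasDerivAt (hA.smooth p q) x (b p)).mul (dd_hasDerivAt (dd_contDiff hh (m := 1) (by norm_num) (b q)) x (b p)))
      simpa using this
    simp only [e, Finset.sum_add_distrib]
    rw [Finset.sum_comm]
    simp only [← Finset.sum_mul, hA.div]
    simp [LL]
  have h2 : ∀ p, ∫ x, ψ x * dd (b p) (V p) x = -∫ x, dd (b p) ψ x * V p x := by
    intro p
    apply integral_mul_fderiv_eq_neg_fderiv_mul_of_integrable
    · exact cint ((dd_cont hψ _).mul (hVs p).continuous) ((dd_supp hc (b p)).mul_right)
    · exact cint (hψ.continuous.mul (dd_cont (hVs p) _)) hc.mul_right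
    · exact cint (hψ.continuous.mul (hVs p).continuous) hc.mul_right
    · exact fun x _ => hψ.differentiable one_ne_zero x
    · exact fun x _ => (hVs p).differentiable one_ne_zero x
  calc ∫ x, ψ x * LL b A h x = ∫ x, ∑ p, ψ x * dd (b p) (V p) x := by
        congr 1; funext x; rw [h1, Finset.mul_sum]
    _ = ∑ p, ∫ x, ψ x * dd (b p) (V p) x := integral_finsetSum _ fun p _ =>
        cint (hψ.continuous.mul (dd_cont (hVs p) _)) hc.mul_right
    _ = - ∑ p, ∫ x, dd (b p) ψ x * V p x := by
        rw [← Finset.sum_neg_distrib]; exact Finset.sum_congr rfl fun p _ => h2 p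
    _ = - ∫ x, ∑ p, dd (b p) ψ x * V p x := by
        rw [integral_finsetSum _ fun p _ => ?_]
        exact cint ((dd_cont hψ _).mul (hVs p).continuous) ((dd_supp hc (b p)).mul_right)
    _ = _ := by
        congr 2; funext x
        unfold QQ
        refine Finset.sum_congr rfl fun p _ => ?_
        rw [hV, Finset.mul_sum]
        exact Finset.sum_congr rfl fun q _ => by ring

lemma fd_sq (b : OrthonormalBasis ι ℝ E) (w : E → ℝ) (x : E) :
    ‖fderiv ℝ w x‖^2 = ∑ p, dd (b p) w x ^ 2 := by
  rw [← gv_norm_sq b]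
  unfold gv
  rw [LinearIsometryEquiv.norm_map]

lemma QQ_lower (hA : Ell b lo hi A) (f : E → ℝ) (x : E) : lo * ‖fderiv ℝ f x‖^2 ≤ QQ b A f f x := by
  rw [fd_sq b]; exact hA.lower x _

lemma QQ_upper (hA : Ell b lo hi A) (f : E → ℝ) (x : E) : QQ b A f f x ≤ hi * ‖fderiv ℝ f x‖^2 := by
  rw [fd_sq b]; exact hA.upper x _

lemma QQ_symm (hA : Ell b lo hi A) (f g : E → ℝ) (x : E) : QQ b A f g x = QQ b A g f x := by
  unfold QQ
  rw [Finset.sum_comm]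
  refine Finset.sum_congr rfl fun p _ => Finset.sum_congr rfl fun q _ => ?_
  rw [hA.symm x]; ring

lemma QQ_young (hA : Ell b lo hi A) (hlo : 0 ≤ lo) (f g : E → ℝ) (x : E) (s t : ℝ) :
    -(2 * (s * t) * QQ b A g f x) ≤ 1/2 * (s^2 * QQ b A f f x) + 2 * (t^2 * QQ b A g g x) := by
  have h := hA.lower x (fun p => s * dd (b p) f x + 2 * t * dd (b p) g x)
  have h0 : 0 ≤ lo * ∑ p, (s * dd (b p) f x + 2 * t * dd (b p) g x)^2 := by positivity
  have e : ∑ p, ∑ q, A x p q * ((s * dd (b p) f x + 2 * t * dd (b p) g x) * (s * dd (b q) f x + 2 * t * dd (b q) g x)) =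
      s^2 * QQ b A f f x + 2 * s * t * QQ b A f g x + 2 * s * t * QQ b A g f x + 4 * t^2 * QQ b A g g x := by
    unfold QQ
    simp only [Finset.mul_sum, ← Finset.sum_add_distrib]
    refine Finset.sum_congr rfl fun p _ => Finset.sum_congr rfl fun q _ => ?_
    ring
  rw [e, QQ_symm hA f g] at h
  nlinarith

lemma dd_mul {f g : E → ℝ} (hf : ContDiff ℝ 1 f) (hg : ContDiff ℝ 1 g) (e x : E) :
    dd e (fun y => f y * g y) x = dd e f x * g x + f x * dd e g x := by
  apply dd_unique (hf.mul hg)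
  have := (dd_hasDerivAt hf x e).fun_mul (dd_hasDerivAt hg x e)
  simpa using this

/-- Caccioppoli inequality -/
lemma caccioppoli (hA : Ell b lo hi A) (hlo : 0 ≤ lo) {f φ : E → ℝ} (hf : ContDiff ℝ 2 f) (hφ : ContDiff ℝ 1 φ)
    (hc : HasCompactSupport φ) (hpos : ∀ x, 0 ≤ f x) (hL : ∀ x, 0 ≤ LL b A f x) :
    ∫ x, φ x ^ 2 * QQ b A f f x ≤ 4 * ∫ x, f x ^ 2 * QQ b A φ φ x := by
  have hf1 : ContDiff ℝ 1 f := hf.of_le (by norm_num)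
  have hφ2 : ContDiff ℝ 1 (fun x => φ x * φ x) := hφ.mul hφ
  have hc2 : HasCompactSupport (fun x => φ x * φ x) := hc.mul_right
  have hw := weak hA (ψ := fun x => (φ x * φ x) * f x) (hφ2.mul hf1) hc2.mul_right hf
  have h0 : 0 ≤ ∫ x, (φ x * φ x) * f x * LL b A f x :=
    integral_nonneg fun x => mul_nonneg (mul_nonneg (mul_self_nonneg _) (hpos x)) (hL x)
  have hq : ∀ x, QQ b A (fun x => (φ x * φ x) * f x) f x = 2 * (φ x * f x) * QQ b A φ f x + φ x ^2 * QQ b A f f x := by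
    intro x
    unfold QQ
    simp only [dd_mul hφ2 hf1, dd_mul hφ hφ, Finset.mul_sum, ← Finset.sum_add_distrib]
    refine Finset.sum_congr rfl fun p _ => Finset.sum_congr rfl fun q _ => ?_
    ring
  have hQφ : HasCompactSupport (QQ b A φ φ) := by
    refine hc.mono' (fun x hx => ?_)
    by_contra hn
    apply hx
    have : fderiv ℝ φ x = 0 := by
      by_contra h
      exact hn ((support_fderiv_subset ℝ) h)
    simp [QQ, dd, this]
  have i1 : Integrable fun x => φ x ^ 2 * QQ b A f f x :=
    cint ((hφ.continuous.pow 2).mul (QQ_cont hA hf1 hf1)) (by simp only [pow_two]; exact hc2.mul_right)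
  have i2 : Integrable fun x => f x ^ 2 * QQ b A φ φ x :=
    cint ((hf.continuous.pow 2).mul (QQ_cont hA hφ hφ)) hQφ.mul_left
  have i3 : Integrable fun x => QQ b A (fun x => (φ x * φ x) * f x) f x := by
    simp only [hq]
    refine cint ((((continuous_const.mul (hφ.continuous.mul hf.continuous)).mul (QQ_cont hA hφ hf1))).add
      ((hφ.continuous.pow 2).mul (QQ_cont hA hf1 hf1))) ?_
    refine HasCompactSupport.add ?_ ?_
    · exact (HasCompactSupport.mul_left (f := fun _ => (2:ℝ)) (f' := fun x => φ x * f x) hc.mul_right).mul_right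
    · simp only [pow_two]; exact hc2.mul_right
  have h3 : ∫ x, φ x ^ 2 * QQ b A f f x ≤ ∫ x, (QQ b A (fun x => (φ x * φ x) * f x) f x + 
      (1/2 * (φ x ^ 2 * QQ b A f f x) + 2 * (f x ^ 2 * QQ b A φ φ x))) := by
    refine integral_mono i1 (i3.add ((i1.const_mul _).add (i2.const_mul _))) fun x => ?_
    have := QQ_young hA hlo f φ x (φ x) (f x)
    simp only [hq]
    linarith
  have i5 : Integrable fun x => (1/2 * (φ x ^ 2 * QQ b A f f x) + 2 * (f x ^ 2 * QQ b A φ φ x)) :=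
    (i1.const_mul _).add (i2.const_mul _)
  rw [integral_add i3 i5, integral_add (i1.const_mul _) (i2.const_mul _),
    integral_const_mul, integral_const_mul] at h3
  linarith

/-- energy estimate for supersolution-type logarithms -/
lemma log_energy (hA : Ell b lo hi A) (hlo : 0 ≤ lo) {h φ : E → ℝ} (hh : ContDiff ℝ 2 h) (hφ : ContDiff ℝ 1 φ)
    (hc : HasCompactSupport φ) (hL : ∀ x, QQ b A h h x ≤ LL b A h x) :
    ∫ x, φ x ^ 2 * QQ b A h h x ≤ 4 * ∫ x, QQ b A φ φ x := by
  have hf1 : ContDiff ℝ 1 h := hh.of_le (by norm_num)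
  have hφ2 : ContDiff ℝ 1 (fun x => φ x * φ x) := hφ.mul hφ
  have hc2 : HasCompactSupport (fun x => φ x * φ x) := hc.mul_right
  have hw := weak hA (ψ := fun x => (φ x * φ x)) hφ2 hc2 hh
  have hq : ∀ x, QQ b A (fun x => (φ x * φ x)) h x = 2 * (φ x * 1) * QQ b A φ h x := by
    intro x
    unfold QQ
    simp only [dd_mul hφ hφ, Finset.mul_sum]
    refine Finset.sum_congr rfl fun p _ => Finset.sum_congr rfl fun q _ => ?_
    ring
  have hQφ : HasCompactSupport (QQ b A φ φ) := by
    refine hc.mono' (fun x hx => ?_)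
    by_contra hn
    apply hx
    have : fderiv ℝ φ x = 0 := by
      by_contra h
      exact hn ((support_fderiv_subset ℝ) h)
    simp [QQ, dd, this]
  have i1 : Integrable fun x => φ x ^ 2 * QQ b A h h x :=
    cint ((hφ.continuous.pow 2).mul (QQ_cont hA hf1 hf1)) (by simp only [pow_two]; exact hc2.mul_right)
  have i2 : Integrable fun x => QQ b A φ φ x := cint (QQ_cont hA hφ hφ) hQφ
  have i4 : Integrable fun x => (φ x * φ x) * LL b A h x := 
    cint (hφ2.continuous.mul (LL_cont hA hh)) hc2.mul_right
  have i3 : Integrable fun x => QQ b A (fun x => (φ x * φ x)) h x := by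
    simp only [hq]
    refine cint ((continuous_const.mul (hφ.continuous.mul continuous_const)).mul (QQ_cont hA hφ hf1)) ?_
    exact (HasCompactSupport.mul_left (f := fun _ => (2:ℝ)) (f' := fun x => φ x * 1) hc.mul_right).mul_right
  have h4 : ∫ x, φ x ^ 2 * QQ b A h h x ≤ ∫ x, (φ x * φ x) * LL b A h x := by
    refine integral_mono i1 i4 fun x => ?_
    have := mul_le_mul_of_nonneg_left (hL x) (mul_self_nonneg (φ x))
    simpa [pow_two] using this
  have h3 : - ∫ x, QQ b A (fun x => (φ x * φ x)) h x ≤ ∫ x, 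
      (1/2 * (φ x ^ 2 * QQ b A h h x) + 2 * (QQ b A φ φ x)) := by
    rw [← integral_neg]
    refine integral_mono i3.neg ((i1.const_mul _).add (i2.const_mul _)) fun x => ?_
    have := QQ_young hA hlo h φ x (φ x) 1
    simp only [hq]
    linarith
  rw [integral_add (i1.const_mul _) (i2.const_mul _),
    integral_const_mul, integral_const_mul] at h3
  linarith

/-- cutoff functions -/
lemma exists_cutoff (E : Type*) [NormedAddCommGroup E] [InnerProductSpace ℝ E] [FiniteDimensional ℝ E] :
    ∃ C : ℝ, 0 < C ∧ ∀ r' r : ℝ, 0 < r' → r' < r → ∃ φ : E → ℝ, ContDiff ℝ 1 φ ∧ HasCompactSupport φ ∧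
    (∀ x, 0 ≤ φ x ∧ φ x ≤ 1) ∧ (∀ x, ‖x‖ ≤ r' → φ x = 1) ∧ (∀ x, r ≤ ‖x‖ → φ x = 0) ∧
    (∀ x, r ≤ ‖x‖ → fderiv ℝ φ x = 0) ∧
    ∀ x, ‖fderiv ℝ φ x‖ ≤ C / (r - r') := by
  have hS : ContDiff ℝ 1 Real.smoothTransition := Real.smoothTransition.contDiff
  have hd0 : ∀ t, t ≤ 0 → deriv Real.smoothTransition t = 0 := by
    intro t ht
    apply IsLocalMin.deriv_eq_zero
    refine Filter.Eventually.of_forall fun y => ?_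
    rw [Real.smoothTransition.zero_of_nonpos ht]
    exact Real.smoothTransition.nonneg y
  have hd1 : ∀ t, 1 ≤ t → deriv Real.smoothTransition t = 0 := by
    intro t ht
    apply IsLocalMax.deriv_eq_zero
    refine Filter.Eventually.of_forall fun y => ?_
    rw [Real.smoothTransition.one_of_one_le ht]
    exact Real.smoothTransition.le_one y
  obtain ⟨C0, hC0⟩ := (isCompact_Icc (a := (0:ℝ)) (b := 1)).exists_bound_of_continuousOn
    (hS.continuous_deriv le_rfl).continuousOn
  have hC : ∀ t, |deriv Real.smoothTransition t| ≤ |C0| + 1 := by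
    intro t
    rcases le_or_gt t 0 with h | h
    · rw [hd0 t h]; simp; positivity
    rcases le_or_gt 1 t with h' | h'
    · rw [hd1 t h']; simp; positivity
    · have := hC0 t ⟨h.le, h'.le⟩
      rw [Real.norm_eq_abs] at this
      linarith [le_abs_self C0]
  refine ⟨2 * (|C0| + 1), by positivity, fun r' r hr' hr => ?_⟩
  have hr0 : 0 < r := hr'.trans hr
  have hD : 0 < r^2 - r'^2 := by nlinarith
  set g : E → ℝ := fun x => (r^2 - ‖x‖^2) / (r^2 - r'^2) with hg
  have hgs : ContDiff ℝ 1 g := (contDiff_const.sub (contDiff_norm_sq ℝ)).div_const _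
  have hfd : ∀ x, HasFDerivAt (fun x => Real.smoothTransition (g x)) 
      (deriv Real.smoothTransition (g x) • fderiv ℝ g x) x := fun x =>
    ((hS.differentiable one_ne_zero (g x)).hasDerivAt).comp_hasFDerivAt x (hgs.differentiable one_ne_zero x).hasFDerivAt
  have hg' : ∀ x, ‖fderiv ℝ g x‖ ≤ 2 * ‖x‖ / (r^2 - r'^2) := by
    intro x
    have h1 : HasFDerivAt g ((r^2 - r'^2)⁻¹ • (-((2:ℕ) • (innerSL ℝ x : E →L[ℝ] ℝ))) : E →L[ℝ] ℝ) x := by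
      have h2 := (((hasStrictFDerivAt_norm_sq x).hasFDerivAt.const_sub (r^2)).const_mul (r^2 - r'^2)⁻¹)
      refine h2.congr_of_eventuallyEq (Filter.Eventually.of_forall fun y => ?_)
      simp [hg]; ring
    rw [h1.fderiv, norm_smul, norm_neg, Real.norm_eq_abs, abs_of_pos (inv_pos.2 hD), inv_mul_eq_div]
    gcongr
    refine (norm_nsmul_le).trans ?_
    simp
  have hzero : ∀ x, r ≤ ‖x‖ → g x ≤ 0 := fun x hx => by
    apply div_nonpos_of_nonpos_of_nonneg _ hD.le
    nlinarith
  refine ⟨fun x => Real.smoothTransition (g x), hS.comp hgs, ?_, fun x => ⟨Real.smoothTransition.nonneg _, Real.smoothTransition.le_one _⟩, ?_, ?_, ?_, ?_⟩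
  · refine HasCompactSupport.intro (isCompact_closedBall (0:E) r) fun x hx => ?_
    apply Real.smoothTransition.zero_of_nonpos (hzero x _)
    simp at hx; exact hx.le
  · intro x hx
    apply Real.smoothTransition.one_of_one_le
    rw [hg, le_div_iff₀ hD]
    nlinarith [norm_nonneg x]
  · intro x hx
    exact Real.smoothTransition.zero_of_nonpos (hzero x hx)
  · intro x hx
    rw [(hfd x).fderiv, hd0 _ (hzero x hx), zero_smul]
  · intro x
    rw [(hfd x).fderiv]
    rcases le_or_gt r ‖x‖ with hx | hx
    · rw [hd0 _ (hzero x hx), zero_smul, norm_zero]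
      have : 0 < r - r' := by linarith
      positivity
    rw [norm_smul, Real.norm_eq_abs]
    calc _ ≤ (|C0| + 1) * (2 * ‖x‖ / (r^2 - r'^2)) := mul_le_mul (hC _) (hg' x) (norm_nonneg _) (by positivity)
      _ ≤ (|C0| + 1) * (2 / (r - r')) := by
          refine mul_le_mul_of_nonneg_left ?_ (by positivity)
          rw [div_le_div_iff₀ hD (by linarith)]
          have : 0 < r - r' := by linarith
          nlinarith [mul_pos this hr']
      _ = _ := by ring
end


section
open MeasureTheory
variable {E : Type*} [NormedAddCommGroup E] [InnerProductSpace ℝ E] [FiniteDimensional ℝ E]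
  [MeasurableSpace E] [BorelSpace E]
variable {ι : Type*} [Fintype ι] [DecidableEq ι] {b : OrthonormalBasis ι ℝ E} {A : E → Matrix ι ι ℝ} {lo hi : ℝ}

lemma LL_comp {f : E → ℝ} (hf : ContDiff ℝ 2 f) {Φ Φ1 Φ2 : ℝ → ℝ} (h1 : ∀ x, HasDerivAt Φ (Φ1 (f x)) (f x))
    (h2 : ∀ x, HasDerivAt Φ1 (Φ2 (f x)) (f x)) (x : E) :
    LL b A (fun x => Φ (f x)) x = Φ1 (f x) * LL b A f x + Φ2 (f x) * QQ b A f f x := by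
  have hf1 : ContDiff ℝ 1 f := hf.of_le (by norm_num)
  have e1 : ∀ e, dd e (fun x => Φ (f x)) = fun x => Φ1 (f x) * dd e f x := by
    intro e; funext y
    have := (h1 y).comp_hasFDerivAt y (hf1.differentiable one_ne_zero y).hasFDerivAt
    have h3 : fderiv ℝ (fun x => Φ (f x)) y = _ := this.fderiv
    unfold dd
    rw [h3]; simp
  have e2 : ∀ e e', dd e' (fun x => Φ1 (f x) * dd e f x) x = Φ2 (f x) * dd e' f x * dd e f x + Φ1 (f x) * dd e' (dd e f) x := by
    intro e e'
    have h3 := (h2 x).comp_hasFDerivAt x (hf1.differentiable one_ne_zero x).hasFDerivAt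
    have h4 := h3.mul (((dd_contDiff hf (m := 1) (by norm_num) e).differentiable one_ne_zero x).hasFDerivAt)
    have h5 : fderiv ℝ (fun x => Φ1 (f x) * dd e f x) x = _ := h4.fderiv
    rw [dd, h5]
    simp [dd]
    ring
  unfold LL QQ
  simp only [e1, e2, Finset.mul_sum, ← Finset.sum_add_distrib]
  refine Finset.sum_congr rfl fun p _ => Finset.sum_congr rfl fun q _ => ?_
  ring

lemma QQ_comp {f : E → ℝ} (hf : ContDiff ℝ 2 f) {Φ Φ1 : ℝ → ℝ} (h1 : ∀ x, HasDerivAt Φ (Φ1 (f x)) (f x)) (x : E) :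
    QQ b A (fun x => Φ (f x)) (fun x => Φ (f x)) x = Φ1 (f x) ^2 * QQ b A f f x := by
  have hf1 : ContDiff ℝ 1 f := hf.of_le (by norm_num)
  have e1 : ∀ e, dd e (fun x => Φ (f x)) = fun x => Φ1 (f x) * dd e f x := by
    intro e; funext y
    have := (h1 y).comp_hasFDerivAt y (hf1.differentiable one_ne_zero y).hasFDerivAt
    have h3 : fderiv ℝ (fun x => Φ (f x)) y = _ := this.fderiv
    unfold dd
    rw [h3]; simp
  unfold QQ
  simp only [e1, Finset.mul_sum]
  refine Finset.sum_congr rfl fun p _ => Finset.sum_congr rfl fun q _ => ?_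
  ring

lemma QQ_nonneg (hA : Ell b lo hi A) (hlo : 0 ≤ lo) (f : E → ℝ) (x : E) : 0 ≤ QQ b A f f x :=
  le_trans (by positivity) (QQ_lower hA f x)

lemma indicator_int {f : E → ℝ} (hf : Continuous f) (r : ℝ) : IntegrableOn f (Metric.closedBall (0:E) r) :=
  hf.continuousOn.integrableOn_compact (isCompact_closedBall _ _)

/-- gradient of the test function -/
lemma grad_test (hA : Ell b lo hi A) (hlo : 0 < lo) (hhi : 0 < hi) {f φ : E → ℝ} {r D : ℝ} (hf : ContDiff ℝ 2 f)
    (hφ : ContDiff ℝ 1 φ)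
    (hc : HasCompactSupport φ) (hpos : ∀ x, 0 ≤ f x) (hL : ∀ x, 0 ≤ LL b A f x)
    (h01 : ∀ x, 0 ≤ φ x ∧ φ x ≤ 1) (hz : ∀ x, r ≤ ‖x‖ → φ x = 0) (hz' : ∀ x, r ≤ ‖x‖ → fderiv ℝ φ x = 0)
    (hD : 1 ≤ D) (hφD : ∀ x, ‖fderiv ℝ φ x‖ ≤ D) :
    ∫ x, ‖fderiv ℝ (fun x => (φ x * f x)^2) x‖ ≤ (3 + 4 * hi / lo) * D^2 * ∫ x in Metric.closedBall (0:E) r, f x ^2 := by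
  have hf1 : ContDiff ℝ 1 f := hf.of_le (by norm_num)
  have hφf : ContDiff ℝ 1 (fun x => φ x * f x) := hφ.mul hf1
  have hcd : HasCompactSupport (fun x => ‖fderiv ℝ φ x‖^2) := by
    have := (hc.fderiv ℝ).norm
    simp only [pow_two]; exact this.mul_right
  have i1 : Integrable fun x => (φ x * f x)^2 :=
    cint (hφf.continuous.pow 2) (by
      have : HasCompactSupport (fun x => φ x * f x) := hc.mul_right
      simp only [pow_two]; exact this.mul_right)
  have i2 : Integrable fun x => f x ^2 * ‖fderiv ℝ φ x‖^2 :=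
    cint ((hf.continuous.pow 2).mul ((hφ.continuous_fderiv one_ne_zero).norm.pow 2)) hcd.mul_left
  have i3 : Integrable fun x => φ x ^2 * ‖fderiv ℝ f x‖^2 :=
    cint ((hφ.continuous.pow 2).mul ((hf1.continuous_fderiv one_ne_zero).norm.pow 2)) (by
      have : HasCompactSupport (fun x => φ x * φ x) := hc.mul_right
      simp only [pow_two (φ _)]; exact this.mul_right)
  have i4 : Integrable fun x => φ x ^ 2 * QQ b A f f x :=
    cint ((hφ.continuous.pow 2).mul (QQ_cont hA hf1 hf1)) (by
      have : HasCompactSupport (fun x => φ x * φ x) := hc.mul_right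
      simp only [pow_two (φ _)]; exact this.mul_right)
  have i5 : Integrable fun x => f x ^ 2 * QQ b A φ φ x := by
    refine Integrable.mono' (i2.const_mul hi) ((hf.continuous.pow 2).mul (QQ_cont hA hφ hφ)).aestronglyMeasurable
      (Filter.Eventually.of_forall fun x => ?_)
    rw [Real.norm_eq_abs, abs_of_nonneg (mul_nonneg (sq_nonneg _) (QQ_nonneg hA hlo.le φ x))]
    have := mul_le_mul_of_nonneg_left (QQ_upper hA φ x) (sq_nonneg (f x))
    linarith
  have hg : ∀ x, ‖fderiv ℝ (fun x => (φ x * f x)^2) x‖ ≤ 2 * (φ x * f x)^2 + f x ^2 * ‖fderiv ℝ φ x‖^2 + φ x ^2 * ‖fderiv ℝ f x‖^2 := by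
    intro x
    have h1 := ((hφ.differentiable one_ne_zero x).hasFDerivAt.mul (hf1.differentiable one_ne_zero x).hasFDerivAt).pow 2
    have h2 : fderiv ℝ (fun x => (φ x * f x)^2) x = _ := h1.fderiv
    rw [h2]
    have h3 : ‖φ x • fderiv ℝ f x + f x • fderiv ℝ φ x‖ ≤ φ x * ‖fderiv ℝ f x‖ + f x * ‖fderiv ℝ φ x‖ := by
      refine (norm_add_le _ _).trans ?_
      rw [norm_smul, norm_smul, Real.norm_of_nonneg (h01 x).1, Real.norm_of_nonneg (hpos x)]
    rw [norm_smul]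
    have h4 : ‖(2:ℕ) • (φ * f) x ^ (2-1)‖ = 2 * (φ x * f x) := by
      simp [abs_of_nonneg (hpos x), abs_of_nonneg (h01 x).1]
    have hp : 0 ≤ φ x * f x := mul_nonneg (h01 x).1 (hpos x)
    calc _ ≤ 2 * (φ x * f x) * (φ x * ‖fderiv ℝ f x‖ + f x * ‖fderiv ℝ φ x‖) := by
          refine mul_le_mul ?_ h3 (norm_nonneg _) (by positivity)
          exact h4.le
      _ ≤ _ := by nlinarith [sq_nonneg (φ x * f x - f x * ‖fderiv ℝ φ x‖), sq_nonneg (φ x * f x - φ x * ‖fderiv ℝ f x‖)]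
  have hI : ∀ g : E → ℝ, Integrable g → (∀ x, r ≤ ‖x‖ → g x = 0) → ∀ c, (∀ x, g x ≤ c * f x ^2) → 
      ∫ x, g x ≤ c * ∫ x in Metric.closedBall (0:E) r, f x ^2 := by
    intro g hgi hg0 c hgc
    rw [← setIntegral_eq_integral_of_forall_compl_eq_zero (s := Metric.closedBall (0:E) r), ← integral_const_mul]
    · refine setIntegral_mono hgi.integrableOn (indicator_int ((hf.continuous.pow 2).const_mul c) r) hgc
    · intro x hx
      apply hg0
      simp at hx; exact hx.le
  have b1 : ∫ x, (φ x * f x)^2 ≤ 1 * ∫ x in Metric.closedBall (0:E) r, f x ^2 := by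
    apply hI _ i1
    · intro x hx; simp [hz x hx]
    · intro x; rw [mul_pow]
      exact mul_le_mul_of_nonneg_right (pow_le_one₀ (h01 x).1 (h01 x).2) (sq_nonneg _)
  have b2 : ∫ x, f x ^2 * ‖fderiv ℝ φ x‖^2 ≤ D^2 * ∫ x in Metric.closedBall (0:E) r, f x ^2 := by
    apply hI _ i2
    · intro x hx; simp [hz' x hx]
    · intro x; rw [mul_comm]
      gcongr
      exact hφD x
  have b3 : lo * ∫ x, φ x ^2 * ‖fderiv ℝ f x‖^2 ≤ 4 * hi * ∫ x, f x ^2 * ‖fderiv ℝ φ x‖^2 := by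
    calc lo * ∫ x, φ x ^2 * ‖fderiv ℝ f x‖^2 = ∫ x, lo * (φ x ^2 * ‖fderiv ℝ f x‖^2) := (integral_const_mul _ _).symm
      _ ≤ ∫ x, φ x ^2 * QQ b A f f x := by
          refine integral_mono (i3.const_mul lo) i4 fun x => ?_
          have := mul_le_mul_of_nonneg_left (QQ_lower hA f x) (sq_nonneg (φ x))
          simp only; linarith
      _ ≤ 4 * ∫ x, f x ^ 2 * QQ b A φ φ x := caccioppoli hA hlo.le hf hφ hc hpos hL
      _ ≤ 4 * ∫ x, hi * (f x ^2 * ‖fderiv ℝ φ x‖^2) := by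
          gcongr ?_ * ?_
          refine integral_mono i5 (i2.const_mul hi) fun x => ?_
          have := mul_le_mul_of_nonneg_left (QQ_upper hA φ x) (sq_nonneg (f x))
          simp only; linarith
      _ = _ := by rw [integral_const_mul]; ring
  have b3' : ∫ x, φ x ^2 * ‖fderiv ℝ f x‖^2 ≤ 4 * hi / lo * ∫ x, f x ^2 * ‖fderiv ℝ φ x‖^2 := by
    rw [div_mul_eq_mul_div, le_div_iff₀ hlo]; linarith
  have i6 : Integrable fun x => 2 * (φ x * f x)^2 + f x ^2 * ‖fderiv ℝ φ x‖^2 := (i1.const_mul 2).add i2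
  have hs : ContDiff ℝ 1 (fun x => (φ x * f x)^2) := hφf.pow 2
  have h5 : ∫ x, ‖fderiv ℝ (fun x => (φ x * f x)^2) x‖ ≤ 2 * (∫ x, (φ x * f x)^2) + (∫ x, f x ^2 * ‖fderiv ℝ φ x‖^2) + ∫ x, φ x ^2 * ‖fderiv ℝ f x‖^2 := by
    rw [← integral_const_mul, ← integral_add (i1.const_mul 2) i2, ← integral_add i6 i3]
    refine integral_mono_of_nonneg (Filter.Eventually.of_forall fun x => norm_nonneg _) (i6.add i3) (Filter.Eventually.of_forall hg)
  set S := ∫ x in Metric.closedBall (0:E) r, f x ^2 with hS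
  have hS0 : 0 ≤ S := integral_nonneg fun x => sq_nonneg _
  have hD2 : 1 ≤ D^2 := one_le_pow₀ hD
  have hq : 0 ≤ 4 * hi / lo := by positivity
  have : 4 * hi / lo * ∫ x, f x ^2 * ‖fderiv ℝ φ x‖^2 ≤ 4 * hi / lo * (D^2 * S) := by gcongr
  nlinarith
end


section
open MeasureTheory
variable {E : Type*} [NormedAddCommGroup E] [InnerProductSpace ℝ E] [FiniteDimensional ℝ E]
  [MeasurableSpace E] [BorelSpace E]
variable {ι : Type*} [Fintype ι] [DecidableEq ι] {b : OrthonormalBasis ι ℝ E} {lo hi : ℝ}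

lemma sobolev_real {p : ℝ} (hp : Real.HolderConjugate (Module.finrank ℝ E) p) :
    ∃ C : ℝ, 1 ≤ C ∧ ∀ u : E → ℝ, ContDiff ℝ 1 u → HasCompactSupport u → (∀ x, 0 ≤ u x) →
      ∫ x, (u x)^p ≤ (C * ∫ x, ‖fderiv ℝ u x‖)^p := by
  have hp0 : 0 < p := hp.symm.pos
  have hp1 : 1 ≤ p := hp.symm.lt.le
  set cS := lintegralPowLePowLIntegralFDerivConst (volume : Measure E) p with hcS
  refine ⟨cS + 1, by simp, fun u hu hc hpos => ?_⟩
  have h := lintegral_pow_le_pow_lintegral_fderiv (volume : Measure E) hu hc hp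
  have i1 : Integrable (fun x => u x ^ p) := by
    apply cint (hu.continuous.rpow_const fun x => Or.inr hp0.le)
    exact hc.comp_left (g := fun t : ℝ => t ^ p) (Real.zero_rpow hp0.ne')
  have i2 : Integrable (fderiv ℝ u) :=
    (hu.continuous_fderiv one_ne_zero).integrable_of_hasCompactSupport (hc.fderiv ℝ)
  have e1 : ∫⁻ x, ‖u x‖ₑ ^ p = ENNReal.ofReal (∫ x, (u x)^p) := by
    rw [ofReal_integral_eq_lintegral_ofReal i1 (Filter.Eventually.of_forall fun x => Real.rpow_nonneg (hpos x) p)]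
    refine lintegral_congr fun x => ?_
    rw [Real.enorm_of_nonneg (hpos x), ENNReal.ofReal_rpow_of_nonneg (hpos x) hp0.le]
  have hn : 0 ≤ ∫ x, ‖fderiv ℝ u x‖ := integral_nonneg fun x => norm_nonneg _
  rw [e1, ← ofReal_integral_norm_eq_lintegral_enorm i2, ENNReal.ofReal_rpow_of_nonneg hn hp0.le,
    ← ENNReal.ofReal_coe_nnreal, ← ENNReal.ofReal_mul (by positivity),
    ENNReal.ofReal_le_ofReal_iff (by positivity)] at h
  refine h.trans ?_
  rw [Real.mul_rpow (by positivity) hn]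
  gcongr
  calc (cS:ℝ) ≤ cS + 1 := by linarith
    _ = (cS+1:ℝ)^(1:ℝ) := (Real.rpow_one _).symm
    _ ≤ (cS+1:ℝ)^p := Real.rpow_le_rpow_of_exponent_le (by simp) hp1

lemma one_step {p : ℝ} (hp : Real.HolderConjugate (Module.finrank ℝ E) p) (hlo : 0 < lo) (hhi : 0 < hi)
    (b : OrthonormalBasis ι ℝ E) :
    ∃ C : ℝ, 1 ≤ C ∧ ∀ A, Ell b lo hi A → ∀ f : E → ℝ, ContDiff ℝ 2 f → (∀ x, 0 ≤ f x) → (∀ x, 0 ≤ LL b A f x) →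
      ∀ r' r : ℝ, 0 < r' → r' < r → r ≤ 1 →
      ∫ x in Metric.closedBall (0:E) r', (f x ^2)^p ≤ (C / (r - r')^2 * ∫ x in Metric.closedBall (0:E) r, f x ^2)^p := by
  obtain ⟨C0, hC0, hcut⟩ := exists_cutoff E
  obtain ⟨CS, hCS, hS⟩ := sobolev_real (E := E) hp
  have hp0 : 0 < p := hp.symm.pos
  refine ⟨CS * ((3 + 4 * hi / lo) * (C0+1)^2), ?_, ?_⟩
  · have h1 : (1:ℝ) ≤ (C0+1)^2 := one_le_pow₀ (by linarith)
    have h2 : (1:ℝ) ≤ 3 + 4 * hi/lo := by have : 0 < 4 * hi / lo := by positivity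
                                          linarith
    exact one_le_mul_of_one_le_of_one_le hCS (one_le_mul_of_one_le_of_one_le h2 h1)
  intro A hA f hf hpos hL r' r hr' hr hr1
  obtain ⟨φ, hφ, hc, h01, hone, hz, hz', hD⟩ := hcut r' r hr' hr
  have hrr : 0 < r - r' := by linarith
  have hD1 : 1 ≤ (C0+1)/(r-r') := by rw [le_div_iff₀ hrr]; linarith
  have h1 := grad_test hA hlo hhi hf hφ hc hpos hL h01 hz hz' hD1 (fun x => (hD x).trans (by gcongr; linarith))
  have hus : ContDiff ℝ 1 (fun x => (φ x * f x)^2) := (hφ.mul (hf.of_le (by norm_num))).pow 2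
  have huc : HasCompactSupport (fun x => (φ x * f x)^2) := by
    have : HasCompactSupport (fun x => φ x * f x) := hc.mul_right
    simp only [pow_two]; exact this.mul_right
  have h2 := hS _ hus huc (fun x => sq_nonneg _)
  have i1 : Integrable (fun x => ((φ x * f x)^2) ^ p) := by
    apply cint (hus.continuous.rpow_const fun x => Or.inr hp0.le)
    exact huc.comp_left (g := fun t : ℝ => t ^ p) (Real.zero_rpow hp0.ne')
  calc ∫ x in Metric.closedBall (0:E) r', (f x ^2)^p = ∫ x in Metric.closedBall (0:E) r', ((φ x * f x) ^2)^p := by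
        refine setIntegral_congr_fun Metric.isClosed_closedBall.measurableSet fun x hx => ?_
        simp only [Metric.mem_closedBall, dist_zero_right] at hx
        simp [hone x hx]
    _ ≤ ∫ x, ((φ x * f x) ^2)^p := setIntegral_le_integral i1 
        (Filter.Eventually.of_forall fun x => Real.rpow_nonneg (sq_nonneg _) p)
    _ ≤ _ := h2
    _ ≤ _ := by
      have : 0 ≤ ∫ x, ‖fderiv ℝ (fun x => (φ x * f x)^2) x‖ := integral_nonneg fun x => norm_nonneg _
      refine Real.rpow_le_rpow (by positivity) ?_ hp0.le
      calc _ ≤ CS * _ := mul_le_mul_of_nonneg_left h1 (by linarith)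
        _ = _ := by rw [div_pow]; ring

/-- Moser iteration -/
lemma moser {p : ℝ} (hp : Real.HolderConjugate (Module.finrank ℝ E) p) (hlo : 0 < lo) (hhi : 0 < hi)
    (b : OrthonormalBasis ι ℝ E) :
    ∃ ε : ℝ, 0 < ε ∧ ∀ A, Ell b lo hi A → ∀ f : E → ℝ, ContDiff ℝ 2 f → (∀ x, 0 < f x) → (∀ x, 0 ≤ LL b A f x) →
      ∫ x in Metric.closedBall (0:E) 1, f x ^2 ≤ ε → f 0 ≤ 1 := by
  obtain ⟨C, hC, hstep⟩ := one_step hp hlo hhi b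
  have hp0 : 0 < p := hp.symm.pos
  have hp1 : 1 < p := hp.symm.lt
  have hp1' : 0 < p - 1 := by linarith
  -- θ with (4θ)^p ≤ θ
  set θ : ℝ := (4:ℝ)^(-(p/(p-1))) with hθ
  have hθ0 : 0 < θ := by positivity
  have hθ1 : θ < 1 := Real.rpow_lt_one_of_one_lt_of_neg (by norm_num) (by
    have : 0 < p/(p-1) := by positivity
    linarith)
  have hθp : (4*θ)^p = θ := by
    rw [hθ, ← Real.rpow_one_add' (by norm_num) (by
      have : 1 < p/(p-1) := by rw [lt_div_iff₀ hp1']; linarith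
      linarith), ← Real.rpow_mul (by norm_num)]
    congr 1
    field_simp
    ring
  -- ε with (16 C ε)^p ≤ θ ε
  set ε : ℝ := (θ / (16*C)^p)^(1/(p-1)) with hε
  have hC0 : 0 < C := by linarith
  have hε0 : 0 < ε := by positivity
  have hεp : (16*C*ε)^p = θ * ε := by
    rw [Real.mul_rpow (by positivity) hε0.le]
    have : ε^p = ε^(p-1) * ε := by
      rw [← Real.rpow_add_one hε0.ne']; congr 1; ring
    rw [this, hε, ← Real.rpow_mul (by positivity), one_div_mul_cancel hp1'.ne', Real.rpow_one, ← hε]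
    field_simp
  refine ⟨ε, hε0, fun A hA f hf hpos hL hIg => ?_⟩
  by_contra hcon
  push Not at hcon
  set F : ℕ → E → ℝ := fun m x => f x ^ (p^m) with hF
  have hF0 : ∀ m x, 0 < F m x := fun m x => Real.rpow_pos_of_pos (hpos x) _
  have hFs : ∀ m, ContDiff ℝ 2 (F m) := fun m => hf.rpow_const_of_ne fun x => (hpos x).ne'
  have hFL : ∀ m x, 0 ≤ LL b A (F m) x := by
    intro m x
    have hq : 1 ≤ p^m := one_le_pow₀ hp1.le
    have := LL_comp (b := b) (A := A) hf (Φ := fun t => t^(p^m)) (Φ1 := fun t => p^m * t^(p^m-1))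
      (Φ2 := fun t => p^m * ((p^m-1) * t^(p^m-1-1)))
      (fun x => Real.hasDerivAt_rpow_const (Or.inl (hpos x).ne'))
      (fun x => (Real.hasDerivAt_rpow_const (Or.inl (hpos x).ne')).const_mul _) x
    rw [hF]
    simp only at this ⊢
    rw [this]
    have a1 : 0 < f x ^ (p^m-1) := Real.rpow_pos_of_pos (hpos x) _
    have a2 : 0 < f x ^ (p^m-1-1) := Real.rpow_pos_of_pos (hpos x) _
    have a3 := QQ_nonneg hA hlo.le f x
    have a4 : 0 ≤ p^m - 1 := by linarith
    have := hL x
    positivity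
  set ρ : ℕ → ℝ := fun m => 1/2 + (1/2)*(1/2)^m with hρ
  have key : ∀ m, ∫ x in Metric.closedBall (0:E) (ρ m), F m x ^2 ≤ ε * θ^m := by
    intro m
    induction m with
    | zero => 
      simp only [hρ, hF, pow_zero, Real.rpow_one, mul_one]
      norm_num
      exact hIg
    | succ m ih =>
      have hm : 0 < (1/2:ℝ)^m := by positivity
      have hm1 : (1/2:ℝ)^m ≤ 1 := pow_le_one₀ (by norm_num) (by norm_num)
      have hd : ρ m - ρ (m+1) = (1/4) * (1/2)^m := by simp only [hρ, pow_succ]; ring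
      have h1 := hstep A hA (F m) (hFs m) (fun x => (hF0 m x).le) (hFL m) (ρ (m+1)) (ρ m)
        (by simp only [hρ]; positivity) (by nlinarith) (by simp only [hρ]; linarith)
      have e1 : ∀ x, F (m+1) x ^2 = (F m x ^2)^p := by
        intro x
        simp only [hF]
        have a1 : f x ^ (p^(m+1)) = (f x ^ (p^m))^p := by rw [← Real.rpow_mul (hpos x).le, pow_succ]
        have a2 : 0 ≤ f x ^ (p^m) := Real.rpow_nonneg (hpos x).le _
        rw [a1, pow_two, pow_two, Real.mul_rpow a2 a2]
      simp only [e1]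
      refine h1.trans ?_
      have hn : 0 ≤ ∫ x in Metric.closedBall (0:E) (ρ m), F m x ^2 := integral_nonneg fun x => sq_nonneg _
      calc _ ≤ (C / (ρ m - ρ (m+1))^2 * (ε * θ^m))^p := by
            refine Real.rpow_le_rpow (by positivity) ?_ hp0.le
            gcongr
        _ = ((16*C*ε) * (4*θ)^m)^p := by
            congr 1
            rw [hd, mul_pow, mul_pow, ← pow_mul, mul_comm m 2, pow_mul]
            have : ((1/2:ℝ)^2)^m * 4^m = 1 := by rw [← mul_pow]; norm_num
            rw [div_mul_eq_mul_div, div_eq_iff (by positivity)]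
            linear_combination (-C * ε * θ^m) * this
        _ = (16*C*ε)^p * ((4*θ)^p)^m := by
            rw [Real.mul_rpow (by positivity) (by positivity)]
            congr 1
            rw [← Real.rpow_natCast, ← Real.rpow_natCast, ← Real.rpow_mul (by positivity), ← Real.rpow_mul (by positivity), mul_comm (m:ℝ) p]
        _ = ε * θ^(m+1) := by rw [hεp, hθp]; ring
  -- contradiction
  have hnb : ∀ᶠ x in nhds (0:E), 1 < f x := hf.continuous.continuousAt.eventually (lt_mem_nhds hcon)
  obtain ⟨d, hd0, hd⟩ := Metric.eventually_nhds_iff_ball.1 hnb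
  set s := min (d/2) (1/2) with hs
  have hs0 : 0 < s := by positivity
  have hlow : ∀ m, volume.real (Metric.closedBall (0:E) s) ≤ ε * θ^m := by
    intro m
    refine le_trans ?_ (key m)
    have hsub : Metric.closedBall (0:E) s ⊆ Metric.closedBall (0:E) (ρ m) :=
      Metric.closedBall_subset_closedBall ((min_le_right _ _).trans (by simp only [hρ]; have : 0 < (1/2:ℝ)^m := by positivity
                                                                        linarith))
    have hcF : Continuous fun x => F m x ^2 := (hFs m).continuous.pow 2
    calc volume.real (Metric.closedBall (0:E) s) = ∫ x in Metric.closedBall (0:E) s, (1:ℝ) := by simp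
      _ ≤ ∫ x in Metric.closedBall (0:E) s, F m x ^2 := by
          refine setIntegral_mono_on (indicator_int continuous_const s) (indicator_int hcF s) Metric.isClosed_closedBall.measurableSet ?_
          intro x hx
          have h1 : 1 < f x := hd x (Metric.closedBall_subset_ball (by
            have := min_le_left (d/2) (1/2:ℝ)
            linarith) hx)
          have : 1 ≤ F m x := Real.one_le_rpow h1.le (by positivity)
          exact one_le_pow₀ this
      _ ≤ _ := setIntegral_mono_set (indicator_int hcF _) (Filter.Eventually.of_forall fun x => sq_nonneg _)
          (Filter.Eventually.of_forall hsub)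
  have hpos' : 0 < volume.real (Metric.closedBall (0:E) s) := by
    rw [Measure.real, ENNReal.toReal_pos_iff]
    exact ⟨Metric.measure_closedBall_pos _ _ hs0, measure_closedBall_lt_top⟩
  have hlim : Filter.Tendsto (fun m : ℕ => ε * θ^m) Filter.atTop (nhds (ε * 0)) :=
    (tendsto_pow_atTop_nhds_zero_of_lt_one hθ0.le hθ1).const_mul ε
  have := ge_of_tendsto' hlim hlow
  linarith
end


section
open MeasureTheory
variable {E : Type*} [NormedAddCommGroup E] [InnerProductSpace ℝ E] [FiniteDimensional ℝ E]
  [MeasurableSpace E] [BorelSpace E]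

lemma line_sq {h : E → ℝ} (hh : ContDiff ℝ 1 h) (x y : E) :
    (h x - h y)^2 ≤ ‖x - y‖^2 * ∫ t in Set.Icc (0:ℝ) 1, ‖fderiv ℝ h (t • x + (1-t) • y)‖^2 := by
  set γ : ℝ → E := fun t => t • x + (1-t) • y with hγ
  have hγc : Continuous γ := by fun_prop
  have hγd : ∀ t, HasDerivAt γ (x - y) t := by
    intro t
    have h1 := ((hasDerivAt_id t).smul_const x).add (((hasDerivAt_const t (1:ℝ)).sub (hasDerivAt_id t)).smul_const y)
    refine h1.congr_deriv ?_
    simp [sub_eq_add_neg]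
  have hfc : Continuous fun t => fderiv ℝ h (γ t) := (hh.continuous_fderiv one_ne_zero).comp hγc
  have hgc : Continuous fun t => fderiv ℝ h (γ t) (x - y) := hfc.clm_apply continuous_const
  have e1 : ∫ t in (0:ℝ)..1, fderiv ℝ h (γ t) (x - y) = h x - h y := by
    have := intervalIntegral.integral_eq_sub_of_hasDerivAt (a := 0) (b := 1) (f := fun t => h (γ t))
      (f' := fun t => fderiv ℝ h (γ t) (x - y))
      (fun t _ => ((hh.differentiable one_ne_zero (γ t)).hasFDerivAt.comp_hasDerivAt t (hγd t)))
      (hgc.intervalIntegrable _ _)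
    rw [this]; simp [hγ]
  set c := h x - h y with hc
  have e2 : 0 ≤ ∫ t in (0:ℝ)..1, (fderiv ℝ h (γ t) (x - y) - c)^2 :=
    intervalIntegral.integral_nonneg (by norm_num) fun t _ => sq_nonneg _
  have e3 : ∫ t in (0:ℝ)..1, (fderiv ℝ h (γ t) (x - y) - c)^2
      = (∫ t in (0:ℝ)..1, (fderiv ℝ h (γ t) (x - y))^2) - c^2 := by
    have : ∀ t, (fderiv ℝ h (γ t) (x - y) - c)^2 = ((fderiv ℝ h (γ t) (x - y))^2 - (2*c) * fderiv ℝ h (γ t) (x - y)) + c^2 := by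
      intro t; ring
    simp only [this]
    rw [intervalIntegral.integral_add, intervalIntegral.integral_sub, intervalIntegral.integral_const_mul, e1]
    · simp; ring
    · exact (hgc.pow 2).intervalIntegrable _ _
    · exact (hgc.const_mul (2*c)).intervalIntegrable _ _
    · exact ((hgc.pow 2).sub (hgc.const_mul (2*c))).intervalIntegrable _ _
    · exact continuous_const.intervalIntegrable _ _
  have e4 : ∫ t in (0:ℝ)..1, (fderiv ℝ h (γ t) (x - y))^2 ≤ ∫ t in (0:ℝ)..1, ‖x - y‖^2 * ‖fderiv ℝ h (γ t)‖^2 := by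
    refine intervalIntegral.integral_mono_on (by norm_num) ((hgc.pow 2).intervalIntegrable _ _)
      ((continuous_const.mul (hfc.norm.pow 2)).intervalIntegrable _ _) fun t _ => ?_
    rw [← mul_pow, mul_comm]
    rw [← sq_abs]
    exact pow_le_pow_left₀ (abs_nonneg _) ((fderiv ℝ h (γ t)).le_opNorm (x-y)) 2
  rw [intervalIntegral.integral_const_mul, intervalIntegral.integral_of_le (by norm_num : (0:ℝ) ≤ 1),
    intervalIntegral.integral_of_le (by norm_num : (0:ℝ) ≤ 1), ← integral_Icc_eq_integral_Ioc, ← integral_Icc_eq_integral_Ioc] at e4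
  rw [e3, intervalIntegral.integral_of_le (by norm_num : (0:ℝ) ≤ 1), ← integral_Icc_eq_integral_Ioc] at e2
  linarith

lemma lint_scale {g : E → ENNReal} (hg : Measurable g) {s : ℝ} (hs : 1/2 ≤ s) (z : E) :
    ∫⁻ x, g (s • x + z) ≤ 2^(Module.finrank ℝ E) * ∫⁻ x, g x := by
  have hs0 : 0 < s := by linarith
  have h1 : ∫⁻ x, g (s • x + z) = ∫⁻ x, g (x + z) ∂(Measure.map (fun x : E => s • x) volume) := by
    have hg' : Measurable fun x => g (x + z) := hg.comp (measurable_id.add_const z)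
    rw [lintegral_map hg' (measurable_const_smul s)]
  rw [h1, Measure.map_addHaar_smul volume hs0.ne', lintegral_smul_measure, lintegral_add_right_eq_self g z, smul_eq_mul]
  gcongr
  calc ENNReal.ofReal |(s ^ Module.finrank ℝ E)⁻¹| ≤ ENNReal.ofReal ((2:ℝ)^(Module.finrank ℝ E)) := by
        apply ENNReal.ofReal_le_ofReal
        rw [abs_of_nonneg (by positivity), ← inv_pow]
        gcongr
        rw [inv_le_comm₀ hs0 (by norm_num)]; linarith
    _ = _ := by rw [ENNReal.ofReal_pow (by norm_num)]; norm_num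

lemma lint_scale_ball {g : E → ENNReal} (hg : Measurable g) {s : ℝ} (hs : 1/2 ≤ s) (hs1 : s ≤ 1) {y : E}
    (hy : y ∈ Metric.closedBall (0:E) 1) :
    ∫⁻ x in Metric.closedBall (0:E) 1, g (s • x + (1-s) • y) ≤
      2^(Module.finrank ℝ E) * ∫⁻ x in Metric.closedBall (0:E) 1, g x := by
  have hm : MeasurableSet (Metric.closedBall (0:E) 1) := Metric.isClosed_closedBall.measurableSet
  rw [← lintegral_indicator hm, ← lintegral_indicator hm]
  refine le_trans ?_ (lint_scale (hg.indicator hm) hs ((1-s) • y))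
  refine lintegral_mono fun x => ?_
  by_cases hx : x ∈ Metric.closedBall (0:E) 1
  · have : s • x + (1-s) • y ∈ Metric.closedBall (0:E) 1 :=
      convex_closedBall (0:E) 1 hx hy (by linarith) (by linarith) (by ring)
    rw [Set.indicator_of_mem hx, Set.indicator_of_mem this]
  · rw [Set.indicator_of_notMem hx]; exact zero_le

set_option maxHeartbeats 1000000 in
lemma poincare {h : E → ℝ} (hh : ContDiff ℝ 1 h) :
    ∫⁻ x in Metric.closedBall (0:E) 1, ∫⁻ y in Metric.closedBall (0:E) 1, ENNReal.ofReal ((h x - h y)^2) ≤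
     4 * (2^(Module.finrank ℝ E) * (∫⁻ x in Metric.closedBall (0:E) 1, ENNReal.ofReal (‖fderiv ℝ h x‖^2)) *
      volume (Metric.closedBall (0:E) 1)) := by
  set B := Metric.closedBall (0:E) 1 with hB
  have hm : MeasurableSet B := Metric.isClosed_closedBall.measurableSet
  set g : E → ENNReal := fun x => ENNReal.ofReal (‖fderiv ℝ h x‖^2) with hg
  have hgm : Measurable g := ((hh.continuous_fderiv one_ne_zero).norm.pow 2).measurable.ennreal_ofReal
  set I := ∫⁻ x in B, g x with hI
  have hpt : ∀ x ∈ B, ∀ y ∈ B, ENNReal.ofReal ((h x - h y)^2) ≤ 4 * ∫⁻ t in Set.Icc (0:ℝ) 1, g (t • x + (1-t) • y) := by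
    intro x hx y hy
    have hc : Continuous fun t : ℝ => ‖fderiv ℝ h (t • x + (1-t) • y)‖^2 :=
      ((hh.continuous_fderiv one_ne_zero).comp (by fun_prop)).norm.pow 2
    rw [← ofReal_integral_eq_lintegral_ofReal (hc.continuousOn.integrableOn_compact isCompact_Icc)
      (Filter.Eventually.of_forall fun t => sq_nonneg _)]
    have : (4:ENNReal) = ENNReal.ofReal 4 := by norm_num
    rw [this, ← ENNReal.ofReal_mul (by norm_num)]
    apply ENNReal.ofReal_le_ofReal
    refine (line_sq hh x y).trans ?_
    have h2 : ‖x - y‖^2 ≤ 4 := by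
      simp only [hB, Metric.mem_closedBall, dist_zero_right] at hx hy
      have := norm_sub_le x y
      nlinarith [norm_nonneg (x - y)]
    exact mul_le_mul_of_nonneg_right h2 (integral_nonneg fun t => sq_nonneg _)
  have hjm : Measurable fun q : (E × E) × ℝ => g (q.2 • q.1.1 + (1-q.2) • q.1.2) :=
    hgm.comp (by fun_prop)
  calc _ ≤ ∫⁻ x in B, ∫⁻ y in B, 4 * ∫⁻ t in Set.Icc (0:ℝ) 1, g (t • x + (1-t) • y) := by
        refine setLIntegral_mono' hm fun x hx => setLIntegral_mono' hm fun y hy => hpt x hx y hy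
    _ = 4 * ∫⁻ x in B, ∫⁻ y in B, ∫⁻ t in Set.Icc (0:ℝ) 1, g (t • x + (1-t) • y) := by
        simp_rw [lintegral_const_mul' _ _ (by norm_num : (4:ENNReal) ≠ ⊤)]
    _ = 4 * ∫⁻ x in B, ∫⁻ t in Set.Icc (0:ℝ) 1, ∫⁻ y in B, g (t • x + (1-t) • y) := by
        congr 1
        refine lintegral_congr fun x => ?_
        rw [lintegral_lintegral_swap]
        exact (hjm.comp (by fun_prop : Measurable fun p : E × ℝ => ((x, p.1), p.2))).aemeasurable
    _ = 4 * ∫⁻ t in Set.Icc (0:ℝ) 1, ∫⁻ x in B, ∫⁻ y in B, g (t • x + (1-t) • y) := by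
        congr 1
        rw [lintegral_lintegral_swap]
        have m1 : Measurable fun q : (E × ℝ) × E => g (q.1.2 • q.1.1 + (1-q.1.2) • q.2) := hgm.comp (by fun_prop)
        have m2 := m1.lintegral_prod_right' (ν := volume.restrict B)
        exact m2.aemeasurable
    _ ≤ 4 * ∫⁻ t in Set.Icc (0:ℝ) 1, 2^(Module.finrank ℝ E) * I * volume B := by
        refine mul_le_mul_right ?_ _
        refine setLIntegral_mono' measurableSet_Icc fun t ht => ?_
        rcases le_total (1/2) t with h1 | h1
        · rw [lintegral_lintegral_swap]
          · calc _ ≤ ∫⁻ y in B, 2^(Module.finrank ℝ E) * I :=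
                  setLIntegral_mono' hm fun y hy => lint_scale_ball hgm h1 ht.2 hy
              _ = _ := by simp
          · exact (hjm.comp (by fun_prop : Measurable fun p : E × E => (p, t))).aemeasurable
        · calc _ ≤ ∫⁻ x in B, 2^(Module.finrank ℝ E) * I := by
                  refine setLIntegral_mono' hm fun x hx => ?_
                  have := lint_scale_ball hgm (s := 1 - t) (by linarith) (by linarith [ht.1]) hx
                  refine le_trans (le_of_eq ?_) this
                  refine lintegral_congr fun y => ?_
                  congr 1
                  rw [add_comm]; congr 2; ring
              _ = _ := by simp
    _ = _ := by simp
end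


section
open MeasureTheory
variable {E : Type*} [NormedAddCommGroup E] [InnerProductSpace ℝ E] [FiniteDimensional ℝ E]
  [MeasurableSpace E] [BorelSpace E]
variable {ι : Type*} [Fintype ι] [DecidableEq ι] {lo hi : ℝ}

def spf (t : ℝ) : ℝ := (t + Real.sqrt (t^2+1))/2
def spf1 (t : ℝ) : ℝ := (1 + t / Real.sqrt (t^2+1))/2
def spf2 (t : ℝ) : ℝ := (1 / (Real.sqrt (t^2+1) * (t^2+1)))/2

lemma spf_d1 (t : ℝ) : HasDerivAt spf (spf1 t) t := by
  have h0 : t^2+1 ≠ 0 := by positivity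
  have h1 : HasDerivAt (fun t : ℝ => t^2+1) (2*t) t := by
    have := (hasDerivAt_pow 2 t).add_const (1:ℝ)
    exact this.congr_deriv (by simp)
  have h2 := ((hasDerivAt_id t).add (h1.sqrt h0)).div_const 2
  refine h2.congr_deriv ?_
  unfold spf1
  have : Real.sqrt (t^2+1) ≠ 0 := by positivity
  field_simp

lemma spf_d2 (t : ℝ) : HasDerivAt spf1 (spf2 t) t := by
  have h0 : t^2+1 ≠ 0 := by positivity
  have h1 : HasDerivAt (fun t : ℝ => t^2+1) (2*t) t := by
    have := (hasDerivAt_pow 2 t).add_const (1:ℝ)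
    exact this.congr_deriv (by simp)
  have hs : Real.sqrt (t^2+1) ≠ 0 := by positivity
  have h2 := (((hasDerivAt_id t).div (h1.sqrt h0) hs).const_add 1).div_const 2
  refine h2.congr_deriv ?_
  unfold spf2
  have hsq : Real.sqrt (t^2+1)^2 = t^2+1 := Real.sq_sqrt (by positivity)
  simp only [id]
  rw [hsq]
  field_simp
  rw [hsq]; ring

lemma sqrt_gt (t : ℝ) : |t| < Real.sqrt (t^2+1) := by
  apply Real.lt_sqrt_of_sq_lt
  rw [sq_abs]; linarith

lemma spf_pos (t : ℝ) : 0 < spf t := by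
  have := sqrt_gt t
  have := neg_abs_le t
  unfold spf; linarith

lemma spf_ge (t : ℝ) : t ≤ spf t := by
  have := sqrt_gt t
  have := le_abs_self t
  unfold spf; linarith

lemma spf1_pos (t : ℝ) : 0 < spf1 t := by
  have h := sqrt_gt t
  have := neg_abs_le t
  have hs : 0 < Real.sqrt (t^2+1) := by positivity
  have : -1 < t / Real.sqrt (t^2+1) := by rw [lt_div_iff₀ hs]; linarith
  unfold spf1; linarith

lemma spf2_pos (t : ℝ) : 0 < spf2 t := by
  unfold spf2; positivity

lemma spf_sq_le (t : ℝ) : spf t ^2 ≤ 2 * (max t 0)^2 + 1 := by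
  have h1 : Real.sqrt (t^2+1) ≤ |t| + 1 := by
    rw [Real.sqrt_le_left (by positivity)]
    nlinarith [sq_abs t, abs_nonneg t]
  have h2 : spf t ≤ max t 0 + 1/2 := by
    unfold spf
    rcases le_total 0 t with h | h
    · rw [abs_of_nonneg h] at h1; rw [max_eq_left h]; linarith
    · rw [abs_of_nonpos h] at h1; rw [max_eq_right h]; linarith
  have h3 := spf_pos t
  nlinarith [sq_nonneg (max t 0 - 1/2), le_max_right t 0]

lemma spf_contDiff : ContDiff ℝ 2 spf := by
  unfold spf
  have : ContDiff ℝ 2 fun t : ℝ => Real.sqrt (t^2+1) :=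
    ContDiff.sqrt (by fun_prop) (fun t => by positivity)
  fun_prop

lemma energy_pos {h : E → ℝ} (hh : ContDiff ℝ 1 h) {δ G : ℝ} (hδ : 0 < δ) (hG : 0 ≤ G)
    (hen : ∫ x in Metric.closedBall (0:E) 1, ‖fderiv ℝ h x‖^2 ≤ G)
    (hD : ENNReal.ofReal δ ≤ volume ({x | h x ≤ 0} ∩ Metric.closedBall (0:E) 1)) :
    ∫ x in Metric.closedBall (0:E) 1, (max (h x) 0)^2 ≤
      4 * (2^(Module.finrank ℝ E) * G * volume.real (Metric.closedBall (0:E) 1)) / δ := by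
  set B := Metric.closedBall (0:E) 1 with hB
  have hm : MeasurableSet B := Metric.isClosed_closedBall.measurableSet
  have hP := poincare hh
  have hDm : MeasurableSet {x | h x ≤ 0} := (isClosed_le hh.continuous continuous_const).measurableSet
  have hcm : Continuous fun x => (max (h x) 0)^2 := (hh.continuous.max continuous_const).pow 2
  have h1 : ENNReal.ofReal δ * ∫⁻ x in B, ENNReal.ofReal ((max (h x) 0)^2) ≤
      ∫⁻ x in B, ∫⁻ y in B, ENNReal.ofReal ((h x - h y)^2) := by
    rw [← lintegral_const_mul' _ _ (by simp)]
    refine lintegral_mono fun x => ?_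
    calc ENNReal.ofReal δ * ENNReal.ofReal ((max (h x) 0)^2)
        ≤ ENNReal.ofReal ((max (h x) 0)^2) * volume ({x | h x ≤ 0} ∩ B) := by
          rw [mul_comm]; exact mul_le_mul_right hD _
      _ = ∫⁻ y in {x | h x ≤ 0} ∩ B, ENNReal.ofReal ((max (h x) 0)^2) := by simp
      _ ≤ ∫⁻ y in {x | h x ≤ 0} ∩ B, ENNReal.ofReal ((h x - h y)^2) := by
          refine setLIntegral_mono' (hDm.inter hm) fun y hy => ENNReal.ofReal_le_ofReal ?_
          have hy0 : h y ≤ 0 := hy.1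
          rcases le_total 0 (h x) with h | h
          · rw [max_eq_left h]; nlinarith
          · rw [max_eq_right h]; nlinarith
      _ ≤ _ := lintegral_mono_set Set.inter_subset_right
  have h2 := h1.trans hP
  have hcf : Continuous fun x => ‖fderiv ℝ h x‖^2 := (hh.continuous_fderiv one_ne_zero).norm.pow 2
  rw [← ofReal_integral_eq_lintegral_ofReal (indicator_int hcm 1) (Filter.Eventually.of_forall fun t => sq_nonneg _),
    ← ofReal_integral_eq_lintegral_ofReal (indicator_int hcf 1)
      (Filter.Eventually.of_forall fun t => sq_nonneg _)] at h2
  have e1 : volume B = ENNReal.ofReal (volume.real B) := by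
    rw [Measure.real, ENNReal.ofReal_toReal (measure_closedBall_lt_top (x := (0:E)) (r := 1)).ne]
  have e2 : (4:ENNReal) = ENNReal.ofReal 4 := by norm_num
  have e3 : (2:ENNReal)^(Module.finrank ℝ E) = ENNReal.ofReal (2^(Module.finrank ℝ E)) := by
    rw [ENNReal.ofReal_pow (by norm_num)]; norm_num
  have hI : 0 ≤ ∫ x in B, ‖fderiv ℝ h x‖^2 := integral_nonneg fun x => sq_nonneg _
  rw [e1, e2, e3, ← ENNReal.ofReal_mul hδ.le, ← ENNReal.ofReal_mul (by positivity), ← ENNReal.ofReal_mul (by positivity),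
    ← ENNReal.ofReal_mul (by norm_num), ENNReal.ofReal_le_ofReal_iff (by positivity)] at h2
  rw [le_div_iff₀ hδ, mul_comm]
  refine h2.trans ?_
  gcongr

set_option maxHeartbeats 1000000 in
lemma weak_harnack {p : ℝ} (hp : Real.HolderConjugate (Module.finrank ℝ E) p) (hlo : 0 < lo) (hhi : 0 < hi)
    (b : OrthonormalBasis ι ℝ E) {δ : ℝ} (hδ : 0 < δ) :
    ∃ c : ℝ, 0 < c ∧ ∀ A, Ell b lo hi A → ∀ w : E → ℝ, ContDiff ℝ 2 w → (∀ x, 0 ≤ w x) → (∀ x, LL b A w x ≤ 0) →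
      ∀ m : ℝ, 0 < m → ENNReal.ofReal δ ≤ volume ({x | m ≤ w x} ∩ Metric.closedBall (0:E) 1) → c * m ≤ w 0 := by
  obtain ⟨ε0, hε0, hmos⟩ := moser hp hlo hhi b
  obtain ⟨C0, hC0, hcut⟩ := exists_cutoff E
  obtain ⟨φ, hφ, hcs, h01, hone, hz, hz', hDφ⟩ := hcut 1 2 (by norm_num) (by norm_num)
  set P := ∫ x, ‖fderiv ℝ φ x‖^2 with hPd
  have hP0 : 0 ≤ P := integral_nonneg fun x => sq_nonneg _
  have iP : Integrable fun x => ‖fderiv ℝ φ x‖^2 := by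
    apply cint ((hφ.continuous_fderiv one_ne_zero).norm.pow 2)
    simp only [pow_two]
    exact (hcs.fderiv ℝ).norm.mul_right
  set G := 4 * (hi * P) / lo with hG
  have hG0 : 0 ≤ G := by positivity
  set V := volume.real (Metric.closedBall (0:E) 1) with hV
  have hV0 : 0 ≤ V := measureReal_nonneg
  set S := 4 * (2^(Module.finrank ℝ E) * G * V) / δ with hS
  have hS0 : 0 ≤ S := by positivity
  set M := Real.sqrt ((2*S+V)/ε0) + 1 with hM
  have hM0 : 0 < M := by positivity
  have hM2 : (2*S+V)/ε0 ≤ M^2 := by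
    have h1 := Real.sq_sqrt (show 0 ≤ (2*S+V)/ε0 by positivity)
    have h2 := Real.sqrt_nonneg ((2*S+V)/ε0)
    rw [hM]; nlinarith
  refine ⟨Real.exp (-M), Real.exp_pos _, ?_⟩
  intro A hA w hw hw0 hLw m hm hD
  refine le_of_forall_pos_le_add fun ε hε => ?_
  have hwp : ∀ x, 0 < w x + ε := fun x => by linarith [hw0 x]
  set h : E → ℝ := fun x => Real.log m - Real.log (w x + ε) with hh
  have hhs : ContDiff ℝ 2 h := contDiff_const.sub ((hw.add contDiff_const).log fun x => (hwp x).ne')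
  have hh1 : ContDiff ℝ 1 h := hhs.of_le (by norm_num)
  have d1 : ∀ x, HasDerivAt (fun t => Real.log m - Real.log (t + ε)) (-((w x + ε)⁻¹)) (w x) := by
    intro x
    have := (((hasDerivAt_id (w x)).add_const ε).log (hwp x).ne').const_sub (Real.log m)
    exact this.congr_deriv (by simp)
  have d2 : ∀ x, HasDerivAt (fun t => -((t + ε)⁻¹)) (((w x + ε)^2)⁻¹) (w x) := by
    intro x
    have := (((hasDerivAt_id (w x)).add_const ε).inv (hwp x).ne').neg
    refine this.congr_deriv (by simp [neg_div])
  have hL : ∀ x, QQ b A h h x ≤ LL b A h x := by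
    intro x
    have e1 := LL_comp (b := b) (A := A) hw (Φ := fun t => Real.log m - Real.log (t + ε)) (Φ1 := fun t => -((t + ε)⁻¹))
      (Φ2 := fun t => ((t + ε)^2)⁻¹) d1 d2 x
    have e2 := QQ_comp (b := b) (A := A) hw (Φ := fun t => Real.log m - Real.log (t + ε)) (Φ1 := fun t => -((t + ε)⁻¹)) d1 x
    rw [hh, e1, e2, neg_sq, inv_pow]
    have := mul_nonneg (inv_nonneg.2 (hwp x).le) (neg_nonneg.2 (hLw x))
    linarith
  have hen : ∫ x in Metric.closedBall (0:E) 1, ‖fderiv ℝ h x‖^2 ≤ G := by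
    have h1 := log_energy hA hlo.le hhs hφ hcs hL
    have h2 : ∫ x, QQ b A φ φ x ≤ hi * P := by
      rw [hPd, ← integral_const_mul]
      refine integral_mono ?_ (iP.const_mul hi) fun x => QQ_upper hA φ x
      refine (iP.const_mul hi).mono' (QQ_cont hA hφ hφ).aestronglyMeasurable (Filter.Eventually.of_forall fun x => ?_)
      rw [Real.norm_of_nonneg (QQ_nonneg hA hlo.le φ x)]
      exact QQ_upper hA φ x
    have hQc := QQ_cont hA hh1 hh1
    have i1 : Integrable fun x => φ x ^2 * QQ b A h h x := by
      apply cint ((hφ.continuous.pow 2).mul hQc)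
      have : HasCompactSupport fun x => φ x ^2 := hcs.comp_left (g := fun t : ℝ => t^2) (by simp)
      exact this.mul_right
    have h3 : lo * ∫ x in Metric.closedBall (0:E) 1, ‖fderiv ℝ h x‖^2 ≤ ∫ x, φ x ^2 * QQ b A h h x := by
      rw [← integral_const_mul]
      refine le_trans ?_ (setIntegral_le_integral (s := Metric.closedBall (0:E) 1) i1 
        (Filter.Eventually.of_forall fun x => mul_nonneg (sq_nonneg _) (QQ_nonneg hA hlo.le h x)))
      refine setIntegral_mono_on ((indicator_int ((hh1.continuous_fderiv one_ne_zero).norm.pow 2) 1).const_mul lo)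
        i1.integrableOn Metric.isClosed_closedBall.measurableSet fun x hx => ?_
      simp only [Metric.mem_closedBall, dist_zero_right] at hx
      rw [hone x hx, one_pow, one_mul]
      exact QQ_lower hA h x
    rw [hG, le_div_iff₀ hlo, mul_comm]
    linarith
  have hsub : ENNReal.ofReal δ ≤ volume ({x | h x ≤ 0} ∩ Metric.closedBall (0:E) 1) := by
    refine hD.trans (measure_mono (Set.inter_subset_inter_left _ fun x hx => ?_))
    have hx' : m ≤ w x := hx
    have := Real.log_le_log hm (show m ≤ w x + ε by linarith)
    simp only [hh, Set.mem_setOf_eq]; linarith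
  have hpos := energy_pos hh1 hδ hG0 hen hsub
  have hfs : ContDiff ℝ 2 fun x => spf (h x) / M := (spf_contDiff.comp hhs).div_const M
  have hf0 := hmos A hA (fun x => spf (h x) / M) hfs (fun x => div_pos (spf_pos _) hM0) (by
    intro x
    have e1 := LL_comp (b := b) (A := A) hhs (Φ := fun t => spf t / M) (Φ1 := fun t => spf1 t / M)
      (Φ2 := fun t => spf2 t / M) (fun x => (spf_d1 _).div_const M) (fun x => (spf_d2 _).div_const M) x
    rw [e1]
    have a1 := QQ_nonneg hA hlo.le h x
    have a2 := a1.trans (hL x)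
    have a3 := spf1_pos (h x)
    have a4 := spf2_pos (h x)
    positivity) (by
    have c1 : Continuous fun x => (max (h x) 0)^2 := (hh1.continuous.max continuous_const).pow 2
    calc ∫ x in Metric.closedBall (0:E) 1, (spf (h x) / M)^2
        ≤ ∫ x in Metric.closedBall (0:E) 1, (2 * (max (h x) 0)^2 + 1) / M^2 := by
          refine setIntegral_mono_on (indicator_int (hfs.continuous.pow 2) 1)
            (indicator_int (((continuous_const.mul c1).add continuous_const).div_const _) 1) Metric.isClosed_closedBall.measurableSet fun x _ => ?_
          rw [div_pow]
          gcongr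
          exact spf_sq_le _
      _ = (2 * (∫ x in Metric.closedBall (0:E) 1, (max (h x) 0)^2) + V) / M^2 := by
          rw [integral_div, integral_add ((indicator_int c1 1).const_mul 2) (indicator_int continuous_const 1), integral_const_mul]
          simp [hV]
      _ ≤ (2*S+V)/M^2 := by gcongr
      _ ≤ ε0 := by
          rw [div_le_iff₀ hε0] at hM2
          rw [div_le_iff₀ (by positivity)]; linarith)
  rw [div_le_one hM0] at hf0
  have h3 := (spf_ge (h 0)).trans hf0
  simp only [hh] at h3
  have h4 : -M + Real.log m ≤ Real.log (w 0 + ε) := by linarith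
  have h5 := Real.exp_le_exp.2 h4
  rwa [Real.exp_log (hwp 0), Real.exp_add, Real.exp_log hm] at h5
end


section
open MeasureTheory
variable {E : Type*} [NormedAddCommGroup E] [InnerProductSpace ℝ E] [FiniteDimensional ℝ E]
  [MeasurableSpace E] [BorelSpace E]
variable {ι : Type*} [Fintype ι] [DecidableEq ι] {lo hi : ℝ} {b : OrthonormalBasis ι ℝ E} {A : E → Matrix ι ι ℝ}

lemma Ell.scale (hA : Ell b lo hi A) (R : ℝ) (x0 : E) : Ell b lo hi (fun y => A (x0 + R • y)) := by
  have e1 : ∀ p q, (fun y => A (x0 + R • y) p q) = fun y => 1 * (fun z => A z p q) (x0 + R • y) := by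
    intro p q; funext y; simp
  refine ⟨fun p q => ?_, fun x => hA.symm _, fun x => hA.lower _, fun x => hA.upper _, fun x q => ?_⟩
  · rw [e1]; exact affine_contDiff (hA.smooth p q) 1 R x0
  · simp only [e1]
    have : ∀ p, dd (b p) (fun y => 1 * (fun z => A z p q) (x0 + R • y)) x = R * dd (b p) (fun z => A z p q) (x0 + R • x) := by
      intro p
      rw [dd_affine (hA.smooth p q)]; simp
    simp only [this]
    rw [← Finset.mul_sum, hA.div, mul_zero]

lemma LL_scale {w : E → ℝ} (hw : ContDiff ℝ 2 w) (c R : ℝ) (x0 y : E) :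
    LL b (fun y => A (x0 + R • y)) (fun y => c * w (x0 + R • y)) y = (c * R^2) * LL b A w (x0 + R • y) := by
  unfold LL
  rw [Finset.mul_sum]
  refine Finset.sum_congr rfl fun p _ => ?_
  rw [Finset.mul_sum]
  refine Finset.sum_congr rfl fun q _ => ?_
  rw [dd2_affine hw]; ring

lemma LL_const_sub {w : E → ℝ} (hw : ContDiff ℝ 2 w) (S : ℝ) (x : E) :
    LL b A (fun y => S - w y) x = - LL b A w x := by
  have := LL_comp (b := b) (A := A) hw (Φ := fun t => S - t) (Φ1 := fun _ => -1) (Φ2 := fun _ => 0)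
    (fun x => by simpa using (hasDerivAt_id (w x)).const_sub S) (fun x => hasDerivAt_const _ _) x
  rw [this]; ring

lemma common_max {p : ℝ} (hp : Real.HolderConjugate (Module.finrank ℝ E) p) (hlo : 0 < lo) (hhi : 0 < hi)
    (hA : Ell b lo hi A) {κ : Type*} (s : Finset κ) (w : κ → E → ℝ) (S : κ → ℝ) (hw : ∀ i, ContDiff ℝ 2 (w i))
    (hL : ∀ i x, 0 ≤ LL b A (w i) x) (hS : ∀ i x, w i x ≤ S i) (hsup : ∀ i ε, 0 < ε → ∃ x, S i - ε < w i x)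
    {η : ℝ} (hη : 0 < η) : ∃ y, ∀ i ∈ s, S i - η < w i y := by
  set N := Module.finrank ℝ E with hN
  set V := volume.real (Metric.closedBall (0:E) 1) with hV
  have hVt : volume (Metric.closedBall (0:E) 1) = ENNReal.ofReal V := by
    rw [hV, Measure.real, ENNReal.ofReal_toReal (measure_closedBall_lt_top (x := (0:E)) (r := 1)).ne]
  have hV0 : 0 < V := by
    rw [hV, Measure.real, ENNReal.toReal_pos_iff]
    exact ⟨Metric.measure_closedBall_pos _ _ one_pos, measure_closedBall_lt_top⟩
  set δ : ℝ := V / (2^N * (s.card + 1)) with hδ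
  have hδ0 : 0 < δ := by positivity
  obtain ⟨c, hc, hwh⟩ := weak_harnack hp hlo hhi b hδ0
  choose x hx using fun i => hsup i (c * η) (by positivity)
  obtain ⟨R, hR1, hR⟩ : ∃ R : ℝ, 1 ≤ R ∧ ∀ i ∈ s, ‖x i‖ ≤ R := by
    refine ⟨1 + ∑ i ∈ s, ‖x i‖, by have : 0 ≤ ∑ i ∈ s, ‖x i‖ := Finset.sum_nonneg fun i _ => norm_nonneg _
                                   linarith, fun i hi => ?_⟩
    have := Finset.single_le_sum (f := fun i => ‖x i‖) (fun i _ => norm_nonneg _) hi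
    linarith
  have hR0 : 0 < R := by linarith
  set Y : κ → Set E := fun i => {y | w i y ≤ S i - η} ∩ Metric.closedBall 0 R with hY
  have hYs : ∀ i ∈ s, volume (Y i) ≤ ENNReal.ofReal ((2*R)^N * δ) := by
    intro i hi
    set Z : Set E := {z | η ≤ 1 * (fun y => S i - w i y) (x i + (2*R) • z)} ∩ Metric.closedBall 0 1 with hZ
    have hsi : ContDiff ℝ 2 (fun y => S i - w i y) := contDiff_const.sub (hw i)
    have hZs : volume Z < ENNReal.ofReal δ := by
      by_contra hcon
      push Not at hcon
      have := hwh _ (hA.scale (2*R) (x i)) (fun y => 1 * (fun y => S i - w i y) (x i + (2*R) • y))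
        (affine_contDiff hsi 1 (2*R) (x i))
        (fun y => by simpa using hS i _) (fun y => by
          rw [LL_scale hsi, LL_const_sub (hw i)]
          have := hL i (x i + (2*R) • y)
          have : 0 ≤ (1 * (2*R)^2) * LL b A (w i) (x i + (2*R) • y) := by positivity
          linarith) η hη hcon
      simp at this
      linarith [hx i]
    have hsub : Y i ⊆ (fun y => y + (- x i)) ⁻¹' ((fun y => (2*R)⁻¹ • y) ⁻¹' Z) := by
      rintro y ⟨h1, h2⟩
      simp only [Set.mem_preimage, hZ]
      have e1 : x i + (2*R) • (2*R)⁻¹ • (y + -x i) = y := by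
        rw [smul_smul, mul_inv_cancel₀ (by positivity), one_smul]; abel
      constructor
      · change η ≤ 1 * (S i - w i (x i + (2*R) • (2*R)⁻¹ • (y + -x i)))
        rw [e1]
        have h1' : w i y ≤ S i - η := h1
        linarith
      · simp only [Metric.mem_closedBall, dist_zero_right] at h2 ⊢
        rw [norm_smul, Real.norm_of_nonneg (by positivity), inv_mul_le_iff₀ (by positivity)]
        have := norm_add_le y (- x i)
        rw [norm_neg] at this
        linarith [hR i hi]
    refine (measure_mono hsub).trans ?_
    rw [measure_preimage_add_right, Measure.addHaar_preimage_smul _ (by positivity), ENNReal.ofReal_mul (by positivity)]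
    refine mul_le_mul' (le_of_eq ?_) hZs.le
    congr 1
    rw [abs_of_nonneg (by positivity), inv_pow, inv_inv]
  have hnot : ¬ (Metric.closedBall (0:E) R ⊆ ⋃ i ∈ s, Y i) := by
    intro hsub
    have h1 := (measure_mono (μ := volume) hsub).trans ((measure_biUnion_finset_le s Y).trans (Finset.sum_le_sum hYs))
    rw [Measure.addHaar_closedBall' _ _ hR0.le, hVt, ← ENNReal.ofReal_mul (by positivity), Finset.sum_const, nsmul_eq_mul,
      ← ENNReal.ofReal_natCast, ← ENNReal.ofReal_mul (by positivity), ENNReal.ofReal_le_ofReal_iff (by positivity)] at h1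
    have e : (s.card:ℝ) * ((2*R)^N * δ) = R^N * V * (s.card / (s.card + 1)) := by
      rw [hδ, mul_pow]; field_simp
    rw [e] at h1
    have h2 : (s.card:ℝ) / (s.card + 1) < 1 := by rw [div_lt_one (by positivity)]; linarith
    have h3 : 0 < R^N * V := by positivity
    nlinarith
  rw [Set.not_subset] at hnot
  obtain ⟨y, hy1, hy2⟩ := hnot
  refine ⟨y, fun i hi => ?_⟩
  by_contra hcon
  push Not at hcon
  exact hy2 (Set.mem_biUnion hi ⟨hcon, hy1⟩)
end


section
variable {ι : Type*} [Fintype ι] [DecidableEq ι]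

lemma es_perm (σ : Equiv.Perm ι) (j : ℕ) (l : ι → ℝ) : es Finset.univ j (l ∘ σ) = es Finset.univ j l := by
  rw [← gp_coeff, ← gp_coeff]
  unfold gp
  congr 1
  exact Equiv.prod_comp σ (fun i => 1 + Polynomial.C (l i) * Polynomial.X)

lemma Gam.smul {T : Finset ι} {k : ℕ} {l : ι → ℝ} (h : Gam T k l) {c : ℝ} (hc : 0 < c) : Gam T k (c • l) := by
  intro j hj
  rw [es_smul]
  exact mul_pos (pow_pos hc j) (h j hj)

lemma es_logconc {T : Finset ι} {k : ℕ} {l m : ι → ℝ} (hl : Gam T k l) (hm : Gam T k m) {s t : ℝ} (hs : 0 < s) (ht : 0 < t)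
    (hst : s + t = 1) : ∀ j, j ≤ k → 0 < es T j (s • l + t • m) ∧
      (es T j l)^s * (es T j m)^t ≤ es T j (s • l + t • m) := by
  intro j
  induction j with
  | zero => intro _; simp [es_zero]
  | succ j ih =>
    intro hj
    obtain ⟨h1, h2⟩ := ih (by omega)
    have hlj : Gam T j l := hl.mono (by omega)
    have hmj : Gam T j m := hm.mono (by omega)
    obtain ⟨h3, h4⟩ := quot_superadd j T (s • l) (t • m) (hlj.smul hs) (hmj.smul ht)
    have a1 := hl j (by omega)
    have a2 := hl (j+1) hj
    have b1 := hm j (by omega)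
    have b2 := hm (j+1) hj
    have e1 : ∀ (c : ℝ) (q : ι → ℝ), 0 < c → es T (j+1) (c • q) / es T j (c • q) = c * (es T (j+1) q / es T j q) := by
      intro c q hc
      rw [es_smul, es_smul, pow_succ, mul_assoc, mul_div_mul_left _ _ (pow_pos hc j).ne', mul_div_assoc]
    rw [e1 s l hs, e1 t m ht] at h4
    have h5 := (Real.geom_mean_le_arith_mean2_weighted hs.le ht.le (div_pos a2 a1).le (div_pos b2 b1).le hst).trans h4
    have h6 : (es T (j+1) l)^s * (es T (j+1) m)^t ≤ es T (j+1) (s • l + t • m) := by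
      calc (es T (j+1) l)^s * (es T (j+1) m)^t
          = ((es T (j+1) l / es T j l)^s * (es T (j+1) m / es T j m)^t) * ((es T j l)^s * (es T j m)^t) := by
            rw [Real.div_rpow a2.le a1.le, Real.div_rpow b2.le b1.le]
            have : 0 < (es T j l)^s := Real.rpow_pos_of_pos a1 _
            have : 0 < (es T j m)^t := Real.rpow_pos_of_pos b1 _
            field_simp
        _ ≤ (es T (j+1) (s • l + t • m) / es T j (s • l + t • m)) * es T j (s • l + t • m) := by
            refine mul_le_mul h5 h2 (by positivity) (le_trans (by positivity) h5)
        _ = _ := by field_simp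
    exact ⟨lt_of_lt_of_le (by positivity) h6, h6⟩

def Zset (ι : Type*) [Fintype ι] [DecidableEq ι] (k : ℕ) : Set (ι → ℝ) := {d | Gam Finset.univ k d ∧ 1 ≤ es Finset.univ k d}

lemma Zset_convex (k : ℕ) : Convex ℝ (Zset ι k) := by
  rw [convex_iff_forall_pos]
  rintro l ⟨hl, hl1⟩ m ⟨hm, hm1⟩ s t hs ht hst
  have h := es_logconc hl hm hs ht hst
  refine ⟨fun j hj => (h j hj).1, le_trans ?_ (h k le_rfl).2⟩
  exact one_le_mul_of_one_le_of_one_le (Real.one_le_rpow hl1 hs.le) (Real.one_le_rpow hm1 ht.le)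

lemma schur_mem {k : ℕ} {l : ι → ℝ} (hl : l ∈ Zset ι k) {S : Matrix ι ι ℝ} (hS : S ∈ doublyStochastic ℝ ι) :
    S.mulVec l ∈ Zset ι k := by
  set f : Matrix ι ι ℝ →ₗ[ℝ] (ι → ℝ) :=
    { toFun := fun M => M.mulVec l
      map_add' := fun M M' => Matrix.add_mulVec M M' l
      map_smul' := fun c M => Matrix.smul_mulVec c M l } with hf
  have hconv : Convex ℝ (f ⁻¹' Zset ι k) := (Zset_convex k).linear_preimage f
  rw [← SetLike.mem_coe, doublyStochastic_eq_convexHull_permMatrix] at hS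
  refine convexHull_min ?_ hconv hS
  rintro _ ⟨σ, rfl⟩
  change (σ.permMatrix ℝ).mulVec l ∈ Zset ι k
  rw [Matrix.permMatrix_mulVec]
  exact ⟨fun j hj => by rw [es_perm]; exact hl.1 j hj, by rw [es_perm]; exact hl.2⟩

/-- first order inequality -/
lemma first_order {k : ℕ} {l d : ι → ℝ} (hl : Gam Finset.univ (k+1) l) (h1 : es Finset.univ (k+1) l = 1)
    (hd : d ∈ Zset ι (k+1)) : 0 ≤ ∑ i, (d i - l i) * es (Finset.univ.erase i) k l := by
  have hder := es_hasDerivAt Finset.univ k l (d - l) 0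
  simp only [zero_smul, add_zero] at hder
  have hge : ∀ s ∈ Set.Icc (0:ℝ) 1, es Finset.univ (k+1) (l + (0:ℝ) • (d - l)) ≤ es Finset.univ (k+1) (l + s • (d - l)) := by
    intro s hs
    have := Zset_convex (ι := ι) (k+1) (⟨hl, h1.ge⟩ : l ∈ Zset ι (k+1)) hd (a := 1 - s) (b := s) (by linarith [hs.2]) hs.1 (by ring)
    have e : (1 - s) • l + s • d = l + s • (d - l) := by
      ext i; simp; ring
    rw [e] at this
    simpa [h1] using this.2
  by_contra hcon
  push Not at hcon
  have hmin : IsLocalMinOn (fun s : ℝ => es Finset.univ (k+1) (l + s • (d - l))) (Set.Icc 0 1) 0 := by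
    filter_upwards [self_mem_nhdsWithin] with s hs using hge s hs
  have := hmin.hasFDerivWithinAt_nonneg hder.hasFDerivAt.hasFDerivWithinAt (y := 1)
    (mem_posTangentConeAt_of_segment_subset (by simp [segment_eq_Icc]))
  simp only [ContinuousLinearMap.toSpanSingleton_apply, one_smul, Pi.sub_apply] at this
  linarith
end


section
variable {E : Type*} [NormedAddCommGroup E] [InnerProductSpace ℝ E] [FiniteDimensional ℝ E]
variable {ι : Type*} [Fintype ι] [DecidableEq ι] {j : ℕ} {K : ℝ} {v : E → ℝ}

lemma Sol.polar (h : Sol ι j K v) (x a c : E) :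
    4 * dd a (dd c v) x = dd (a+c) (dd (a+c) v) x - dd (a-c) (dd (a-c) v) x := by
  obtain ⟨b, l, hp⟩ := h.pt x
  have hv2 : ContDiff ℝ 2 v := h.smooth.of_le (by norm_num)
  rw [hp.form hv2, hp.form hv2, hp.form hv2, Finset.mul_sum, ← Finset.sum_sub_distrib]
  refine Finset.sum_congr rfl fun i _ => ?_
  rw [inner_add_right, inner_sub_right]; ring

lemma Sol.upper (h : Sol ι j K v) {C : ℝ} (hbd : ∀ x e : E, ‖e‖ = 1 → dd e (dd e v) x ≤ C) (x e : E) :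
    dd e (dd e v) x ≤ C * ‖e‖^2 := by
  obtain ⟨b, l, hp⟩ := h.pt x
  have hv2 : ContDiff ℝ 2 v := h.smooth.of_le (by norm_num)
  rw [hp.form hv2, ← sum_inner_sq b e, Finset.mul_sum]
  refine Finset.sum_le_sum fun i _ => ?_
  have h1 := hbd x (b i) (b.norm_eq_one i)
  rw [hp.apply] at h1
  simp only [if_true] at h1
  rw [← pow_two]
  exact mul_le_mul_of_nonneg_right h1 (sq_nonneg _)

lemma Sol.expand (h : Sol ι j K v) (b : OrthonormalBasis ι ℝ E) (x e : E) :
    dd e (dd e v) x = ∑ p, ∑ q, inner ℝ (b p) e * inner ℝ (b q) e * dd (b p) (dd (b q) v) x := by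
  have hv2 : ContDiff ℝ 2 v := h.smooth.of_le (by norm_num)
  have := dd2_sum Finset.univ hv2 (fun p => inner ℝ (b p) e) b (fun p => inner ℝ (b p) e) x
  rw [b.sum_repr' e] at this
  exact this

lemma PtEig.trace (h : Sol ι j K v) {x : E} {b : OrthonormalBasis ι ℝ E} {l : ι → ℝ}
    (hp : PtEig j K v x b l) (b' : OrthonormalBasis ι ℝ E) : ∑ i, dd (b' i) (dd (b' i) v) x = ∑ i, l i := by
  have hv2 : ContDiff ℝ 2 v := h.smooth.of_le (by norm_num)
  simp only [hp.form hv2]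
  rw [Finset.sum_comm]
  refine Finset.sum_congr rfl fun k _ => ?_
  rw [← Finset.mul_sum]
  have := sum_inner_sq b' (b k)
  rw [b.norm_eq_one, one_pow] at this
  have e : ∑ i, inner ℝ (b k) (b' i) * inner ℝ (b k) (b' i) = 1 := by
    rw [← this]
    refine Finset.sum_congr rfl fun i _ => ?_
    rw [real_inner_comm, pow_two]
  rw [e, mul_one]

lemma near_form (h : Sol ι j K v) (b : OrthonormalBasis ι ℝ E) {η : ℝ} {y y' : E} {S : E → ℝ}
    (hS : ∀ e x, dd e (dd e v) x ≤ S e)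
    (hy : ∀ p q, S (b p + b q) - η < dd (b p + b q) (dd (b p + b q) v) y ∧ S (b p - b q) - η < dd (b p - b q) (dd (b p - b q) v) y)
    (hy' : ∀ p q, S (b p + b q) - η < dd (b p + b q) (dd (b p + b q) v) y' ∧ S (b p - b q) - η < dd (b p - b q) (dd (b p - b q) v) y')
    {e : E} (he : ‖e‖ = 1) : dd e (dd e v) y' ≤ dd e (dd e v) y + (Fintype.card ι : ℝ)^2 * η := by
  rw [h.expand b y e, h.expand b y' e]
  have hc : ∀ p, |inner ℝ (b p) e| ≤ 1 := by
    intro p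
    have := abs_real_inner_le_norm (b p) e
    rwa [b.norm_eq_one, he, one_mul] at this
  have : (Fintype.card ι : ℝ)^2 * η = ∑ p : ι, ∑ q : ι, η := by
    simp only [Finset.sum_const, Finset.card_univ, nsmul_eq_mul]; ring
  rw [this, ← Finset.sum_add_distrib]
  refine Finset.sum_le_sum fun p _ => ?_
  rw [← Finset.sum_add_distrib]
  refine Finset.sum_le_sum fun q _ => ?_
  have h1 := h.polar y (b p) (b q)
  have h2 := h.polar y' (b p) (b q)
  have a1 := hy p q
  have a2 := hy' p q
  have c1 := hS (b p + b q) y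
  have c2 := hS (b p + b q) y'
  have c3 := hS (b p - b q) y
  have c4 := hS (b p - b q) y'
  have hd : |dd (b p) (dd (b q) v) y' - dd (b p) (dd (b q) v) y| ≤ η := by
    rw [abs_le]; constructor <;> linarith
  have hpr : |inner ℝ (b p) e * inner ℝ (b q) e| ≤ 1 := by
    rw [abs_mul]; exact mul_le_one₀ (hc p) (abs_nonneg _) (hc q)
  have hη : 0 ≤ η := (abs_nonneg _).trans hd
  have := le_abs_self (inner ℝ (b p) e * inner ℝ (b q) e * (dd (b p) (dd (b q) v) y' - dd (b p) (dd (b q) v) y))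
  rw [abs_mul] at this
  have h3 : |inner ℝ (b p) e * inner ℝ (b q) e| * |dd (b p) (dd (b q) v) y' - dd (b p) (dd (b q) v) y| ≤ 1 * η :=
    mul_le_mul hpr hd (abs_nonneg _) zero_le_one
  linarith

lemma exists_near_max (h : Sol ι j K v) (hK : 0 < K) {C : ℝ} (hC : 0 < C)
    (hbd : ∀ x e : E, ‖e‖ = 1 → dd e (dd e v) x ≤ C) {η : ℝ} (hη : 0 < η) :
    ∃ y, ∀ e x, ‖e‖ = 1 → dd e (dd e v) x ≤ dd e (dd e v) y + η := by
  classical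
  letI : MeasurableSpace E := borel E
  haveI : BorelSpace E := ⟨rfl⟩
  obtain ⟨b, l, hp0⟩ := h.pt 0
  obtain ⟨lo, hi, A, hlo, hhi, hA, hL⟩ := exists_Ell h hK hC hbd b
  have hN : 1 < (Module.finrank ℝ E : ℝ) := by
    rw [Module.finrank_eq_card_basis b.toBasis]
    have := card_ge hp0.one
    exact_mod_cast (by omega : 1 < Fintype.card ι)
  have hp := Real.HolderConjugate.conjExponent hN
  set S : E → ℝ := fun e => sSup (Set.range fun x => dd e (dd e v) x) with hSd
  have hb : ∀ e, BddAbove (Set.range fun x => dd e (dd e v) x) := by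
    intro e
    refine ⟨C * ‖e‖^2, ?_⟩
    rintro _ ⟨x, rfl⟩
    exact h.upper hbd x e
  have hS : ∀ e x, dd e (dd e v) x ≤ S e := fun e x => le_csSup (hb e) ⟨x, rfl⟩
  have hsup : ∀ e ε, 0 < ε → ∃ x, S e - ε < dd e (dd e v) x := by
    intro e ε hε
    obtain ⟨_, ⟨x, rfl⟩, hx⟩ := exists_lt_of_lt_csSup (Set.range_nonempty fun x => dd e (dd e v) x) (show S e - ε < S e by linarith)
    exact ⟨x, hx⟩
  have hcm := fun (s : Finset E) (η : ℝ) (hη : 0 < η) => common_max hp hlo hhi hA s (fun e => dd e (dd e v)) S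
    (fun e => dd_contDiff (n := 3) (dd_contDiff h.smooth (by norm_num) e) (by norm_num) e) hL hS hsup hη
  set η' : ℝ := η / ((Fintype.card ι : ℝ)^2 + 1) with hη'
  have hη0 : 0 < η' := by positivity
  have hηe : (Fintype.card ι : ℝ)^2 * η' + η' = η := by rw [hη']; field_simp
  set D : Finset E := (Finset.univ.image fun r : ι × ι => b r.1 + b r.2) ∪ (Finset.univ.image fun r : ι × ι => b r.1 - b r.2) with hD
  have hD1 : ∀ p q, b p + b q ∈ D := fun p q => Finset.mem_union_left _ (Finset.mem_image.2 ⟨(p,q), Finset.mem_univ _, rfl⟩)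
  have hD2 : ∀ p q, b p - b q ∈ D := fun p q => Finset.mem_union_right _ (Finset.mem_image.2 ⟨(p,q), Finset.mem_univ _, rfl⟩)
  obtain ⟨y, hy⟩ := hcm D η' hη0
  refine ⟨y, fun e x he => ?_⟩
  obtain ⟨y', hy'⟩ := hcm (insert e D) η' hη0
  have h1 := near_form h b hS (fun p q => ⟨hy _ (hD1 p q), hy _ (hD2 p q)⟩)
    (fun p q => ⟨hy' _ (Finset.mem_insert_of_mem (hD1 p q)), hy' _ (Finset.mem_insert_of_mem (hD2 p q))⟩) he
  have h2 := hy' e (Finset.mem_insert_self _ _)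
  have h3 := hS e x
  linarith

lemma compare_xy (h : Sol ι j K v) {M : ℝ} (hM : 1 ≤ M)
    (hl : ∀ x (b : OrthonormalBasis ι ℝ E) l, PtEig j K v x b l → ∀ i, |l i| ≤ M) {η : ℝ} {y : E}
    (hy : ∀ e x, ‖e‖ = 1 → dd e (dd e v) x ≤ dd e (dd e v) y + η) (hη : 0 < η) (x : E) (b0 : OrthonormalBasis ι ℝ E) :
    ∑ i, (dd (b0 i) (dd (b0 i) v) y + η - dd (b0 i) (dd (b0 i) v) x) ≤
      η * (Fintype.card ι * (2^Fintype.card ι * M^(j+1))) * (2 * (Fintype.card ι + 1) * M) := by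
  have hv2 : ContDiff ℝ 2 v := h.smooth.of_le (by norm_num)
  obtain ⟨b, l, hp⟩ := h.pt x
  obtain ⟨b', l', hp'⟩ := h.pt y
  set d : ι → ℝ := fun i => dd (b' i) (dd (b' i) v) x with hd
  have hdZ : d ∈ Zset ι (j+2) := by
    set T : Matrix ι ι ℝ := Matrix.of fun i k => inner ℝ (b k) (b' i) ^2 with hT
    have hTd : T ∈ doublyStochastic ℝ ι := by
      rw [mem_doublyStochastic_iff_sum]
      refine ⟨fun i k => sq_nonneg _, fun i => ?_, fun k => ?_⟩
      · simp only [hT, Matrix.of_apply]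
        rw [sum_inner_sq, b'.norm_eq_one, one_pow]
      · simp only [hT, Matrix.of_apply]
        have := sum_inner_sq b' (b k)
        rw [b.norm_eq_one, one_pow] at this
        rw [← this]
        exact Finset.sum_congr rfl fun i _ => by rw [real_inner_comm]
    have : d = T.mulVec l := by
      funext i
      simp only [hd, hT, Matrix.mulVec, dotProduct, Matrix.of_apply]
      rw [hp.form hv2]
      exact Finset.sum_congr rfl fun k _ => by ring
    rw [this]
    exact schur_mem ⟨hp.gam, hp.one.ge⟩ hTd
  have hfo := first_order hp'.gam hp'.one hdZ
  have hl' : ∀ i, l' i = dd (b' i) (dd (b' i) v) y := fun i => by rw [hp'.apply]; simp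
  have hr : ∀ i, 0 ≤ l' i + η - d i := fun i => by
    have := hy (b' i) x (b'.norm_eq_one i)
    rw [hl' i]; simp only [hd]; linarith
  set Q : ℝ := 2 * (Fintype.card ι + 1) * M with hQ
  have hQ0 : 0 < Q := by positivity
  have hF1 : ∀ i, 1 / Q ≤ es (Finset.univ.erase i) (j+1) l' := fun i => by
    have := ellip_lower hp'.gam hp'.one (C := M) (by linarith) (fun i _ => hl y b' l' hp' i) (Finset.mem_univ i)
    simpa [hQ] using this
  have hF2 : ∀ i, es (Finset.univ.erase i) (j+1) l' ≤ 2^Fintype.card ι * M^(j+1) := fun i =>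
    es_abs_le _ _ hM (hl y b' l' hp')
  have h1 : ∑ i, (l' i + η - d i) * (1/Q) ≤ ∑ i, (l' i + η - d i) * es (Finset.univ.erase i) (j+1) l' :=
    Finset.sum_le_sum fun i _ => mul_le_mul_of_nonneg_left (hF1 i) (hr i)
  have h2 : ∑ i, (l' i + η - d i) * es (Finset.univ.erase i) (j+1) l' =
      ∑ i, η * es (Finset.univ.erase i) (j+1) l' - ∑ i, (d i - l' i) * es (Finset.univ.erase i) (j+1) l' := by
    rw [← Finset.sum_sub_distrib]
    exact Finset.sum_congr rfl fun i _ => by ring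
  have h3 : ∑ i, η * es (Finset.univ.erase i) (j+1) l' ≤ η * (Fintype.card ι * (2^Fintype.card ι * M^(j+1))) := by
    rw [← Finset.mul_sum]
    refine mul_le_mul_of_nonneg_left ?_ hη.le
    refine (Finset.sum_le_sum fun i _ => hF2 i).trans ?_
    simp
  rw [← Finset.sum_mul] at h1
  have h4 : ∑ i, (l' i + η - d i) ≤ η * (Fintype.card ι * (2^Fintype.card ι * M^(j+1))) * Q := by
    rw [← div_le_iff₀ hQ0, div_eq_mul_one_div]
    linarith
  refine le_trans (le_of_eq ?_) h4
  rw [Finset.sum_sub_distrib, Finset.sum_sub_distrib, Finset.sum_add_distrib, Finset.sum_add_distrib,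
    hp'.trace h b0, hp.trace h b0]
  simp only [hd]
  rw [hp.trace h b']

lemma hess_const {ι : Type} [Fintype ι] [DecidableEq ι] {a b : ℝ} (h : Sol ι j K v) (hK : 0 < K) (ha : 0 < a) (hb : 0 < b)
    (hgr : ∀ x, a * ‖x‖^2 - b ≤ v x) (e x x' : E) (he : ‖e‖ = 1) : dd e (dd e v) x' ≤ dd e (dd e v) x := by
  obtain ⟨C, hC, hbd⟩ := hess_bound h hK ha hb hgr
  set M : ℝ := K + C + 1 with hM
  have hM1 : 1 ≤ M := by linarith
  have hl : ∀ x (b : OrthonormalBasis ι ℝ E) l, PtEig j K v x b l → ∀ i, |l i| ≤ M := by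
    intro x b l hp i
    have h1 := hbd x (b i) (b.norm_eq_one i)
    rw [hp.apply] at h1
    simp only [if_true] at h1
    rw [abs_le]
    constructor <;> linarith [hp.lb i]
  obtain ⟨b1, l1, hp1⟩ := h.pt 0
  have hcard := card_ge hp1.one
  have : Nonempty ι := Fintype.card_pos_iff.1 (by omega)
  obtain ⟨i0⟩ := this
  obtain ⟨b0, hb0⟩ : ∃ b0 : OrthonormalBasis ι ℝ E, b0 i0 = e := by
    obtain ⟨b0, hb0⟩ := Orthonormal.exists_orthonormalBasis_extension_of_card_eq (𝕜 := ℝ)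
      (Module.finrank_eq_card_basis b1.toBasis) (v := fun _ : ι => e) (s := {i0}) (by
        refine ⟨fun i => by simpa using he, fun i k hik => ?_⟩
        exact absurd (Subtype.ext (i.2.trans k.2.symm)) hik)
    exact ⟨b0, hb0 i0 rfl⟩
  set Q : ℝ := (Fintype.card ι * (2^Fintype.card ι * M^(j+1))) * (2 * (Fintype.card ι + 1) * M) with hQ
  have hQ0 : 0 ≤ Q := by positivity
  refine le_of_forall_pos_le_add fun ε hε => ?_
  have hη : 0 < ε / (Q+1) := by positivity
  obtain ⟨y, hy⟩ := exists_near_max h hK hC hbd hη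
  have h1 := compare_xy h hM1 hl hy hη x b0
  have h2 := Finset.single_le_sum (f := fun i => dd (b0 i) (dd (b0 i) v) y + ε/(Q+1) - dd (b0 i) (dd (b0 i) v) x)
    (fun i _ => by have := hy (b0 i) x (b0.norm_eq_one i); linarith) (Finset.mem_univ i0)
  simp only [hb0] at h2
  have h3 := hy e x' he
  have h4 : ε / (Q+1) * (Fintype.card ι * (2^Fintype.card ι * M^(j+1))) * (2 * (Fintype.card ι + 1) * M) ≤ ε := by
    rw [mul_assoc, ← hQ, div_mul_eq_mul_div, div_le_iff₀ (by positivity)]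
    nlinarith
  linarith
end
section reduction
variable {n : ℕ}

abbrev EO (n : ℕ) := EuclideanSpace ℝ (Option (Fin n))

def prL (n : ℕ) : EO n →L[ℝ] (Fin n → ℝ) :=
  ContinuousLinearMap.pi fun i => EuclideanSpace.proj (some i)

def nnL (n : ℕ) : EO n →L[ℝ] ℝ := EuclideanSpace.proj none

lemma prL_apply (y : EO n) (i : Fin n) : prL n y i = y (some i) := rfl
lemma nnL_apply (y : EO n) : nnL n y = y none := rfl

def ext0 (x : Fin n → ℝ) : EO n := WithLp.toLp 2 fun o => o.elim 0 x

lemma prL_ext0 (x : Fin n → ℝ) : prL n (ext0 x) = x := by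
  funext i; rfl
lemma nnL_ext0 (x : Fin n → ℝ) : nnL n (ext0 x) = 0 := rfl

def vv (α : ℝ) (u : (Fin n → ℝ) → ℝ) : EO n → ℝ := fun y => u (prL n y) + α / 2 * (nnL n y)^2

lemma vv_contDiff {α : ℝ} {u : (Fin n → ℝ) → ℝ} (hu : ContDiff ℝ 4 u) : ContDiff ℝ 4 (vv α u) :=
  (hu.comp (prL n).contDiff).add (contDiff_const.mul ((nnL n).contDiff.pow 2))

lemma dd_vv {α : ℝ} {u : (Fin n → ℝ) → ℝ} (hu : ContDiff ℝ 4 u) (c y : EO n) :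
    dd c (vv α u) y = fderiv ℝ u (prL n y) (prL n c) + α * nnL n y * nnL n c := by
  have h1 : HasFDerivAt (fun y => u (prL n y)) _ y :=
    ((hu.differentiable (by norm_num) (prL n y)).hasFDerivAt).comp y (prL n).hasFDerivAt
  have h2 := h1.add ((((nnL n).hasFDerivAt (x := y)).pow 2).const_mul (α/2))
  have h3 : fderiv ℝ (vv α u) y = _ := h2.fderiv
  unfold dd
  rw [h3]
  simp
  ring

lemma dd2_vv {α : ℝ} {u : (Fin n → ℝ) → ℝ} (hu : ContDiff ℝ 4 u) (d c y : EO n) :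
    dd d (dd c (vv α u)) y = fderiv ℝ (fderiv ℝ u) (prL n y) (prL n d) (prL n c) + α * nnL n d * nnL n c := by
  have h0 : dd c (vv α u) = fun y => fderiv ℝ u (prL n y) (prL n c) + (α * nnL n c) * nnL n y := by
    funext y; rw [dd_vv hu]; ring
  have hd : HasFDerivAt (fderiv ℝ u) (fderiv ℝ (fderiv ℝ u) (prL n y)) (prL n y) :=
    ((hu.fderiv_right (m := 1) (by norm_num)).differentiable one_ne_zero _).hasFDerivAt
  have h1 := (hd.comp y (prL n).hasFDerivAt).clm_apply (hasFDerivAt_const (prL n c) y)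
  have h2 := h1.add (((nnL n).hasFDerivAt (x := y)).const_mul (α * nnL n c))
  have h3 : fderiv ℝ (fun y => fderiv ℝ u (prL n y) (prL n c) + (α * nnL n c) * nnL n y) y = _ := h2.fderiv
  rw [h0]
  unfold dd
  rw [h3]
  simp
  ring

lemma D2_hess (u : (Fin n → ℝ) → ℝ) (x a c : Fin n → ℝ) :
    fderiv ℝ (fderiv ℝ u) x a c = ∑ i, ∑ k, hess u x i k * a i * c k := by
  have ha : a = ∑ i, a i • Pi.single i (1:ℝ) := by
    funext k; simp [Finset.sum_apply, Pi.single_apply]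
  have hc : c = ∑ i, c i • Pi.single i (1:ℝ) := by
    funext k; simp [Finset.sum_apply, Pi.single_apply]
  conv_lhs => rw [ha, hc]
  simp only [map_sum, map_smul, FunLike.coe_sum, Finset.sum_apply, FunLike.coe_smul, Pi.smul_apply, smul_eq_mul]
  refine Eq.trans ?_ Finset.sum_comm
  refine Finset.sum_congr rfl fun i _ => ?_
  rw [Finset.mul_sum]
  refine Finset.sum_congr rfl fun k _ => ?_
  simp [hess, iteratedFDeriv_two_apply]
  ring

lemma es_option (l : Fin n → ℝ) (α : ℝ) (j : ℕ) :
    es Finset.univ (j+1) (fun o : Option (Fin n) => o.elim α l) =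
      es Finset.univ (j+1) l + α * es Finset.univ j l := by
  have h1 : (Finset.univ : Finset (Option (Fin n))) = insert none (Finset.univ.map Function.Embedding.some) := by
    ext o; cases o <;> simp
  have h2 : ∀ j, es (Finset.univ.map Function.Embedding.some) j (fun o : Option (Fin n) => o.elim α l) = es Finset.univ j l := by
    intro j
    unfold es
    rw [Finset.powersetCard_map, Finset.sum_map]
    refine Finset.sum_congr rfl fun s _ => ?_
    simp
  rw [h1, es_insert _ (by simp), h2, h2]
  rfl

lemma esymmR_es (j : ℕ) (l : Fin n → ℝ) : esymmR (j : ℤ) l = es Finset.univ j l := by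
  simp [esymmR, sigmaOn, es]

lemma vv_sol {j : ℕ} {α : ℝ} (hα : 0 < α)
    (u : (Fin n → ℝ) → ℝ) (hu : ContDiff ℝ 4 u)
    (hherm : ∀ x, (hess u x).IsHermitian)
    (hconv : ∀ x, (hherm x).eigenvalues ∈ GammaCone n (j + 1))
    (K₀ : ℝ) (hK₀ : 0 < K₀)
    (hsemi : ∀ x (i : Fin n), -K₀ < (hherm x).eigenvalues i)
    (heq : ∀ x, esymmR ((j + 2 : ℕ) : ℤ) (hherm x).eigenvalues
        + α * esymmR ((j + 1 : ℕ) : ℤ) (hherm x).eigenvalues = 1) :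
    Sol (Option (Fin n)) j K₀ (vv α u) := by
  refine ⟨vv_contDiff hu, fun y => ?_⟩
  set x := prL n y with hx
  set l := (hherm x).eigenvalues with hl
  set V := (hherm x).eigenvectorBasis with hV
  set w : Option (Fin n) → EO n := fun o => o.elim (EuclideanSpace.single none 1) (fun i => ext0 (V i)) with hw
  have hin : ∀ (p q : EO n), inner ℝ p q = (∑ i, prL n p i * prL n q i) + nnL n p * nnL n q := by
    intro p q
    rw [PiLp.inner_apply, Fintype.sum_option]
    simp [prL_apply, nnL_apply, mul_comm, add_comm]
  have hpn : prL n (EuclideanSpace.single none 1) = 0 := by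
    funext i; simp [prL_apply]
  have hnn : nnL n (EuclideanSpace.single none 1) = 1 := by
    simp [nnL_apply]
  have hVV : ∀ i k, ∑ m, V i m * V k m = if i = k then 1 else 0 := by
    intro i k
    have := orthonormal_iff_ite.1 V.orthonormal i k
    rw [← this, PiLp.inner_apply]
    simp [mul_comm]
  have hwo : Orthonormal ℝ w := by
    rw [orthonormal_iff_ite]
    intro p q
    rw [hin]
    rcases p with _ | p <;> rcases q with _ | q
    · simp [hw, hpn, hnn]
    · simp [hw, hpn, nnL_ext0]
    · simp [hw, hpn, nnL_ext0]
    · simp [hw, prL_ext0, nnL_ext0, hVV]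
  obtain ⟨bb, hbb⟩ := Orthonormal.exists_orthonormalBasis_extension_of_card_eq (𝕜 := ℝ)
    (ι := Option (Fin n)) (E := EO n) (by simp) (v := w) (s := Set.univ) (by
      exact hwo.comp _ Subtype.val_injective)
  have hbw : ∀ o, bb o = w o := fun o => hbb o trivial
  refine ⟨bb, fun o => o.elim α l, ?_, ?_, ?_, ?_⟩
  · ext p q
    simp only [Hb, Matrix.of_apply, hbw]
    rw [dd2_vv hu, D2_hess, ← hx]
    rcases p with _ | p <;> rcases q with _ | q
    · simp [hw, hpn, hnn]
    · simp [hw, hpn, nnL_ext0]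
    · simp [hw, hpn, nnL_ext0]
    · simp only [hw, Option.elim, prL_ext0, nnL_ext0, mul_zero, add_zero, Matrix.diagonal_apply, Option.some.injEq]
      have h1 : ∀ i, ∑ k, hess u x i k * V q k = l q * V q i := by
        intro i
        have := congrFun ((hherm x).mulVec_eigenvectorBasis q) i
        simpa [Matrix.mulVec, dotProduct] using this
      have h2 : ∀ i, ∑ k, hess u x i k * V p i * V q k = l q * (V p i * V q i) := by
        intro i
        calc _ = V p i * ∑ k, hess u x i k * V q k := by
              rw [Finset.mul_sum]; exact Finset.sum_congr rfl fun k _ => by ring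
          _ = _ := by rw [h1]; ring
      rw [Finset.sum_congr rfl fun i _ => h2 i, ← Finset.mul_sum, hVV]
      by_cases hpq : p = q <;> simp [hpq]
  · intro m hm
    rcases m with _ | m
    · simp [es_zero]
    rw [es_option]
    have hp : ∀ i, i ≤ j+1 → 0 < es Finset.univ i l := by
      intro i hi
      rcases i with _ | i
      · simp [es_zero]
      · have := hconv x (i+1) (by omega) hi
        rwa [esymmR_es] at this
    by_cases hmj : m + 1 ≤ j + 1
    · have := hp (m+1) hmj
      have := hp m (by omega)
      positivity
    · have : m = j + 1 := by omega
      subst this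
      have := heq x
      rw [esymmR_es, esymmR_es] at this
      rw [this]; norm_num
  · rw [es_option]
    have := heq x
    rwa [esymmR_es, esymmR_es] at this
  · intro i
    rcases i with _ | i
    · show -K₀ ≤ α
      linarith
    · exact (hsemi x i).le

lemma vv_growth {α : ℝ} (hα : 0 < α) (u : (Fin n → ℝ) → ℝ) (hu : Continuous u)
    (a b R : ℝ) (ha : 0 < a) (hb : 0 < b) (hR : 0 < R)
    (hgrowth : ∀ x, R ≤ eucNorm x → a * (eucNorm x) ^ 2 - b ≤ u x) :
    ∃ a' b' : ℝ, 0 < a' ∧ 0 < b' ∧ ∀ y : EO n, a' * ‖y‖^2 - b' ≤ vv α u y := by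
  have hE : ∀ x : Fin n → ℝ, eucNorm x ^2 = ∑ i, x i^2 := fun x =>
    Real.sq_sqrt (Finset.sum_nonneg fun i _ => sq_nonneg _)
  have hE0 : ∀ x : Fin n → ℝ, 0 ≤ eucNorm x := fun x => Real.sqrt_nonneg _
  obtain ⟨C, hC⟩ := (isCompact_closedBall (0 : Fin n → ℝ) R).exists_bound_of_continuousOn hu.continuousOn
  have hC' : ∀ x : Fin n → ℝ, eucNorm x ≤ R → |u x| ≤ |C| := by
    intro x hx
    refine (hC x ?_).trans (le_abs_self C)
    rw [mem_closedBall_zero_iff, pi_norm_le_iff_of_nonneg hR.le]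
    intro i
    refine le_trans ?_ hx
    rw [Real.norm_eq_abs]
    apply Real.abs_le_sqrt
    exact Finset.single_le_sum (f := fun i => x i^2) (fun i _ => sq_nonneg _) (Finset.mem_univ i)
  have hux : ∀ x : Fin n → ℝ, a * ∑ i, x i^2 - (b + |C| + a * R^2) ≤ u x := by
    intro x
    rw [← hE]
    rcases le_total R (eucNorm x) with h | h
    · have := hgrowth x h
      have : 0 ≤ a * R^2 := by positivity
      linarith [abs_nonneg C]
    · have h1 := neg_le_of_abs_le (hC' x h)
      have h2 : a * eucNorm x^2 ≤ a * R^2 :=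
        mul_le_mul_of_nonneg_left (pow_le_pow_left₀ (hE0 x) h 2) ha.le
      linarith
  refine ⟨min a (α/2), b + |C| + a * R^2, lt_min ha (by positivity), by positivity, fun y => ?_⟩
  rw [EuclideanSpace.norm_sq_eq, Fintype.sum_option]
  have h1 := hux (prL n y)
  have h2 : min a (α/2) * (∑ i, (prL n y i)^2) ≤ a * ∑ i, (prL n y i)^2 :=
    mul_le_mul_of_nonneg_right (min_le_left _ _) (Finset.sum_nonneg fun i _ => sq_nonneg _)
  have h3 : min a (α/2) * (nnL n y)^2 ≤ α/2 * (nnL n y)^2 :=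
    mul_le_mul_of_nonneg_right (min_le_right _ _) (sq_nonneg _)
  simp only [Real.norm_eq_abs, sq_abs]
  unfold vv
  simp only [prL_apply, nnL_apply] at h1 h2 h3 ⊢
  linarith

lemma taylor_line {E : Type*} [NormedAddCommGroup E] [InnerProductSpace ℝ E] [FiniteDimensional ℝ E]
    {v : E → ℝ} (hv : ContDiff ℝ 4 v) (e : E) (c : ℝ)
    (hc : ∀ x, dd e (dd e v) x = c) : v e = v 0 + dd e v 0 + c / 2 := by
  have hv1 : ContDiff ℝ 1 v := hv.of_le (by norm_num)
  have hv2 : ContDiff ℝ 1 (dd e v) := dd_contDiff hv (by norm_num) e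
  have h1 : ∀ s : ℝ, HasDerivAt (fun s : ℝ => dd e v (0 + s • e) - c * s) 0 s := by
    intro s
    have h := (dd_line hv2 0 e s).fun_sub ((hasDerivAt_id s).const_mul c)
    refine h.congr_deriv ?_
    rw [hc]; simp
  have h2 : ∀ s : ℝ, dd e v (0 + s • e) - c * s = dd e v 0 := by
    intro s
    have := is_const_of_deriv_eq_zero (fun s => (h1 s).differentiableAt) (fun s => (h1 s).deriv) s 0
    simpa using this
  have h3 : ∀ s : ℝ, HasDerivAt (fun s : ℝ => v (0 + s • e) - dd e v 0 * s - c/2 * s^2) 0 s := by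
    intro s
    have h := ((dd_line hv1 0 e s).fun_sub ((hasDerivAt_id s).const_mul (dd e v 0))).fun_sub
      (((hasDerivAt_id s).pow 2).const_mul (c/2))
    refine h.congr_deriv ?_
    have := h2 s
    simp
    rw [zero_add] at this
    linarith
  have := is_const_of_deriv_eq_zero (fun s => (h3 s).differentiableAt) (fun s => (h3 s).deriv) 1 0
  simp at this
  linarith

lemma final_aux {j : ℕ} (α : ℝ) (hα : 0 < α)
    (u : (Fin n → ℝ) → ℝ) (hu : ContDiff ℝ 4 u)
    (hherm : ∀ x, (hess u x).IsHermitian)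
    (hconv : ∀ x, (hherm x).eigenvalues ∈ GammaCone n (j + 1))
    (K₀ : ℝ) (hK₀ : 0 < K₀)
    (hsemi : ∀ x (i : Fin n), -K₀ < (hherm x).eigenvalues i)
    (heq : ∀ x, esymmR ((j + 2 : ℕ) : ℤ) (hherm x).eigenvalues
        + α * esymmR ((j + 1 : ℕ) : ℤ) (hherm x).eigenvalues = 1)
    (a b R : ℝ) (ha : 0 < a) (hb : 0 < b) (hR : 0 < R)
    (hgrowth : ∀ x, R ≤ eucNorm x → a * (eucNorm x) ^ 2 - b ≤ u x) :
    ∃ (A : Matrix (Fin n) (Fin n) ℝ) (bv : Fin n → ℝ) (c : ℝ), A.IsSymm ∧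
      ∀ x : Fin n → ℝ,
        u x = (1 / 2) * (∑ i, ∑ j, A i j * x i * x j) + (∑ i, bv i * x i) + c := by
  have hs := vv_sol hα u hu hherm hconv K₀ hK₀ hsemi heq
  obtain ⟨a', b', ha', hb', hg⟩ := vv_growth hα u hu.continuous a b R ha hb hR hgrowth
  have hconst : ∀ e x : EO n, dd e (dd e (vv α u)) x = dd e (dd e (vv α u)) 0 := by
    intro e x
    by_cases he : e = 0
    · subst he; rw [dd2_vv hu, dd2_vv hu]; simp
    have hn : ‖e‖ ≠ 0 := norm_ne_zero_iff.2 he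
    set e1 : EO n := ‖e‖⁻¹ • e with he1
    have h1 : ‖e1‖ = 1 := by rw [he1, norm_smul]; simp [hn]
    have h2 : dd e1 (dd e1 (vv α u)) x = dd e1 (dd e1 (vv α u)) 0 :=
      le_antisymm (hess_const hs hK₀ ha' hb' hg e1 0 x h1) (hess_const hs hK₀ ha' hb' hg e1 x 0 h1)
    have h3 : e = ‖e‖ • e1 := by rw [he1, smul_smul, mul_inv_cancel₀ hn, one_smul]
    rw [dd2_vv hu, dd2_vv hu] at h2 ⊢
    rw [h3]
    simp only [map_smul, FunLike.coe_smul, Pi.smul_apply, smul_eq_mul]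
    linear_combination (‖e‖ * ‖e‖) * h2
  refine ⟨hess u 0, fun i => fderiv ℝ u 0 (Pi.single i 1), u 0, ?_, fun x => ?_⟩
  · have := hherm 0
    rw [Matrix.IsHermitian, Matrix.conjTranspose_eq_transpose_of_trivial] at this
    exact this
  · have h := taylor_line (vv_contDiff (α := α) hu) (ext0 x) _ (hconst (ext0 x))
    rw [dd2_vv hu, dd_vv hu, D2_hess] at h
    simp only [vv, prL_ext0, nnL_ext0, map_zero] at h
    have hx : fderiv ℝ u 0 x = ∑ i, fderiv ℝ u 0 (Pi.single i 1) * x i := by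
      have hx : x = ∑ i, x i • Pi.single i (1:ℝ) := by
        funext k; simp [Finset.sum_apply, Pi.single_apply]
      conv_lhs => rw [hx]
      simp only [map_sum, map_smul, smul_eq_mul]
      exact Finset.sum_congr rfl fun i _ => mul_comm _ _
    rw [hx] at h
    linarith
end reduction

/-- **Rigidity theorem for the elliptic sum Hessian equation** (Theorem 1.3):
an entire `(k-1)`-convex, semi-convex solution of
`σ_k(λ(D²u)) + α σ_{k-1}(λ(D²u)) = 1` on `ℝⁿ` with quadratic growth
must be a quadratic polynomial. -/
theorem rigidity_elliptic_sum_hessian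
    {n k : ℕ} (hk : 2 ≤ k) (hkn : k ≤ n) (α : ℝ) (hα : 0 < α)
    (u : (Fin n → ℝ) → ℝ) (hu : ContDiff ℝ 4 u)
    -- the Hessian of `u` is symmetric (true for `C²` functions), with
    -- eigenvalue vector `(hherm x).eigenvalues`
    (hherm : ∀ x, (hess u x).IsHermitian)
    -- `u` is `(k-1)`-convex
    (hconv : ∀ x, (hherm x).eigenvalues ∈ GammaCone n (k - 1))
    -- `u` is semi-convex with constant `K₀`
    (K₀ : ℝ) (hK₀ : 0 < K₀)
    (hsemi : ∀ x (i : Fin n), -K₀ < (hherm x).eigenvalues i)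
    -- `u` solves the sum Hessian equation on all of `ℝⁿ`
    (heq : ∀ x, esymmR (k : ℤ) (hherm x).eigenvalues
        + α * esymmR ((k : ℤ) - 1) (hherm x).eigenvalues = 1)
    -- quadratic growth condition
    (a b R : ℝ) (ha : 0 < a) (hb : 0 < b) (hR : 0 < R)
    (hgrowth : ∀ x, R ≤ eucNorm x → a * (eucNorm x) ^ 2 - b ≤ u x) :
    ∃ (A : Matrix (Fin n) (Fin n) ℝ) (bv : Fin n → ℝ) (c : ℝ), A.IsSymm ∧
      ∀ x : Fin n → ℝ,
        u x = (1 / 2) * (∑ i, ∑ j, A i j * x i * x j) + (∑ i, bv i * x i) + c := by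
  obtain ⟨j, rfl⟩ : ∃ j, k = j + 2 := ⟨k - 2, by omega⟩
  refine final_aux (j := j) α hα u hu hherm hconv K₀ hK₀ hsemi (fun x => ?_) a b R ha hb hR hgrowth
  have h := heq x
  have e1 : ((j + 2 : ℕ) : ℤ) - 1 = ((j + 1 : ℕ) : ℤ) := by push_cast; ring
  rwa [e1] at h
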